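/- Arbitrarily varying null versus arbitrarily varying alternative. Let ℋ = ℂ^d be a finite-dimensional Hilbert space and 𝒜₁, ℬ₁ ⊆ 𝒟(ℋ) two non-empty closed sets of states. Then Stein(𝒜₁^{av}‖ℬ₁^{av}) = Stein(𝒜₁^{av}‖co(ℬ₁)^{av}) = Stein(𝒜₁^{av}‖co(ℬ₁)^{iid}) = min*_{μ∈𝒫(co(ℬ₁))} lim_{n→∞} (1/n) inf_{ρ_n ∈ co(𝒜₁^{⊗n,av})} D(ρ_n ‖ ∫_{co(ℬ₁)} dμ(σ) σ^{⊗n}), where the minimum is restricted to those μ for which the inner limit in n exists (a non-empty set on which the minimum is attained). -/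

import Mathlib

open Filter MeasureTheory Topology
open scoped BigOperators Classical ComplexOrder

noncomputable section

namespace QSanov

/-- Matrices representing operators on the single-copy Hilbert space with orthonormal
basis indexed by `ι`. -/
abbrev MatC (ι : Type*) := Matrix ι ι ℂ

/-- Matrices representing operators on the `n`-fold tensor power Hilbert space. -/
abbrev MatN (ι : Type*) (n : ℕ) := Matrix (Fin n → ι) (Fin n → ι) ℂ

instance matMeasurableSpace (m n : Type*) : MeasurableSpace (Matrix m n ℂ) :=
  inferInstanceAs (MeasurableSpace (m → n → ℂ))

/-- A quantum state: a positive semidefinite matrix of trace one. -/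
def IsState {κ : Type*} [Fintype κ] (ρ : Matrix κ κ ℂ) : Prop :=
  ρ.PosSemidef ∧ ρ.trace = 1

/-- Loewner order: `A ≤ B` iff `B - A` is positive semidefinite. -/
def loewnerLE {κ : Type*} [Fintype κ] (A B : Matrix κ κ ℂ) : Prop :=
  (B - A).PosSemidef

/-- The `n`-fold tensor power `ρ^{⊗n}` of a single-copy matrix. -/
def tensorPow {ι : Type*} (ρ : MatC ι) (n : ℕ) : MatN ι n :=
  fun i j => ∏ k, ρ (i k) (j k)

/-- The tensor product `ρ₁ ⊗ ⋯ ⊗ ρ_n` of a family of single-copy matrices. -/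
def tensorProdFam {ι : Type*} {n : ℕ} (ρ : Fin n → MatC ι) : MatN ι n :=
  fun i j => ∏ k, ρ k (i k) (j k)

/-- The tensor product of an `n`-copy matrix and an `m`-copy matrix. -/
def tensorMul {ι : Type*} {n m : ℕ} (ρ : MatN ι n) (σ : MatN ι m) : MatN ι (n + m) :=
  fun i j => ρ (fun t => i (Fin.castAdd m t)) (fun t => j (Fin.castAdd m t)) *
    σ (fun t => i (Fin.natAdd n t)) (fun t => j (Fin.natAdd n t))

/-- Conjugation `U_π ρ U_π†` by the unitary permuting the `n` tensor factors. -/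
def permCopies {ι : Type*} {n : ℕ} (π : Equiv.Perm (Fin n)) (ρ : MatN ι n) : MatN ι n :=
  fun i j => ρ (i ∘ π) (j ∘ π)

/-- Matrix logarithm via functional calculus on the support (eigenvalue `0` is sent
to `0`, since `Real.log 0 = 0`). -/
def matLog {κ : Type*} [Fintype κ] [DecidableEq κ] (A : Matrix κ κ ℂ) : Matrix κ κ ℂ :=
  if hA : A.IsHermitian then
    (hA.eigenvectorUnitary : Matrix κ κ ℂ) *
      (Matrix.diagonal fun i => (Real.log (hA.eigenvalues i) : ℂ)) *
      (star (hA.eigenvectorUnitary : Matrix κ κ ℂ))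
  else 0

/-- Support inclusion `supp ρ ⊆ supp σ`, phrased as inclusion of ranges. -/
def suppLE {κ : Type*} [Fintype κ] [DecidableEq κ] (ρ σ : Matrix κ κ ℂ) : Prop :=
  LinearMap.range (Matrix.toLin' ρ) ≤ LinearMap.range (Matrix.toLin' σ)

/-- Umegaki relative entropy `D(ρ‖σ) = Tr[ρ (log ρ - log σ)]`, equal to `+∞` when
`supp ρ ⊄ supp σ`. -/
def relEnt {κ : Type*} [Fintype κ] [DecidableEq κ] (ρ σ : Matrix κ κ ℂ) : EReal :=
  if suppLE ρ σ then (((ρ * (matLog ρ - matLog σ)).trace.re : ℝ) : EReal) else ⊤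

/-- Relative entropy between two sets of states: `D(𝒜‖ℬ) = inf_{ρ∈𝒜, σ∈ℬ} D(ρ‖σ)`. -/
def relEntSet {κ : Type*} [Fintype κ] [DecidableEq κ] (A B : Set (Matrix κ κ ℂ)) : EReal :=
  ⨅ ρ ∈ A, ⨅ σ ∈ B, relEnt ρ σ

/-- The composite i.i.d. hypothesis `𝒻₁^{⊗n, iid}` built on the base set `F1`. -/
def iidSet {ι : Type*} (F1 : Set (MatC ι)) (n : ℕ) : Set (MatN ι n) :=
  {ρ | ∃ σ ∈ F1, ρ = tensorPow σ n}

/-- The arbitrarily varying hypothesis `𝒻₁^{⊗n, av}` built on the base set `F1`. -/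
def avSet {ι : Type*} (F1 : Set (MatC ι)) (n : ℕ) : Set (MatN ι n) :=
  {ρ | ∃ f : Fin n → MatC ι, (∀ p, f p ∈ F1) ∧ ρ = tensorProdFam f}

/-- Worst-case type II error probability `β_ε(A‖B)` for a threshold `ε` on the
worst-case type I error probability. -/
def typeII {κ : Type*} [Fintype κ] [DecidableEq κ] (A B : Set (Matrix κ κ ℂ)) (ε : ℝ) : ℝ :=
  sInf {b : ℝ | ∃ E : Matrix κ κ ℂ, E.PosSemidef ∧ (1 - E).PosSemidef ∧
    (∀ ρ ∈ A, (ρ * (1 - E)).trace.re ≤ ε) ∧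
    b = sSup {x : ℝ | ∃ σ ∈ B, x = (σ * E).trace.re}}

/-- `- log x`, with value `+∞` for `x ≤ 0`. -/
def negLog (x : ℝ) : EReal := if x ≤ 0 then ⊤ else ((-Real.log x : ℝ) : EReal)

/-- `(1/n : EReal)`. -/
def cFrac (n : ℕ) : EReal := (((n : ℝ)⁻¹ : ℝ) : EReal)

/-- The Stein exponent `Stein(𝒜‖ℬ) = lim_{ε→0⁺} liminf_n -(1/n) log β_ε(𝒜_n‖ℬ_n)`;
since the inner quantity is monotone nondecreasing in `ε`, the limit as `ε → 0⁺`
coincides with the infimum over `ε ∈ (0,1)`. -/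
def steinExponent {ι : Type*} [Fintype ι] [DecidableEq ι]
    (A B : ∀ n : ℕ, Set (MatN ι n)) : EReal :=
  ⨅ ε ∈ Set.Ioo (0 : ℝ) 1,
    Filter.liminf (fun n : ℕ => cFrac n * negLog (typeII (A n) (B n) ε)) Filter.atTop

/-- The mixture `∫ dμ(σ) σ^{⊗n}` of i.i.d. states along a measure `μ` on a set of
states `C` (Bochner integral, computed entrywise). -/
def iidMix {ι : Type*} {C : Set (MatC ι)} (μ : Measure ↥C) (n : ℕ) : MatN ι n :=
  fun i j => ∫ σ, (∏ k, (σ : MatC ι) (i k) (j k)) ∂μ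

/-- The `b`-th block of size `k` of an index of `ℋ^{⊗ mk}`. -/
def blockOf {ι : Type*} {m k : ℕ} (i : Fin (m * k) → ι) (b : Fin m) : Fin k → ι :=
  fun t => i (finProdFinEquiv (b, t))

/-- Replace the blocks in `S` of the index `i` by the values prescribed by `c`. -/
def mergeBlocks {ι : Type*} {m k : ℕ} (S : Finset (Fin m)) (c : Fin m → Fin k → ι)
    (i : Fin (m * k) → ι) : Fin (m * k) → ι :=
  fun p => if (finProdFinEquiv.symm p).1 ∈ S
    then c (finProdFinEquiv.symm p).1 (finProdFinEquiv.symm p).2 else i p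

/-- Entry `(i,j)` of the partial trace of `ρ` over the blocks in `S`
(the remaining blocks being evaluated at `i`, `j`). -/
def blockPartialTrace {ι : Type*} [Fintype ι] {m k : ℕ} (S : Finset (Fin m))
    (ρ : MatN ι (m * k)) (i j : Fin (m * k) → ι) : ℂ :=
  (((Fintype.card ι : ℂ) ^ (k * (m - S.card)))⁻¹) *
    ∑ c : Fin m → Fin k → ι, ρ (mergeBlocks S c i) (mergeBlocks S c j)

/-- The `m`-fold tensor power `(𝒩^δ_ω)^{⊗ m}` of the depolarising channel
`𝒩^δ_ω(X) = (1-δ) X + δ Tr[X] ω`, acting blockwise on blocks of `k` tensor factors. -/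
def blockDepolarize {ι : Type*} [Fintype ι] (δ : ℝ) {k : ℕ} (ω : MatN ι k) (m : ℕ)
    (ρ : MatN ι (m * k)) : MatN ι (m * k) :=
  fun i j => ∑ S : Finset (Fin m),
    (((1 - δ) ^ (m - S.card) * δ ^ S.card : ℝ) : ℂ) *
      ((∏ b ∈ S, ω (blockOf i b) (blockOf j b)) * blockPartialTrace S ρ i j)

/-- The `m`-fold tensor power of a `k`-copy matrix, as an `mk`-copy matrix. -/
def powBlocks {ι : Type*} {k : ℕ} (ρ : MatN ι k) (m : ℕ) : MatN ι (m * k) :=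
  fun i j => ∏ b : Fin m, ρ (blockOf i b) (blockOf j b)

/-- `Tr_{n+1,…,n+k}[ρ (𝟙^{⊗n} ⊗ F)]`, the filtered reduction of an `(n+k)`-copy matrix. -/
def condReduce {ι : Type*} [Fintype ι] {n k : ℕ} (ρ : MatN ι (n + k)) (F : MatN ι k) :
    MatN ι n :=
  fun i j => ∑ a : Fin k → ι, ∑ b : Fin k → ι,
    ρ (Fin.append i a) (Fin.append j b) * F b a

/-- Partial trace over the `k`-th tensor factor. -/
def traceOutAt {ι : Type*} [Fintype ι] {n : ℕ} (k : Fin (n + 1)) (σ : MatN ι (n + 1)) :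
    MatN ι n :=
  fun i j => ∑ a : ι, σ (k.insertNth a i) (k.insertNth a j)

/-- Insert the single-copy state `τ` at position `k` into an `n`-copy matrix. -/
def insertState {ι : Type*} {n : ℕ} (k : Fin (n + 1)) (τ : MatC ι) (σ : MatN ι n) :
    MatN ι (n + 1) :=
  fun i j => τ (i k) (j k) *
    σ (fun t => i (k.succAbove t)) (fun t => j (k.succAbove t))

/-- Product of a state on `A^n` and a state on `B^n`, viewed as a state on
`(ℋ_A ⊗ ℋ_B)^{⊗ n}` (reordering tensor factors implicitly). -/
def prodStateAB {ιA ιB : Type*} {n : ℕ} (α : Matrix (Fin n → ιA) (Fin n → ιA) ℂ)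
    (β : Matrix (Fin n → ιB) (Fin n → ιB) ℂ) : MatN (ιA × ιB) n :=
  fun i j => α (fun k => (i k).1) (fun k => (j k).1) * β (fun k => (i k).2) (fun k => (j k).2)


/-- The set `𝒮_{A^n:B^n}` of separable states across the cut `A^n : B^n`. -/
def sepSet (ιA ιB : Type*) [Fintype ιA] [Fintype ιB] (n : ℕ) : Set (MatN (ιA × ιB) n) :=
  convexHull ℝ {ρ | ∃ α β, IsState α ∧ IsState β ∧ ρ = prodStateAB α β}

/-- Classical relative entropy of two finitely supported output distributions. -/
def clRelEnt {m : ℕ} (P Q : Fin m → ℝ) : EReal :=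
  ∑ x, (if P x = 0 then (0 : EReal) else if Q x = 0 then (⊤ : EReal)
    else ((P x * Real.log (P x / Q x) : ℝ) : EReal))

/-- Measured relative entropy: supremum over all finite POVMs of the classical
relative entropy of the induced outcome distributions. -/
def measuredRelEnt {κ : Type*} [Fintype κ] [DecidableEq κ] (ρ σ : Matrix κ κ ℂ) : EReal :=
  ⨆ (m : ℕ) (E : Fin m → Matrix κ κ ℂ) (_ : ∀ x, (E x).PosSemidef) (_ : ∑ x, E x = 1),
    clRelEnt (fun x => (ρ * E x).trace.re) (fun x => (σ * E x).trace.re)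


/-- Axiom Q.I: there is a full-support free state `τ ∈ 𝒜₁` such that every `𝒜_{mk}`
is stable under blockwise depolarising towards `τ^{⊗k}`. -/
def AxiomQI {ι : Type*} [Fintype ι] [DecidableEq ι] (A : ∀ n : ℕ, Set (MatN ι n)) : Prop :=
  ∃ τ : MatC ι, tensorPow τ 1 ∈ A 1 ∧
    ∀ m k : ℕ, 1 ≤ m → 1 ≤ k → ∀ ρ ∈ A (m * k),
      suppLE ρ (tensorPow τ (m * k)) ∧
      ∀ δ ∈ Set.Icc (0 : ℝ) 1, blockDepolarize δ (tensorPow τ k) m ρ ∈ A (m * k)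

/-- Axiom Q.II: closedness under tensor powers. -/
def AxiomQII {ι : Type*} (A : ∀ n : ℕ, Set (MatN ι n)) : Prop :=
  ∀ m k : ℕ, 1 ≤ m → 1 ≤ k → ∀ ρ ∈ A k, powBlocks ρ m ∈ A (m * k)

/-- Axiom Q.III: closedness under permutations of the tensor factors. -/
def AxiomQIII {ι : Type*} (A : ∀ n : ℕ, Set (MatN ι n)) : Prop :=
  ∀ n : ℕ, ∀ ρ ∈ A n, ∀ π : Equiv.Perm (Fin n), permCopies π ρ ∈ A n

/-- Axiom Q.IV: filtering by Hermitian operators in a neighbourhood of the identity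
is completely `cone(𝒜)`-preserving. -/
def AxiomQIV {ι : Type*} [Fintype ι] [DecidableEq ι] (A : ∀ n : ℕ, Set (MatN ι n)) : Prop :=
  ∀ k : ℕ, 1 ≤ k →
    ∃ V : Set (MatN ι k), V ∈ nhds (1 : MatN ι k) ∧
      ∀ F ∈ V, F.IsHermitian → ∀ n : ℕ, 1 ≤ n → ∀ ρ ∈ A (n + k),
        ∃ (lam : ℝ) (ω : MatN ι n), 0 ≤ lam ∧ ω ∈ A n ∧ condReduce ρ F = (lam : ℂ) • ω


section LinearAlgebra

open scoped Matrix




open scoped MatrixOrder in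
theorem re_trace_mul_nonneg {κ : Type*} [Fintype κ] {A B : Matrix κ κ ℂ} (hA : A.PosSemidef)
    (hB : B.PosSemidef) : 0 ≤ (A * B).trace.re := by
  obtain ⟨C, rfl⟩ := CStarAlgebra.nonneg_iff_eq_star_mul_self.mp hA.nonneg
  rw [Matrix.star_eq_conjTranspose, Matrix.mul_assoc, Matrix.trace_mul_comm]
  exact (Complex.le_def.mp (hB.mul_mul_conjTranspose_same C).trace_nonneg).1

theorem re_trace_mul_mono {κ : Type*} [Fintype κ] {A B E : Matrix κ κ ℂ}
    (h : (B - A).PosSemidef) (hE : E.PosSemidef) : (A * E).trace.re ≤ (B * E).trace.re := by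
  have := re_trace_mul_nonneg h hE
  rw [Matrix.sub_mul, Matrix.trace_sub, Complex.sub_re] at this
  linarith

theorem posSemidef_sub_mul_self {κ : Type*} [Fintype κ] [DecidableEq κ] {E : Matrix κ κ ℂ}
    (hE : E.PosSemidef)
    (hE' : (1 - E).PosSemidef) : (E - E * E).PosSemidef := by
  have h1 := hE'.mul_mul_conjTranspose_same E
  have h2 := hE.mul_mul_conjTranspose_same (1 - E)
  rw [hE.1.eq] at h1
  rw [hE'.1.eq] at h2
  convert h1.add h2 using 1
  noncomm_ring

theorem eigen_unitary {κ : Type*} [Fintype κ] [DecidableEq κ]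
    {A : Matrix κ κ ℂ} (hA : A.IsHermitian) :
    (hA.eigenvectorUnitary : Matrix κ κ ℂ)ᴴ * (hA.eigenvectorUnitary : Matrix κ κ ℂ) = 1 ∧
    (hA.eigenvectorUnitary : Matrix κ κ ℂ) * (hA.eigenvectorUnitary : Matrix κ κ ℂ)ᴴ = 1 :=
  ⟨Unitary.coe_star_mul_self hA.eigenvectorUnitary, Unitary.coe_mul_star_self hA.eigenvectorUnitary⟩

theorem eigen_decomp {κ : Type*} [Fintype κ] [DecidableEq κ]
    {A : Matrix κ κ ℂ} (hA : A.IsHermitian) :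
    A = (hA.eigenvectorUnitary : Matrix κ κ ℂ) *
      Matrix.diagonal (fun i => (hA.eigenvalues i : ℂ)) *
      (hA.eigenvectorUnitary : Matrix κ κ ℂ)ᴴ := by
  exact hA.spectral_theorem

theorem matLog_eq {κ : Type*} [Fintype κ] [DecidableEq κ]
    {A : Matrix κ κ ℂ} (hA : A.IsHermitian) :
    matLog A = (hA.eigenvectorUnitary : Matrix κ κ ℂ) *
      Matrix.diagonal (fun i => (Real.log (hA.eigenvalues i) : ℂ)) *
      (hA.eigenvectorUnitary : Matrix κ κ ℂ)ᴴ := by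
  simp only [matLog, dif_pos hA]; rfl

theorem trace_mul_conj_diagonal {κ : Type*} [Fintype κ] [DecidableEq κ]
    (A V : Matrix κ κ ℂ) (f : κ → ℂ) :
    (A * (V * Matrix.diagonal f * Vᴴ)).trace = ∑ x, f x * (Vᴴ * A * V) x x := by
  rw [← Matrix.mul_assoc, Matrix.trace_mul_comm, ← Matrix.mul_assoc, ← Matrix.mul_assoc,
    Matrix.trace]
  simp [Matrix.mul_diagonal, mul_comm]

theorem conj_diagonal_apply {κ : Type*} [Fintype κ] [DecidableEq κ]
    (U V : Matrix κ κ ℂ) (r : κ → ℂ) (x : κ) :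
    (Vᴴ * (U * Matrix.diagonal r * Uᴴ) * V) x x =
      ∑ i, r i * (Complex.normSq ((Uᴴ * V) i x) : ℂ) := by
  have : Vᴴ * (U * Matrix.diagonal r * Uᴴ) * V =
      (Uᴴ * V)ᴴ * Matrix.diagonal r * (Uᴴ * V) := by
    simp [Matrix.conjTranspose_mul, Matrix.mul_assoc]
  rw [this, Matrix.mul_apply]
  refine Finset.sum_congr rfl fun i _ => ?_
  rw [Matrix.mul_diagonal, Matrix.conjTranspose_apply, ← Complex.mul_conj]
  simp only [Complex.star_def]
  ring

theorem sum_normSq_row {κ : Type*} [Fintype κ] [DecidableEq κ]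
    {W : Matrix κ κ ℂ} (h : W * Wᴴ = 1) (i : κ) :
    ∑ x, Complex.normSq (W i x) = 1 := by
  have := congrFun (congrFun h i) i
  rw [Matrix.mul_apply, Matrix.one_apply_eq] at this
  have h2 : ((∑ x, Complex.normSq (W i x) : ℝ) : ℂ) = 1 := by
    rw [← this]; push_cast
    exact Finset.sum_congr rfl fun x _ => by
      rw [Matrix.conjTranspose_apply, ← Complex.mul_conj, Complex.star_def]
  exact_mod_cast h2

theorem sum_normSq_col {κ : Type*} [Fintype κ] [DecidableEq κ]
    {W : Matrix κ κ ℂ} (h : Wᴴ * W = 1) (x : κ) :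
    ∑ i, Complex.normSq (W i x) = 1 := by
  have := sum_normSq_row (W := Wᴴ) (by simpa using h) x
  simpa [Matrix.conjTranspose_apply, Complex.star_def, Complex.normSq_conj] using this

end LinearAlgebra

section WeakConverse

open scoped Matrix

theorem relEnt_trace_formula {κ : Type*} [Fintype κ] [DecidableEq κ] {ρ σ : Matrix κ κ ℂ}
    (hρ : ρ.IsHermitian) (hσ : σ.IsHermitian) :
    (ρ * (matLog ρ - matLog σ)).trace.re =
      ∑ i, hρ.eigenvalues i * Real.log (hρ.eigenvalues i) -
      ∑ x, Real.log (hσ.eigenvalues x) *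
        (((hσ.eigenvectorUnitary : Matrix κ κ ℂ)ᴴ * ρ * hσ.eigenvectorUnitary) x x).re := by
  rw [Matrix.mul_sub, Matrix.trace_sub, Complex.sub_re, matLog_eq hρ, matLog_eq hσ,
    trace_mul_conj_diagonal, trace_mul_conj_diagonal]
  congr 1
  · rw [Complex.re_sum]
    refine Finset.sum_congr rfl fun i _ => ?_
    rw [Complex.re_ofReal_mul, mul_comm]
    congr 1
    have h := (eigen_unitary hρ).1
    have : (hρ.eigenvectorUnitary : Matrix κ κ ℂ)ᴴ * ((hρ.eigenvectorUnitary : Matrix κ κ ℂ) *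
        Matrix.diagonal (fun i => (hρ.eigenvalues i : ℂ)) *
        (hρ.eigenvectorUnitary : Matrix κ κ ℂ)ᴴ) * (hρ.eigenvectorUnitary : Matrix κ κ ℂ) =
        Matrix.diagonal (fun i => (hρ.eigenvalues i : ℂ)) := by
      rw [Matrix.mul_assoc, Matrix.mul_assoc, Matrix.mul_assoc, h, Matrix.mul_one,
        ← Matrix.mul_assoc, h, Matrix.one_mul]
    rw [← eigen_decomp hρ] at this
    rw [this]; simp
  · rw [Complex.re_sum]
    exact Finset.sum_congr rfl fun i _ => Complex.re_ofReal_mul _ _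

theorem conj_eigen_apply_re {κ : Type*} [Fintype κ] [DecidableEq κ] {ρ : Matrix κ κ ℂ}
    (hρ : ρ.IsHermitian) (V : Matrix κ κ ℂ) (x : κ) :
    ((Vᴴ * ρ * V) x x).re = ∑ i, hρ.eigenvalues i *
      Complex.normSq (((hρ.eigenvectorUnitary : Matrix κ κ ℂ)ᴴ * V) i x) := by
  conv_lhs => rw [eigen_decomp hρ, conj_diagonal_apply, Complex.re_sum]
  exact Finset.sum_congr rfl fun i _ => by rw [Complex.re_ofReal_mul, Complex.ofReal_re]

theorem sum_eigenvalues_of_isState {κ : Type*} [Fintype κ] [DecidableEq κ] {ρ : Matrix κ κ ℂ}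
    (h : IsState ρ) : ∑ i, h.1.1.eigenvalues i = 1 := by
  have := h.1.1.trace_eq_sum_eigenvalues
  have h1 := this.symm.trans h.2
  have h2 := congrArg Complex.re h1
  simpa using h2

theorem re_trace_mul_sq {κ : Type*} [Fintype κ] [DecidableEq κ] {ρ F V : Matrix κ κ ℂ}
    (hρ : ρ.IsHermitian) (hF : F.IsHermitian) (hV : V * Vᴴ = 1) :
    (ρ * (F * F)).trace.re = ∑ i, ∑ x, hρ.eigenvalues i *
      Complex.normSq (((hρ.eigenvectorUnitary : Matrix κ κ ℂ)ᴴ * F * V) i x) := by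
  rw [Matrix.trace_mul_comm]
  conv_lhs => enter [1, 1, 2]; rw [eigen_decomp hρ]
  rw [trace_mul_conj_diagonal, Complex.re_sum]
  refine Finset.sum_congr rfl fun i _ => ?_
  rw [Complex.re_ofReal_mul, ← Finset.mul_sum]
  congr 1
  set U := (hρ.eigenvectorUnitary : Matrix κ κ ℂ)
  have : Uᴴ * (F * F) * U = (Uᴴ * F * V) * (Uᴴ * F * V)ᴴ := by
    simp only [Matrix.conjTranspose_mul, Matrix.conjTranspose_conjTranspose, hF.eq]
    calc Uᴴ * (F * F) * U = Uᴴ * F * 1 * F * U := by simp [Matrix.mul_assoc]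
      _ = _ := by rw [← hV]; simp only [Matrix.mul_assoc]
  rw [this, Matrix.mul_apply, Complex.re_sum]
  refine Finset.sum_congr rfl fun x _ => ?_
  rw [Matrix.conjTranspose_apply, Complex.star_def, Complex.mul_conj, Complex.ofReal_re]

theorem suppLE_eigen_zero {κ : Type*} [Fintype κ] [DecidableEq κ] {ρ σ : Matrix κ κ ℂ}
    (hσ : σ.IsHermitian) (h : suppLE ρ σ) (x : κ) (hx : hσ.eigenvalues x = 0) :
    ((hσ.eigenvectorUnitary : Matrix κ κ ℂ)ᴴ * ρ * hσ.eigenvectorUnitary) x x = 0 := by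
  set V := (hσ.eigenvectorUnitary : Matrix κ κ ℂ) with hV
  have hcol : ∀ v, ∃ w, ρ *ᵥ v = σ *ᵥ w := fun v => by
    have : ρ *ᵥ v ∈ LinearMap.range (Matrix.toLin' σ) := h ⟨v, by simp⟩
    obtain ⟨w, hw⟩ := this
    exact ⟨w, by simpa using hw.symm⟩
  obtain ⟨w, hw⟩ := hcol (V *ᵥ Pi.single x 1)
  have h1 : (Vᴴ * ρ * V) *ᵥ Pi.single x 1 = Vᴴ *ᵥ (σ *ᵥ w) := by
    rw [← hw, Matrix.mulVec_mulVec, Matrix.mulVec_mulVec, Matrix.mul_assoc]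
  have h2 : Vᴴ * σ = Matrix.diagonal (fun i => (hσ.eigenvalues i : ℂ)) * Vᴴ := by
    conv_lhs => rw [eigen_decomp hσ]
    rw [← Matrix.mul_assoc, ← Matrix.mul_assoc, (eigen_unitary hσ).1, Matrix.one_mul]
  have h3 := congrFun h1 x
  rw [Matrix.mulVec_mulVec w, h2, ← Matrix.mulVec_mulVec w, Matrix.mulVec_diagonal, hx] at h3
  simpa using h3

theorem entropy_term_bound {r s w t : ℝ} (hr : 0 ≤ r) (hs : 0 ≤ s) (hw : 0 ≤ w) (ht : 0 ≤ t)
    (h0 : s = 0 → r * w = 0) :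
    t * (r * w) - t * min (r * w) (Real.exp t * (s * w)) - s * w ≤
      r * w * Real.log r - Real.log s * (r * w) := by
  rcases eq_or_lt_of_le (mul_nonneg hr hw) with h | h
  · rw [← h]
    have : 0 ≤ Real.exp t * (s * w) := by positivity
    rw [min_eq_left this]
    nlinarith [mul_nonneg hs hw]
  · have hw' : 0 < w := lt_of_le_of_ne hw (by rintro rfl; simp at h)
    have hr' : 0 < r := lt_of_le_of_ne hr (by rintro rfl; simp at h)
    have hs' : 0 < s := lt_of_le_of_ne hs (fun hh => h.ne' (h0 hh.symm))
    have hl : Real.log (r / s) = Real.log r - Real.log s := Real.log_div hr'.ne' hs'.ne'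
    have key : t * (r * w) - t * min (r * w) (Real.exp t * (s * w)) - s * w ≤
        (r * w) * Real.log (r / s) := by
      by_cases hc : Real.exp t * s ≤ r
      · have h1 : t ≤ Real.log (r / s) := by
          rw [Real.le_log_iff_exp_le (by positivity), le_div_iff₀ hs']; exact hc
        have h2 : 0 ≤ min (r * w) (Real.exp t * (s * w)) := by positivity
        nlinarith [mul_le_mul_of_nonneg_left h1 h.le, mul_nonneg ht h2, mul_nonneg hs hw]
      · push Not at hc
        rw [min_eq_left (by nlinarith)]
        have h1 : 1 - (r / s)⁻¹ ≤ Real.log (r / s) :=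
          Real.one_sub_inv_le_log_of_pos (by positivity)
        have h2 := mul_le_mul_of_nonneg_left h1 h.le
        have h3 : r * w * (1 - (r / s)⁻¹) = r * w - s * w := by field_simp
        linarith
    rw [hl] at key
    linarith

theorem weak_converse {κ : Type*} [Fintype κ] [DecidableEq κ] {ρ σ E : Matrix κ κ ℂ}
    (hρ : IsState ρ) (hσ : IsState σ) (hE : E.PosSemidef) (hE' : (1 - E).PosSemidef)
    {ε t : ℝ} (ht : 0 ≤ t) (h1 : (ρ * (1 - E)).trace.re ≤ ε)
    (h2 : (σ * E).trace.re ≤ ε * Real.exp (-t)) :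
    (((1 - 4 * ε) * t - 1 : ℝ) : EReal) ≤ relEnt ρ σ := by
  unfold relEnt
  split_ifs with hs
  swap
  · exact le_top
  rw [EReal.coe_le_coe_iff, relEnt_trace_formula hρ.1.1 hσ.1.1]
  have hzero := suppLE_eigen_zero hσ.1.1 hs
  set r := hρ.1.1.eigenvalues with hr
  set s := hσ.1.1.eigenvalues with hsdef
  set U := (hρ.1.1.eigenvectorUnitary : Matrix κ κ ℂ) with hU
  set V := (hσ.1.1.eigenvectorUnitary : Matrix κ κ ℂ) with hV
  have hr0 : ∀ i, 0 ≤ r i := hρ.1.eigenvalues_nonneg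
  have hs0 : ∀ i, 0 ≤ s i := hσ.1.eigenvalues_nonneg
  have UU := eigen_unitary hρ.1.1
  have VV := eigen_unitary hσ.1.1
  rw [← hU] at UU
  rw [← hV] at VV
  set w : κ → κ → ℝ := fun i x => Complex.normSq ((Uᴴ * V) i x) with hw
  have hw0 : ∀ i x, 0 ≤ w i x := fun i x => Complex.normSq_nonneg _
  have hWW : (Uᴴ * V) * (Uᴴ * V)ᴴ = 1 := by
    simp only [Matrix.conjTranspose_mul, Matrix.conjTranspose_conjTranspose]
    rw [Matrix.mul_assoc, ← Matrix.mul_assoc V, VV.2, Matrix.one_mul, UU.1]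
  have hWW' : (Uᴴ * V)ᴴ * (Uᴴ * V) = 1 := by
    simp only [Matrix.conjTranspose_mul, Matrix.conjTranspose_conjTranspose]
    rw [Matrix.mul_assoc, ← Matrix.mul_assoc U, UU.2, Matrix.one_mul, VV.1]
  have hrow : ∀ i, ∑ x, w i x = 1 := sum_normSq_row hWW
  have hcol : ∀ x, ∑ i, w i x = 1 := sum_normSq_col hWW'
  have hdiag : ∀ x, ((Vᴴ * ρ * V) x x).re = ∑ i, r i * w i x := conj_eigen_apply_re hρ.1.1 V
  have hz : ∀ i x, s x = 0 → r i * w i x = 0 := by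
    intro i x hx
    have h := hdiag x
    rw [hzero x hx, Complex.zero_re] at h
    exact (Finset.sum_eq_zero_iff_of_nonneg (fun i _ => mul_nonneg (hr0 i) (hw0 i x))).mp h.symm i
      (Finset.mem_univ _)
  have hform : ∑ i, r i * Real.log (r i) - ∑ x, Real.log (s x) * ((Vᴴ * ρ * V) x x).re =
      ∑ i, ∑ x, (r i * w i x * Real.log (r i) - Real.log (s x) * (r i * w i x)) := by
    simp only [Finset.sum_sub_distrib]
    congr 1
    · refine Finset.sum_congr rfl fun i _ => ?_
      rw [← Finset.sum_mul, ← Finset.mul_sum, hrow, mul_one]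
    · rw [Finset.sum_comm]
      refine Finset.sum_congr rfl fun x _ => ?_
      rw [hdiag, Finset.mul_sum]
  rw [hform]
  set c := Real.exp t with hc
  have hFF := posSemidef_sub_mul_self hE' (by simpa using hE)
  have hEE := posSemidef_sub_mul_self hE hE'
  have b1 : ∑ i, ∑ x, r i * Complex.normSq ((Uᴴ * (1 - E) * V) i x) ≤ ε := by
    rw [← re_trace_mul_sq hρ.1.1 hE'.1 VV.2]
    have := re_trace_mul_nonneg hρ.1 hFF
    rw [Matrix.mul_sub, Matrix.trace_sub, Complex.sub_re] at this
    linarith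
  have b2 : ∑ i, ∑ x, s x * Complex.normSq ((Uᴴ * E * V) i x) ≤ ε * Real.exp (-t) := by
    have h3 := re_trace_mul_sq hσ.1.1 hE.1 UU.2
    have := re_trace_mul_nonneg hσ.1 hEE
    rw [Matrix.mul_sub, Matrix.trace_sub, Complex.sub_re] at this
    rw [Finset.sum_comm]
    refine le_trans (le_of_eq ?_) ((h3.symm.le.trans (by linarith)).trans h2)
    refine Finset.sum_congr rfl fun x _ => Finset.sum_congr rfl fun i _ => ?_
    have : (Vᴴ * E * U) = (Uᴴ * E * V)ᴴ := by
      simp [Matrix.conjTranspose_mul, hE.1.eq, Matrix.mul_assoc]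
    change _ = s x * Complex.normSq ((Vᴴ * E * U) x i)
    rw [this, Matrix.conjTranspose_apply, Complex.star_def, Complex.normSq_conj]
  have hct : c * Real.exp (-t) = 1 := by rw [hc, ← Real.exp_add]; simp
  have hmin : ∑ i, ∑ x, min (r i * w i x) (c * (s x * w i x)) ≤ 4 * ε := by
    have : ∀ i x, min (r i * w i x) (c * (s x * w i x)) ≤
        2 * (r i * Complex.normSq ((Uᴴ * (1 - E) * V) i x)) +
        2 * c * (s x * Complex.normSq ((Uᴴ * E * V) i x)) := by
      intro i x
      have hsplit : (Uᴴ * V) i x = (Uᴴ * (1 - E) * V) i x + (Uᴴ * E * V) i x := by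
        rw [← Matrix.add_apply, ← Matrix.add_mul, ← Matrix.mul_add]
        simp
      have hq : w i x ≤ 2 * Complex.normSq ((Uᴴ * (1 - E) * V) i x) +
          2 * Complex.normSq ((Uᴴ * E * V) i x) := by
        simp only [hw, hsplit, Complex.normSq_apply, Complex.add_re, Complex.add_im]
        nlinarith [sq_nonneg (((Uᴴ * (1 - E) * V) i x).re - ((Uᴴ * E * V) i x).re),
          sq_nonneg (((Uᴴ * (1 - E) * V) i x).im - ((Uᴴ * E * V) i x).im)]
      set m := min (r i) (c * s x) with hm
      have hm0 : 0 ≤ m := le_min (hr0 i) (mul_nonneg (Real.exp_pos t).le (hs0 x))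
      have e1 : min (r i * w i x) (c * (s x * w i x)) = m * w i x := by
        rw [hm, min_mul_of_nonneg _ _ (hw0 i x), mul_assoc]
      rw [e1]
      have n1 := Complex.normSq_nonneg ((Uᴴ * (1 - E) * V) i x)
      have n2 := Complex.normSq_nonneg ((Uᴴ * E * V) i x)
      nlinarith [mul_le_mul_of_nonneg_left hq hm0,
        mul_le_mul_of_nonneg_right (min_le_left (r i) (c * s x)) n1,
        mul_le_mul_of_nonneg_right (min_le_right (r i) (c * s x)) n2]
    calc _ ≤ ∑ i, ∑ x, (2 * (r i * Complex.normSq ((Uᴴ * (1 - E) * V) i x)) +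
        2 * c * (s x * Complex.normSq ((Uᴴ * E * V) i x))) :=
          Finset.sum_le_sum fun i _ => Finset.sum_le_sum fun x _ => this i x
      _ = 2 * (∑ i, ∑ x, r i * Complex.normSq ((Uᴴ * (1 - E) * V) i x)) +
        2 * c * ∑ i, ∑ x, s x * Complex.normSq ((Uᴴ * E * V) i x) := by
          simp only [Finset.sum_add_distrib, Finset.mul_sum]
      _ ≤ 2 * ε + 2 * c * (ε * Real.exp (-t)) := by
          have := (Real.exp_pos t)
          gcongr
      _ = 4 * ε := by linear_combination 2 * ε * hct
  have hsr : ∑ i, ∑ x, r i * w i x = 1 := by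
    simp only [← Finset.mul_sum, hrow, mul_one]
    exact sum_eigenvalues_of_isState hρ
  have hss : ∑ i, ∑ x, s x * w i x = 1 := by
    rw [Finset.sum_comm]
    simp only [← Finset.mul_sum, hcol, mul_one]
    exact sum_eigenvalues_of_isState hσ
  calc (1 - 4 * ε) * t - 1 ≤ t * (∑ i, ∑ x, r i * w i x) -
        t * (∑ i, ∑ x, min (r i * w i x) (c * (s x * w i x))) - ∑ i, ∑ x, s x * w i x := by
        rw [hsr, hss]; nlinarith
    _ = ∑ i, ∑ x,
          (t * (r i * w i x) - t * min (r i * w i x) (c * (s x * w i x)) - s x * w i x) := by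
        simp only [Finset.sum_sub_distrib, Finset.mul_sum]
    _ ≤ _ := Finset.sum_le_sum fun i _ => Finset.sum_le_sum fun x _ =>
        entropy_term_bound (hr0 i) (hs0 x) (hw0 i x) ht (hz i x)

end WeakConverse

section Tensor

open scoped Matrix

theorem tensorProdFam_mul {κ : Type*} [Fintype κ] {n : ℕ} (A B : Fin n → MatC κ) :
    tensorProdFam A * tensorProdFam B = tensorProdFam (fun p => A p * B p) := by
  ext i j
  simp only [Matrix.mul_apply, tensorProdFam, ← Finset.prod_mul_distrib]
  rw [Finset.prod_univ_sum, Fintype.piFinset_univ]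

theorem trace_tensorProdFam {κ : Type*} [Fintype κ] {n : ℕ} (A : Fin n → MatC κ) :
    (tensorProdFam A).trace = ∏ p, (A p).trace := by
  simp only [Matrix.trace, Matrix.diag, tensorProdFam]
  rw [Finset.prod_univ_sum, Fintype.piFinset_univ]

theorem tensorProdFam_one {κ : Type*} [DecidableEq κ] {n : ℕ} :
    tensorProdFam (fun _ : Fin n => (1 : MatC κ)) = 1 := by
  ext i j
  simp only [tensorProdFam, Matrix.one_apply, Finset.prod_ite_zero, Finset.prod_const_one]
  simp [funext_iff]

theorem tensorProdFam_sum {κ X : Type*} [Fintype X] {n : ℕ}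
    (M : Fin n → X → MatC κ) :
    tensorProdFam (fun p => ∑ x, M p x) = ∑ f : Fin n → X, tensorProdFam (fun p => M p (f p)) := by
  ext i j
  simp only [tensorProdFam, Matrix.sum_apply]
  rw [Finset.prod_univ_sum, Fintype.piFinset_univ]

theorem posSemidef_ones (κ : Type*) [Fintype κ] :
    (Matrix.of fun _ _ : κ => (1 : ℂ)).PosSemidef := by
  have := Matrix.posSemidef_vecMulVec_self_star (fun _ : κ => (1 : ℂ))
  convert this using 1
  ext i j
  simp [Matrix.vecMulVec_apply]

theorem posSemidef_prod_submatrix {κ γ : Type*} [Fintype κ] [Fintype γ] {P : Type*}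
    (S : Finset P) (A : P → MatC κ) (e : P → γ → κ) (hA : ∀ p, (A p).PosSemidef) :
    (Matrix.of fun i j : γ => ∏ p ∈ S, A p (e p i) (e p j)).PosSemidef := by
  induction S using Finset.induction_on with
  | empty => simpa using posSemidef_ones γ
  | insert a s ha ih =>
    have h : (Matrix.of fun i j : γ => ∏ p ∈ insert a s, A p (e p i) (e p j)) =
        ((A a).submatrix (e a) (e a)).hadamard
          (Matrix.of fun i j : γ => ∏ p ∈ s, A p (e p i) (e p j)) := by
      ext i j
      simp [Finset.prod_insert ha, Matrix.hadamard_apply]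
    rw [h]
    exact ((hA a).submatrix (e a)).hadamard ih

theorem posSemidef_prod_submatrix_sub {κ γ : Type*} [Fintype κ] [Fintype γ] {P : Type*}
    (S : Finset P) (A B : P → MatC κ) (e : P → γ → κ) (hB : ∀ p, (B p).PosSemidef)
    (hAB : ∀ p, (A p - B p).PosSemidef) :
    ((Matrix.of fun i j : γ => ∏ p ∈ S, A p (e p i) (e p j)) -
      (Matrix.of fun i j : γ => ∏ p ∈ S, B p (e p i) (e p j))).PosSemidef := by
  have hA : ∀ p, (A p).PosSemidef := fun p => by simpa using (hAB p).add (hB p)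
  induction S using Finset.induction_on with
  | empty => simpa using Matrix.PosSemidef.zero
  | insert a s ha ih =>
    have h1 := ((hAB a).submatrix (e a)).hadamard (posSemidef_prod_submatrix s A e hA)
    have h2 := ((hB a).submatrix (e a)).hadamard ih
    have h := h1.add h2
    have heq : (Matrix.of fun i j : γ => ∏ p ∈ insert a s, A p (e p i) (e p j)) -
        (Matrix.of fun i j : γ => ∏ p ∈ insert a s, B p (e p i) (e p j)) =
        ((A a - B a).submatrix (e a) (e a)).hadamard
          (Matrix.of fun i j : γ => ∏ p ∈ s, A p (e p i) (e p j)) +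
        ((B a).submatrix (e a) (e a)).hadamard
          ((Matrix.of fun i j : γ => ∏ p ∈ s, A p (e p i) (e p j)) -
            (Matrix.of fun i j : γ => ∏ p ∈ s, B p (e p i) (e p j))) := by
      ext i j
      simp only [Finset.prod_insert ha, Matrix.hadamard_apply, Matrix.sub_apply, Matrix.add_apply,
        Matrix.of_apply, Matrix.submatrix_apply]
      ring
    rw [heq]
    exact h

theorem posSemidef_tensorProdFam {κ : Type*} [Fintype κ] {n : ℕ} {A : Fin n → MatC κ}
    (hA : ∀ p, (A p).PosSemidef) : (tensorProdFam A).PosSemidef :=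
  posSemidef_prod_submatrix Finset.univ A (fun p (i : Fin n → κ) => i p) hA

theorem posSemidef_tensorProdFam_sub {κ : Type*} [Fintype κ] {n : ℕ} {A B : Fin n → MatC κ}
    (hB : ∀ p, (B p).PosSemidef) (hAB : ∀ p, (A p - B p).PosSemidef) :
    (tensorProdFam A - tensorProdFam B).PosSemidef :=
  posSemidef_prod_submatrix_sub Finset.univ A B (fun p (i : Fin n → κ) => i p) hB hAB

theorem isState_tensorProdFam {κ : Type*} [Fintype κ] {n : ℕ} {A : Fin n → MatC κ}
    (hA : ∀ p, IsState (A p)) : IsState (tensorProdFam A) :=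
  ⟨posSemidef_tensorProdFam fun p => (hA p).1, by
    rw [trace_tensorProdFam]; exact Finset.prod_eq_one fun p _ => (hA p).2⟩

theorem convex_isState (κ : Type*) [Fintype κ] : Convex ℝ {ρ : MatC κ | IsState ρ} := by
  rintro ρ ⟨h1, h2⟩ σ ⟨h3, h4⟩ a b ha hb hab
  refine ⟨(h1.smul ha).add (h3.smul hb), ?_⟩
  rw [Matrix.trace_add, Matrix.trace_smul, Matrix.trace_smul, h2, h4]
  rw [← add_smul, hab, one_smul]

theorem isState_of_mem_convexHull {κ : Type*} [Fintype κ] {S : Set (MatC κ)}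
    (hS : ∀ ρ ∈ S, IsState ρ) : ∀ ρ ∈ convexHull ℝ S, IsState ρ :=
  fun _ h => convexHull_min (t := {ρ | IsState ρ}) hS (convex_isState κ) h

theorem isState_of_mem_avSet {κ : Type*} [Fintype κ] {S : Set (MatC κ)}
    (hS : ∀ ρ ∈ S, IsState ρ) {n : ℕ} : ∀ ρ ∈ avSet S n, IsState ρ := by
  rintro _ ⟨f, hf, rfl⟩
  exact isState_tensorProdFam fun p => hS _ (hf p)

theorem isState_of_mem_iidSet {κ : Type*} [Fintype κ] {S : Set (MatC κ)}
    (hS : ∀ ρ ∈ S, IsState ρ) {n : ℕ} : ∀ ρ ∈ iidSet S n, IsState ρ := by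
  rintro _ ⟨σ, hσ, rfl⟩
  exact isState_tensorProdFam fun _ => hS _ hσ

end Tensor

section BlockTest

open scoped Matrix

theorem sum_prod_le_of_exp {X : Type*} [Fintype X] {m : ℕ} (P : Fin m → X → ℝ)
    (hP : ∀ b x, 0 ≤ P b x) (g : X → ℝ) (c : ℝ)
    (hg : ∀ b, ∑ x, P b x * Real.exp (g x) ≤ Real.exp c) (T : ℝ)
    (S : Finset (Fin m → X)) (hS : ∀ f ∈ S, T ≤ ∑ b, g (f b)) :
    ∑ f ∈ S, ∏ b, P b (f b) ≤ Real.exp (m * c - T) := by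
  have h1 : ∀ f ∈ S, ∏ b, P b (f b) ≤ Real.exp (-T) * ∏ b, (P b (f b) * Real.exp (g (f b))) := by
    intro f hf
    rw [Finset.prod_mul_distrib, ← Real.exp_sum]
    have h2 : 1 ≤ Real.exp (-T) * Real.exp (∑ b, g (f b)) := by
      rw [← Real.exp_add]
      exact Real.one_le_exp (by linarith [hS f hf])
    have h3 : 0 ≤ ∏ b, P b (f b) := Finset.prod_nonneg fun b _ => hP b _
    nlinarith
  calc ∑ f ∈ S, ∏ b, P b (f b)
      ≤ ∑ f ∈ S, Real.exp (-T) * ∏ b, (P b (f b) * Real.exp (g (f b))) := Finset.sum_le_sum h1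
    _ ≤ ∑ f : Fin m → X, Real.exp (-T) * ∏ b, (P b (f b) * Real.exp (g (f b))) :=
        Finset.sum_le_sum_of_subset_of_nonneg (Finset.subset_univ _) fun f _ _ =>
          mul_nonneg (Real.exp_pos _).le
            (Finset.prod_nonneg fun b _ => mul_nonneg (hP b _) (Real.exp_pos _).le)
    _ = Real.exp (-T) * ∏ b, ∑ x, P b x * Real.exp (g x) := by
        rw [← Finset.mul_sum, Finset.prod_univ_sum, Fintype.piFinset_univ]
    _ ≤ Real.exp (-T) * ∏ _b : Fin m, Real.exp c := by
        refine mul_le_mul_of_nonneg_left ?_ (Real.exp_pos _).le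
        exact Finset.prod_le_prod (fun b _ => Finset.sum_nonneg fun x _ =>
          mul_nonneg (hP b _) (Real.exp_pos _).le) fun b _ => hg b
    _ = Real.exp (m * c - T) := by
        rw [Finset.prod_const, Finset.card_univ, Fintype.card_fin, ← Real.exp_nat_mul,
          ← Real.exp_add]
        congr 1; ring

theorem sum_mul_exp_neg_le {X : Type*} [Fintype X] (P : X → ℝ) (hP : ∀ x, 0 ≤ P x)
    (hP1 : ∑ x, P x = 1) (h : X → ℝ) {R H θ : ℝ} (hθ : 0 ≤ θ) (hH : ∀ x, |h x| ≤ H)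
    (hθH : θ * H ≤ 1) (hR : R ≤ ∑ x, P x * h x) :
    ∑ x, P x * Real.exp (-θ * h x) ≤ Real.exp (-θ * R + θ ^ 2 * H ^ 2) := by
  have h1 : ∀ x, Real.exp (-θ * h x) ≤ 1 - θ * h x + θ ^ 2 * H ^ 2 := by
    intro x
    have ha : |-θ * h x| ≤ θ * H := by
      rw [abs_mul, abs_neg, abs_of_nonneg hθ]
      exact mul_le_mul_of_nonneg_left (hH x) hθ
    have hb := (abs_le.mp (Real.abs_exp_sub_one_sub_id_le (ha.trans hθH))).2
    have hc : (-θ * h x) ^ 2 ≤ (θ * H) ^ 2 := by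
      rw [← sq_abs]; exact pow_le_pow_left₀ (abs_nonneg _) ha 2
    nlinarith
  calc ∑ x, P x * Real.exp (-θ * h x) ≤ ∑ x, P x * (1 - θ * h x + θ ^ 2 * H ^ 2) :=
        Finset.sum_le_sum fun x _ => mul_le_mul_of_nonneg_left (h1 x) (hP x)
    _ = (1 + θ ^ 2 * H ^ 2) * ∑ x, P x - θ * ∑ x, P x * h x := by
        rw [Finset.mul_sum, Finset.mul_sum, ← Finset.sum_sub_distrib]
        exact Finset.sum_congr rfl fun x _ => by ring
    _ ≤ (-θ * R + θ ^ 2 * H ^ 2) + 1 := by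
        rw [hP1]; nlinarith [mul_le_mul_of_nonneg_left hR hθ]
    _ ≤ _ := Real.add_one_le_exp _

/-- Existence of a test with worst-case errors at most `ε` and `β`. -/
def HasTest {κ : Type*} [Fintype κ] [DecidableEq κ] (A B : Set (Matrix κ κ ℂ)) (ε β : ℝ) : Prop :=
  ∃ E : Matrix κ κ ℂ, E.PosSemidef ∧ (1 - E).PosSemidef ∧
    (∀ ρ ∈ A, (ρ * (1 - E)).trace.re ≤ ε) ∧ ∀ σ ∈ B, (σ * E).trace.re ≤ β

theorem typeII_le_of_hasTest {κ : Type*} [Fintype κ] [DecidableEq κ] {A B : Set (Matrix κ κ ℂ)}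
    {ε β : ℝ} (hB : ∀ σ ∈ B, IsState σ) (hβ : 0 ≤ β) (h : HasTest A B ε β) :
    typeII A B ε ≤ β := by
  obtain ⟨E, h1, h2, h3, h4⟩ := h
  have hmem : ∀ x ∈ {x : ℝ | ∃ σ ∈ B, x = (σ * E).trace.re}, x ≤ β := by
    rintro _ ⟨σ, hσ, rfl⟩
    exact h4 σ hσ
  unfold typeII
  refine le_trans (csInf_le ⟨0, ?_⟩ ⟨E, h1, h2, h3, rfl⟩) (Real.sSup_le hmem hβ)
  · rintro _ ⟨E', h1', -, -, rfl⟩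
    refine Real.sSup_nonneg ?_
    rintro _ ⟨σ, hσ, rfl⟩
    exact re_trace_mul_nonneg (hB σ hσ).1 h1'

theorem re_trace_mul_le_one {κ : Type*} [Fintype κ] [DecidableEq κ] {σ E : Matrix κ κ ℂ}
    (hσ : IsState σ) (hE : (1 - E).PosSemidef) : (σ * E).trace.re ≤ 1 := by
  have := re_trace_mul_nonneg hσ.1 hE
  rw [Matrix.mul_sub, Matrix.trace_sub, Matrix.mul_one, hσ.2, Complex.sub_re, Complex.one_re]
    at this
  linarith

theorem hasTest_of_typeII_lt {κ : Type*} [Fintype κ] [DecidableEq κ] {A B : Set (Matrix κ κ ℂ)}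
    {ε β : ℝ} (hB : ∀ σ ∈ B, IsState σ) (hε : 0 ≤ ε)
    (h : typeII A B ε < β) : HasTest A B ε β := by
  have hne : {b : ℝ | ∃ E : Matrix κ κ ℂ, E.PosSemidef ∧ (1 - E).PosSemidef ∧
    (∀ ρ ∈ A, (ρ * (1 - E)).trace.re ≤ ε) ∧
    b = sSup {x : ℝ | ∃ σ ∈ B, x = (σ * E).trace.re}}.Nonempty :=
    ⟨_, 1, Matrix.PosSemidef.one, by simpa using Matrix.PosSemidef.zero,
      fun ρ _ => by simpa using hε, rfl⟩
  obtain ⟨_, ⟨E, h1, h2, h3, rfl⟩, hlt⟩ := exists_lt_of_csInf_lt hne h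
  have hbdd : BddAbove {x : ℝ | ∃ σ ∈ B, x = (σ * E).trace.re} := by
    refine ⟨1, ?_⟩
    rintro _ ⟨σ, hσ, rfl⟩
    exact re_trace_mul_le_one (hB σ hσ) h2
  exact ⟨E, h1, h2, h3, fun σ hσ => (le_csSup hbdd ⟨σ, hσ, rfl⟩).trans hlt.le⟩

theorem tensorMul_eq_submatrix {κ : Type*} {n m : ℕ} (A : MatN κ n) (B : MatN κ m) :
    tensorMul A B = (Matrix.kroneckerMap (· * ·) A B).submatrix (Fin.appendEquiv n m).symm
      (Fin.appendEquiv n m).symm := by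
  ext i j
  rfl

theorem tensorProdFam_add {κ : Type*} {n m : ℕ} (f : Fin (n + m) → MatC κ) :
    tensorProdFam f = tensorMul (tensorProdFam fun p => f (Fin.castAdd m p))
      (tensorProdFam fun p => f (Fin.natAdd n p)) := by
  ext i j
  simp [tensorProdFam, tensorMul, Fin.prod_univ_add]

theorem trace_tensorMul_mul {κ : Type*} [Fintype κ] {n m : ℕ} (A C : MatN κ n) (B D : MatN κ m) :
    (tensorMul A B * tensorMul C D).trace = (A * C).trace * (B * D).trace := by
  rw [tensorMul_eq_submatrix, tensorMul_eq_submatrix, Matrix.submatrix_mul_equiv,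
    ← Matrix.mul_kronecker_mul, ← Matrix.trace_kronecker]
  exact Equiv.sum_comp (Fin.appendEquiv n m).symm
    (fun i => (Matrix.kroneckerMap (· * ·) (A * C) (B * D)) i i)

theorem posSemidef_tensorMul {κ : Type*} [Fintype κ] [DecidableEq κ] {n m : ℕ} {A : MatN κ n}
    {B : MatN κ m} (hA : A.PosSemidef) (hB : B.PosSemidef) : (tensorMul A B).PosSemidef := by
  rw [tensorMul_eq_submatrix]
  exact (hA.kronecker hB).submatrix _

theorem tensorMul_one_one {κ : Type*} [DecidableEq κ] {n m : ℕ} :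
    tensorMul (1 : MatN κ n) (1 : MatN κ m) = 1 := by
  rw [tensorMul_eq_submatrix]
  have := Matrix.one_kronecker_one (α := ℂ) (m := Fin n → κ) (n := Fin m → κ)
  rw [this, Matrix.submatrix_one_equiv]

theorem hasTest_avSet_add {κ : Type*} [Fintype κ] [DecidableEq κ] {A B : Set (MatC κ)} {n : ℕ}
    {ε β : ℝ} (hA : ∀ ρ ∈ A, IsState ρ) (hB : ∀ ρ ∈ B, IsState ρ) (r : ℕ)
    (h : HasTest (avSet A n) (avSet B n) ε β) :
    HasTest (avSet A (n + r)) (avSet B (n + r)) ε β := by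
  obtain ⟨E, h1, h2, h3, h4⟩ := h
  have hsub : 1 - tensorMul E (1 : MatN κ r) = tensorMul (1 - E) (1 : MatN κ r) := by
    rw [← tensorMul_one_one]
    ext i j
    simp [tensorMul, sub_mul]
  have htr : ∀ (S : Set (MatC κ)) (_ : ∀ ρ ∈ S, IsState ρ) (f : Fin (n + r) → MatC κ)
      (_ : ∀ p, f p ∈ S) (F : MatN κ n), (tensorProdFam f * tensorMul F (1 : MatN κ r)).trace =
      (tensorProdFam (fun p => f (Fin.castAdd r p)) * F).trace := by
    intro S hS f hf F
    rw [tensorProdFam_add, trace_tensorMul_mul, Matrix.mul_one, trace_tensorProdFam (n := r),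
      Finset.prod_eq_one fun p _ => (hS _ (hf _)).2, mul_one]
  refine ⟨tensorMul E 1, posSemidef_tensorMul h1 Matrix.PosSemidef.one, ?_, ?_, ?_⟩
  · rw [hsub]
    exact posSemidef_tensorMul h2 Matrix.PosSemidef.one
  · rintro _ ⟨f, hf, rfl⟩
    rw [hsub, htr A hA f hf]
    exact h3 _ ⟨_, fun p => hf _, rfl⟩
  · rintro _ ⟨f, hf, rfl⟩
    rw [htr B hB f hf]
    exact h4 _ ⟨_, fun p => hf _, rfl⟩

end BlockTest

section BlockAchievability

open scoped Matrix

/-- Grouping of the tensor factors of an `m * k`-copy index into `m` blocks of size `k`. -/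
def blockEquiv (ι : Type*) (m k : ℕ) : (Fin (m * k) → ι) ≃ (Fin m → Fin k → ι) :=
  (Equiv.arrowCongr finProdFinEquiv.symm (Equiv.refl ι)).trans (Equiv.curry (Fin m) (Fin k) ι)

theorem blockEquiv_apply {ι : Type*} {m k : ℕ} (i : Fin (m * k) → ι) (b : Fin m) (t : Fin k) :
    blockEquiv ι m k i b t = i (finProdFinEquiv (b, t)) := rfl

theorem tensorProdFam_blocks {ι : Type*} {m k : ℕ} (σ : Fin (m * k) → MatC ι) :
    tensorProdFam σ = (tensorProdFam fun b : Fin m =>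
      tensorProdFam fun t : Fin k => σ (finProdFinEquiv (b, t))).submatrix
        (blockEquiv ι m k) (blockEquiv ι m k) := by
  ext i j
  simp only [tensorProdFam, Matrix.submatrix_apply, blockEquiv_apply]
  rw [← finProdFinEquiv.prod_comp, Fintype.prod_prod_type]

theorem trace_submatrix_equiv_mul {κ γ : Type*} [Fintype κ] [Fintype γ] (e : γ ≃ κ)
    (A B : Matrix κ κ ℂ) : (A.submatrix e e * B.submatrix e e).trace = (A * B).trace := by
  rw [Matrix.submatrix_mul_equiv]
  exact Equiv.sum_comp e fun i => (A * B) i i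

theorem re_trace_tensorProdFam_mul {κ : Type*} [Fintype κ] {m : ℕ} {A B : Fin m → MatC κ}
    (hA : ∀ b, (A b).PosSemidef) (hB : ∀ b, (B b).PosSemidef) :
    (tensorProdFam A * tensorProdFam B).trace.re = ∏ b, (A b * B b).trace.re := by
  rw [tensorProdFam_mul, trace_tensorProdFam]
  have h : ∀ b, (A b * B b).trace = ((A b * B b).trace.re : ℂ) := by
    intro b
    refine (Complex.conj_eq_iff_re.mp ?_).symm
    rw [← Complex.star_def, ← Matrix.trace_conjTranspose, Matrix.conjTranspose_mul, (hA b).1.eq,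
      (hB b).1.eq, Matrix.trace_mul_comm]
  rw [Finset.prod_congr rfl fun b _ => h b, ← Complex.ofReal_prod, Complex.ofReal_re]

theorem hasTest_blocks {ι X : Type*} [Fintype ι] [DecidableEq ι] [Fintype X] {k : ℕ}
    {A B : Set (MatC ι)} (hA : ∀ ρ ∈ A, IsState ρ) (hB : ∀ σ ∈ B, IsState σ)
    {M : X → MatN ι k} (hM : ∀ x, (M x).PosSemidef) (hM1 : ∑ x, M x = 1) (h : X → ℝ)
    {R s H θ : ℝ} (hR : ∀ ρ ∈ avSet A k, R ≤ ∑ x, (ρ * M x).trace.re * h x)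
    (hs : ∀ σ ∈ avSet B k, ∑ x, (σ * M x).trace.re * Real.exp (h x) ≤ Real.exp s)
    (hθ : 0 ≤ θ) (hH : ∀ x, |h x| ≤ H) (hθH : θ * H ≤ 1) (m : ℕ) (T : ℝ) :
    HasTest (avSet A (m * k)) (avSet B (m * k))
      (Real.exp (m * (-θ * R + θ ^ 2 * H ^ 2) + θ * T)) (Real.exp (m * s - T)) := by
  set e := blockEquiv ι m k
  set F : Finset (Fin m → X) → MatN (Fin k → ι) m :=
    fun S => ∑ f ∈ S, tensorProdFam fun b => M (f b) with hF
  have hFpos : ∀ S, (F S).PosSemidef := fun S =>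
    Matrix.posSemidef_sum _ fun f _ => posSemidef_tensorProdFam fun b => hM _
  have htr : ∀ (C : Set (MatC ι)) (_ : ∀ ρ ∈ C, IsState ρ) (g : Fin (m * k) → MatC ι)
      (_ : ∀ p, g p ∈ C) (S : Finset (Fin m → X)),
      (tensorProdFam g * (F S).submatrix e e).trace.re = ∑ f ∈ S, ∏ b,
        ((tensorProdFam fun t : Fin k => g (finProdFinEquiv (b, t))) * M (f b)).trace.re := by
    intro C hC g hg S
    rw [tensorProdFam_blocks, trace_submatrix_equiv_mul, hF, Finset.mul_sum, Matrix.trace_sum,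
      Complex.re_sum]
    refine Finset.sum_congr rfl fun f _ => re_trace_tensorProdFam_mul (fun b => ?_) fun b => hM _
    exact posSemidef_tensorProdFam fun t => (hC _ (hg _)).1
  have hstate : ∀ (C : Set (MatC ι)) (_ : ∀ ρ ∈ C, IsState ρ) (g : Fin (m * k) → MatC ι)
      (_ : ∀ p, g p ∈ C) (b : Fin m),
      IsState (tensorProdFam fun t : Fin k => g (finProdFinEquiv (b, t))) :=
    fun C hC g hg b => isState_tensorProdFam fun t => hC _ (hg _)
  set S : Finset (Fin m → X) := Finset.univ.filter fun f => T ≤ ∑ b, h (f b) with hS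
  have hcompl : 1 - (F S).submatrix e e = (F Sᶜ).submatrix e e := by
    have h1 : F S + F Sᶜ = 1 := by
      rw [hF]
      simp only [Finset.sum_add_sum_compl]
      rw [← tensorProdFam_sum (fun (_ : Fin m) x => M x)]
      simp only [hM1]
      exact tensorProdFam_one
    rw [← Matrix.submatrix_one_equiv e, ← h1]
    ext i j
    simp
  refine ⟨(F S).submatrix e e, (hFpos S).submatrix e, ?_, ?_, ?_⟩
  · rw [hcompl]
    exact (hFpos _).submatrix e
  · rintro _ ⟨g, hg, rfl⟩
    rw [hcompl, htr A hA g hg]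
    have hPn : ∀ (b : Fin m) (x : X), 0 ≤
        ((tensorProdFam fun t : Fin k => g (finProdFinEquiv (b, t))) * M x).trace.re :=
      fun b x => re_trace_mul_nonneg (hstate A hA g hg b).1 (hM x)
    refine (sum_prod_le_of_exp (fun b x =>
      ((tensorProdFam fun t : Fin k => g (finProdFinEquiv (b, t))) * M x).trace.re) hPn
      (fun x => -θ * h x) (-θ * R + θ ^ 2 * H ^ 2) (fun b => ?_) (-θ * T) Sᶜ ?_).trans_eq ?_
    · refine sum_mul_exp_neg_le _ (hPn b) ?_ h hθ hH hθH (hR _ ⟨_, fun t => hg _, rfl⟩)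
      rw [← Complex.re_sum, ← Matrix.trace_sum, ← Finset.mul_sum, hM1, Matrix.mul_one,
        (hstate A hA g hg b).2, Complex.one_re]
    · intro f hf
      rw [← Finset.mul_sum]
      have : ∑ b, h (f b) ≤ T := by
        simp only [hS, Finset.mem_compl, Finset.mem_filter, Finset.mem_univ, true_and, not_le] at hf
        exact hf.le
      nlinarith
    · congr 1; ring
  · rintro _ ⟨g, hg, rfl⟩
    rw [htr B hB g hg]
    refine sum_prod_le_of_exp (fun b x =>
      ((tensorProdFam fun t : Fin k => g (finProdFinEquiv (b, t))) * M x).trace.re)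
      (fun b x => re_trace_mul_nonneg (hstate B hB g hg b).1 (hM x)) h s
      (fun b => hs _ ⟨_, fun t => hg _, rfl⟩) T S ?_
    intro f hf
    simpa [hS] using hf

theorem negLog_antitone {x y : ℝ} (h : x ≤ y) : negLog y ≤ negLog x := by
  unfold negLog
  split_ifs with h1 h2 h2
  · exact le_rfl
  · exact absurd (h.trans h1) h2
  · exact le_top
  · push Not at h1 h2
    exact_mod_cast neg_le_neg (Real.log_le_log h2 h)

theorem negLog_exp (x : ℝ) : negLog (Real.exp x) = ((-x : ℝ) : EReal) := by
  simp [negLog, not_le.mpr (Real.exp_pos x)]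

theorem cFrac_mul_mono (n : ℕ) {x y : EReal} (h : x ≤ y) : cFrac n * x ≤ cFrac n * y :=
  mul_le_mul_of_nonneg_left h (by unfold cFrac; exact_mod_cast inv_nonneg.mpr n.cast_nonneg)

/-- A finite scored measurement on `k` copies yields an achievable Stein exponent. -/
theorem le_steinExponent_of_scored_povm {ι X : Type*} [Fintype ι] [DecidableEq ι] [Fintype X]
    {k : ℕ} (hk : 0 < k)
    {A B : Set (MatC ι)} (hA : ∀ ρ ∈ A, IsState ρ) (hB : ∀ σ ∈ B, IsState σ)
    {M : X → MatN ι k} (hM : ∀ x, (M x).PosSemidef) (hM1 : ∑ x, M x = 1) (h : X → ℝ)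
    {R s : ℝ} (hR : ∀ ρ ∈ avSet A k, R ≤ ∑ x, (ρ * M x).trace.re * h x)
    (hs : ∀ σ ∈ avSet B k, ∑ x, (σ * M x).trace.re * Real.exp (h x) ≤ Real.exp s)
    {δ : ℝ} (hδ : 0 < δ) :
    (((R - δ - s) / k : ℝ) : EReal) ≤ steinExponent (avSet A) (avSet B) := by
  unfold steinExponent
  refine le_iInf₂ fun ε hε => ?_
  obtain ⟨H, hH1, hH⟩ : ∃ H : ℝ, 1 ≤ H ∧ ∀ x, |h x| ≤ H := by
    refine ⟨1 + ∑ x, |h x|, by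
      have := Finset.sum_nonneg fun x (_ : x ∈ Finset.univ) => abs_nonneg (h x)
      linarith, fun x => ?_⟩
    have := Finset.single_le_sum (fun x _ => abs_nonneg (h x)) (Finset.mem_univ x)
    linarith
  obtain ⟨θ, hθ0, hθH, hθδ⟩ : ∃ θ : ℝ, 0 < θ ∧ θ * H ≤ 1 ∧ θ * H ^ 2 ≤ δ / 2 := by
    have hHp : 0 < H := by linarith
    refine ⟨min (1 / H) (δ / 2 / H ^ 2), by positivity, ?_, ?_⟩
    · exact (mul_le_mul_of_nonneg_right (min_le_left _ _) hHp.le).trans_eq (by field_simp)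
    · exact (mul_le_mul_of_nonneg_right (min_le_right _ _) (by positivity)).trans_eq (by field_simp)
  have hk' : (0 : ℝ) < k := Nat.cast_pos.mpr hk
  have htests : ∀ n : ℕ, HasTest (avSet A n) (avSet B n)
      (Real.exp (-((n / k : ℕ) * (θ * δ / 2))))
      (Real.exp (-((n / k : ℕ) * (R - δ - s)))) := by
    intro n
    have h1 := hasTest_avSet_add hA hB (n % k)
      (hasTest_blocks hA hB hM hM1 h hR hs hθ0.le hH hθH (n / k) ((n / k : ℕ) * (R - δ)))
    rw [Nat.div_add_mod'] at h1
    obtain ⟨E, e1, e2, e3, e4⟩ := h1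
    refine ⟨E, e1, e2, fun ρ hρ => (e3 ρ hρ).trans (Real.exp_le_exp.mpr ?_),
      fun σ hσ => (e4 σ hσ).trans_eq (by congr 1; ring)⟩
    have h2 : θ * (θ * H ^ 2) ≤ θ * (δ / 2) := mul_le_mul_of_nonneg_left hθδ hθ0.le
    have h3 : (0 : ℝ) ≤ (n / k : ℕ) := Nat.cast_nonneg _
    nlinarith [mul_le_mul_of_nonneg_left h2 h3]
  have hdiv : Tendsto (fun n : ℕ => ((n / k : ℕ) : ℝ)) atTop atTop :=
    tendsto_natCast_atTop_atTop.comp (Nat.tendsto_div_const_atTop hk.ne')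
  have hlim1 : ∀ᶠ n : ℕ in atTop, Real.exp (-((n / k : ℕ) * (θ * δ / 2))) ≤ ε := by
    have : Tendsto (fun n : ℕ => Real.exp (-((n / k : ℕ) * (θ * δ / 2)))) atTop (𝓝 0) :=
      Real.tendsto_exp_neg_atTop_nhds_zero.comp (hdiv.atTop_mul_const (by positivity))
    exact (this.eventually (gt_mem_nhds hε.1)).mono fun n hn => le_of_lt hn
  have hratio : Tendsto (fun n : ℕ => (n : ℝ)⁻¹ * ((n / k : ℕ) * (R - δ - s))) atTop
      (𝓝 ((R - δ - s) / k)) := by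
    have h0 : Tendsto (fun n : ℕ => (n : ℝ)⁻¹ * ((n / k : ℕ) : ℝ)) atTop (𝓝 ((k : ℝ)⁻¹)) := by
      have hb : Tendsto (fun n : ℕ => (k : ℝ)⁻¹ - (n : ℝ)⁻¹) atTop (𝓝 ((k : ℝ)⁻¹)) := by
        simpa using (tendsto_const_nhds (x := (k : ℝ)⁻¹)).sub
          (tendsto_inv_atTop_nhds_zero_nat (𝕜 := ℝ))
      refine tendsto_of_tendsto_of_tendsto_of_le_of_le' hb tendsto_const_nhds ?_ ?_
      · filter_upwards [eventually_gt_atTop 0] with n hn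
        have hn' : (0 : ℝ) < n := Nat.cast_pos.mpr hn
        have h4 : n < (n / k + 1) * k := by
          have := Nat.div_add_mod' n k
          have := Nat.mod_lt n hk
          nlinarith
        have h5 : (n : ℝ) ≤ ((n / k : ℕ) + 1) * k := by exact_mod_cast h4.le
        have h6 : (n : ℝ) / k ≤ (n / k : ℕ) + 1 := by rwa [div_le_iff₀ hk']
        have h7 := mul_le_mul_of_nonneg_left h6 (inv_nonneg.mpr hn'.le)
        have h8 : (n : ℝ)⁻¹ * (n / k) = (k : ℝ)⁻¹ := by field_simp
        linarith
      · filter_upwards [eventually_gt_atTop 0] with n hn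
        have hn' : (0 : ℝ) < n := Nat.cast_pos.mpr hn
        have h7 := mul_le_mul_of_nonneg_left (Nat.cast_div_le (α := ℝ) (m := n) (n := k))
          (inv_nonneg.mpr hn'.le)
        have h8 : (n : ℝ)⁻¹ * (n / k) = (k : ℝ)⁻¹ := by field_simp
        linarith
    have := h0.mul_const (R - δ - s)
    convert this using 2
    · ring
    · rw [div_eq_mul_inv]; ring
  have hratio' : Tendsto (fun n : ℕ => (((n : ℝ)⁻¹ * ((n / k : ℕ) * (R - δ - s)) : ℝ) : EReal))
      atTop (𝓝 (((R - δ - s) / k : ℝ) : EReal)) :=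
    (continuous_coe_real_ereal.tendsto _).comp hratio
  rw [← hratio'.liminf_eq]
  refine liminf_le_liminf ?_
  filter_upwards [hlim1] with n hn
  have h1 : typeII (avSet A n) (avSet B n) ε ≤ Real.exp (-((n / k : ℕ) * (R - δ - s))) := by
    refine typeII_le_of_hasTest (isState_of_mem_avSet hB) (Real.exp_pos _).le ?_
    obtain ⟨E, e1, e2, e3, e4⟩ := htests n
    exact ⟨E, e1, e2, fun ρ hρ => (e3 ρ hρ).trans hn, e4⟩
  have h2 := cFrac_mul_mono n (negLog_antitone h1)
  rw [negLog_exp, neg_neg] at h2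
  refine le_trans (le_of_eq ?_) h2
  rw [cFrac, ← EReal.coe_mul]

end BlockAchievability

section IidMixture

open scoped Matrix

theorem norm_entry_le_one {κ : Type*} [Fintype κ] [DecidableEq κ] {ρ : Matrix κ κ ℂ}
    (h : IsState ρ) (i j : κ) : ‖ρ i j‖ ≤ 1 := by
  have h1 := congrFun (congrFun (eigen_decomp h.1.1) i) j
  rw [h1, Matrix.mul_apply, ← sum_eigenvalues_of_isState h]
  refine norm_sum_le_of_le _ fun x _ => ?_
  rw [Matrix.mul_diagonal, Matrix.conjTranspose_apply, norm_mul, norm_mul, norm_star,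
    Complex.norm_real, Real.norm_eq_abs, abs_of_nonneg (h.1.eigenvalues_nonneg x)]
  have h2 := entry_norm_bound_of_unitary h.1.1.eigenvectorUnitary.2 i x
  have h3 := entry_norm_bound_of_unitary h.1.1.eigenvectorUnitary.2 j x
  have h4 := h.1.eigenvalues_nonneg x
  calc _ ≤ 1 * h.1.1.eigenvalues x * 1 := by gcongr
    _ = _ := by ring

theorem trace_mul_vecMulVec {κ : Type*} [Fintype κ] (A : Matrix κ κ ℂ) (v w : κ → ℂ) :
    (A * Matrix.vecMulVec v w).trace = w ⬝ᵥ A *ᵥ v := by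
  rw [Matrix.mul_vecMulVec, Matrix.trace_vecMulVec, dotProduct_comm]

theorem posSemidef_of_re_trace_mul_nonneg {κ : Type*} [Fintype κ] {A : Matrix κ κ ℂ}
    (hA : A.IsHermitian) (h : ∀ E : Matrix κ κ ℂ, E.PosSemidef → 0 ≤ (A * E).trace.re) :
    A.PosSemidef := by
  refine Matrix.PosSemidef.of_dotProduct_mulVec_nonneg hA fun x => ?_
  have h1 := h _ (Matrix.posSemidef_vecMulVec_self_star x)
  rw [trace_mul_vecMulVec] at h1
  rw [Complex.le_def]
  refine ⟨h1, ?_⟩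
  have h2 : star (star x ⬝ᵥ A *ᵥ x) = star x ⬝ᵥ A *ᵥ x := by
    rw [← Matrix.star_dotProduct, Matrix.star_mulVec, hA.eq, ← Matrix.dotProduct_mulVec]
  have h3 := congrArg Complex.im h2
  rw [Complex.star_def, Complex.conj_im] at h3
  simp only [Complex.zero_im]
  linarith

theorem measurable_entry {ι : Type*} {C : Set (MatC ι)} (i j : ι) :
    Measurable fun σ : ↥C => (σ : MatC ι) i j :=
  (measurable_pi_apply j).comp ((measurable_pi_apply (X := fun _ : ι => ι → ℂ) i).comp
    measurable_subtype_coe)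

theorem integrable_tensorPow {ι : Type*} [Fintype ι] [DecidableEq ι] {C : Set (MatC ι)}
    (hC : ∀ σ ∈ C, IsState σ) (μ : Measure ↥C) [IsProbabilityMeasure μ] (n : ℕ)
    (i j : Fin n → ι) : Integrable (fun σ : ↥C => tensorPow (σ : MatC ι) n i j) μ := by
  refine Integrable.of_bound (C := 1) ?_ ?_
  · exact (Finset.measurable_prod _ fun k _ => measurable_entry (i k) (j k)).aestronglyMeasurable
  · refine ae_of_all _ fun σ => ?_
    rw [tensorPow, norm_prod]
    exact Finset.prod_le_one (fun _ _ => norm_nonneg _) fun k _ =>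
      norm_entry_le_one (hC _ σ.2) _ _

theorem integrable_trace_tensorPow {ι : Type*} [Fintype ι] [DecidableEq ι] {C : Set (MatC ι)}
    (hC : ∀ σ ∈ C, IsState σ) (μ : Measure ↥C) [IsProbabilityMeasure μ] (n : ℕ) (X : MatN ι n) :
    Integrable (fun σ : ↥C => (tensorPow (σ : MatC ι) n * X).trace) μ := by
  simp only [Matrix.trace, Matrix.diag, Matrix.mul_apply]
  exact integrable_finsetSum _ fun i _ => integrable_finsetSum _ fun j _ =>
    (integrable_tensorPow hC μ n i j).mul_const _

theorem trace_iidMix_mul {ι : Type*} [Fintype ι] [DecidableEq ι] {C : Set (MatC ι)}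
    (hC : ∀ σ ∈ C, IsState σ) (μ : Measure ↥C) [IsProbabilityMeasure μ] (n : ℕ) (X : MatN ι n) :
    (iidMix μ n * X).trace = ∫ σ : ↥C, (tensorPow (σ : MatC ι) n * X).trace ∂μ := by
  simp only [Matrix.trace, Matrix.diag, Matrix.mul_apply]
  rw [integral_finsetSum _ fun i _ => integrable_finsetSum _ fun j _ =>
    (integrable_tensorPow hC μ n i j).mul_const _]
  refine Finset.sum_congr rfl fun i _ => ?_
  rw [integral_finsetSum _ fun j _ => (integrable_tensorPow hC μ n i j).mul_const _]
  refine Finset.sum_congr rfl fun j _ => ?_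
  rw [integral_mul_const]
  rfl

theorem re_trace_iidMix_mul {ι : Type*} [Fintype ι] [DecidableEq ι] {C : Set (MatC ι)}
    (hC : ∀ σ ∈ C, IsState σ) (μ : Measure ↥C) [IsProbabilityMeasure μ] (n : ℕ) (X : MatN ι n) :
    (iidMix μ n * X).trace.re = ∫ σ : ↥C, (tensorPow (σ : MatC ι) n * X).trace.re ∂μ := by
  rw [trace_iidMix_mul hC]
  exact (integral_re (integrable_trace_tensorPow hC μ n X)).symm

theorem isState_tensorPow {ι : Type*} [Fintype ι] {σ : MatC ι} (h : IsState σ) (n : ℕ) :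
    IsState (tensorPow σ n) :=
  isState_tensorProdFam fun _ => h

theorem isState_iidMix {ι : Type*} [Fintype ι] [DecidableEq ι] {C : Set (MatC ι)}
    (hC : ∀ σ ∈ C, IsState σ) (μ : Measure ↥C) [IsProbabilityMeasure μ] (n : ℕ) :
    IsState (iidMix μ n) := by
  refine ⟨posSemidef_of_re_trace_mul_nonneg ?_ fun E hE => ?_, ?_⟩
  · ext i j
    rw [Matrix.conjTranspose_apply, Complex.star_def]
    change (starRingEnd ℂ) (∫ σ : ↥C, tensorPow (σ : MatC ι) n j i ∂μ) =
      ∫ σ : ↥C, tensorPow (σ : MatC ι) n i j ∂μ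
    rw [← integral_conj]
    refine integral_congr_ae (ae_of_all _ fun σ => ?_)
    exact (isState_tensorPow (hC _ σ.2) n).1.1.apply i j
  · rw [re_trace_iidMix_mul hC]
    exact integral_nonneg fun σ => re_trace_mul_nonneg (isState_tensorPow (hC _ σ.2) n).1 hE
  · have := trace_iidMix_mul hC μ n 1
    rw [Matrix.mul_one] at this
    rw [this]
    have h1 : ∀ σ : ↥C, (tensorPow (σ : MatC ι) n * 1).trace = 1 := fun σ => by
      rw [Matrix.mul_one, (isState_tensorPow (hC _ σ.2) n).2]
    simp only [h1, integral_const, probReal_univ, one_smul]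

theorem re_trace_iidMix_mul_le {ι : Type*} [Fintype ι] [DecidableEq ι] {C : Set (MatC ι)}
    (hC : ∀ σ ∈ C, IsState σ) (μ : Measure ↥C) [IsProbabilityMeasure μ] {n : ℕ} {X : MatN ι n}
    {β : ℝ} (h : ∀ σ ∈ iidSet C n, (σ * X).trace.re ≤ β) : (iidMix μ n * X).trace.re ≤ β := by
  rw [re_trace_iidMix_mul hC]
  calc _ ≤ ∫ _ : ↥C, β ∂μ := integral_mono (integrable_trace_tensorPow hC μ n X).re
        (integrable_const _) fun σ => h _ ⟨_, σ.2, rfl⟩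
    _ = β := by simp

theorem re_trace_mul_le_of_mem_convexHull {κ : Type*} [Fintype κ] {S : Set (Matrix κ κ ℂ)}
    {X : Matrix κ κ ℂ} {β : ℝ} (h : ∀ ρ ∈ S, (ρ * X).trace.re ≤ β) :
    ∀ ρ ∈ convexHull ℝ S, (ρ * X).trace.re ≤ β := by
  intro ρ hρ
  refine convexHull_min (s := S) (t := {ρ : Matrix κ κ ℂ | (ρ * X).trace.re ≤ β}) h ?_ hρ
  intro a ha b hb s t hs ht hst
  simp only [Set.mem_ofPred_eq] at ha hb ⊢
  simp only [Matrix.add_mul, Matrix.smul_mul, Matrix.trace_add, Matrix.trace_smul, Complex.add_re,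
    Complex.real_smul, Complex.re_ofReal_mul]
  have : β = s * β + t * β := by rw [← add_mul, hst, one_mul]
  rw [this]
  gcongr

theorem le_liminf_cFrac_mul {D : ℕ → EReal} {a b : ℝ}
    (h : ∀ᶠ n : ℕ in atTop, ((a * n + b : ℝ) : EReal) ≤ D n) :
    (a : EReal) ≤ liminf (fun n => cFrac n * D n) atTop := by
  have h1 : Tendsto (fun n : ℕ => a + b * (n : ℝ)⁻¹) atTop (𝓝 a) := by
    simpa using tendsto_const_nhds.add
      ((tendsto_inv_atTop_nhds_zero_nat (𝕜 := ℝ)).const_mul b)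
  have h2 : Tendsto (fun n : ℕ => ((a + b * (n : ℝ)⁻¹ : ℝ) : EReal)) atTop (𝓝 (a : EReal)) :=
    (continuous_coe_real_ereal.tendsto _).comp h1
  rw [← h2.liminf_eq]
  refine liminf_le_liminf ?_
  filter_upwards [h, eventually_gt_atTop 0] with n hn hn0
  refine le_trans (le_of_eq ?_) (cFrac_mul_mono n hn)
  rw [cFrac, ← EReal.coe_mul]
  congr 1
  have : (n : ℝ) ≠ 0 := Nat.cast_ne_zero.mpr hn0.ne'
  field_simp

theorem steinExponent_iid_le_liminf {ι : Type*} [Fintype ι] [DecidableEq ι] {A C : Set (MatC ι)}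
    (hA : ∀ ρ ∈ A, IsState ρ) (hC : ∀ σ ∈ C, IsState σ) (μ : Measure ↥C)
    [IsProbabilityMeasure μ] :
    steinExponent (avSet A) (iidSet C) ≤ liminf (fun n : ℕ =>
      cFrac n * ⨅ ρn ∈ convexHull ℝ (avSet A n), relEnt ρn (iidMix μ n)) atTop := by
  refine EReal.ge_of_forall_gt_iff_ge.mp fun r hr => ?_
  have hst : ∀ n, ∀ ρ ∈ convexHull ℝ (avSet A n), IsState ρ :=
    fun n => isState_of_mem_convexHull (isState_of_mem_avSet hA)
  have key : ∀ {ε : ℝ}, ε ∈ Set.Ioo (0 : ℝ) 1 → 0 < r → (((1 - 4 * ε) * r : ℝ) : EReal) ≤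
      liminf (fun n : ℕ =>
        cFrac n * ⨅ ρn ∈ convexHull ℝ (avSet A n), relEnt ρn (iidMix μ n)) atTop := by
    intro ε hε hr0
    have h1 : (r : EReal) < liminf (fun n : ℕ =>
        cFrac n * negLog (typeII (avSet A n) (iidSet C n) ε)) atTop :=
      hr.trans_le (iInf₂_le ε hε)
    have h2 : ∀ᶠ n : ℕ in atTop, 0 ≤ n * r + Real.log ε :=
      (tendsto_atTop_add_const_right _ _
        (tendsto_natCast_atTop_atTop.atTop_mul_const hr0)).eventually
        (eventually_ge_atTop 0)
    refine le_liminf_cFrac_mul (b := (1 - 4 * ε) * Real.log ε - 1) ?_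
    filter_upwards [eventually_lt_of_lt_liminf h1, h2, eventually_gt_atTop 0] with n hn hn2 hn0
    have hn' : (0 : ℝ) < n := Nat.cast_pos.mpr hn0
    have h3 : typeII (avSet A n) (iidSet C n) ε < Real.exp (-(n * r)) := by
      by_contra! hcon
      have h4 := cFrac_mul_mono n (negLog_antitone hcon)
      rw [negLog_exp, neg_neg, cFrac, ← EReal.coe_mul] at h4
      have h5 : (n : ℝ)⁻¹ * (n * r) = r := by field_simp
      rw [h5] at h4
      exact absurd hn (not_lt.mpr h4)
    obtain ⟨E, e1, e2, e3, e4⟩ := hasTest_of_typeII_lt (isState_of_mem_iidSet hC) hε.1.le h3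
    refine le_iInf₂ fun ρ hρ => ?_
    have h6 := weak_converse (hst n ρ hρ) (isState_iidMix hC μ n) e1 e2 hn2
      (re_trace_mul_le_of_mem_convexHull e3 ρ hρ)
      ((re_trace_iidMix_mul_le hC μ e4).trans_eq (by
        rw [neg_add, Real.exp_add, Real.exp_neg (Real.log ε), Real.exp_log hε.1]
        have := hε.1.ne'
        field_simp))
    refine le_trans (le_of_eq ?_) h6
    congr 1; ring
  rcases le_or_gt r 0 with h0 | h0
  · refine le_trans (b := ((0 : ℝ) : EReal)) (by exact_mod_cast h0) ?_
    refine le_liminf_cFrac_mul (b := -1) (Eventually.of_forall fun n => le_iInf₂ fun ρ hρ => ?_)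
    have h6 := weak_converse (hst n ρ hρ) (isState_iidMix hC μ n) (E := 1) (ε := 1) (t := 0)
      Matrix.PosSemidef.one (by simpa using Matrix.PosSemidef.zero) le_rfl (by simp)
      (by simp [(isState_iidMix hC μ n).2])
    simpa using h6
  · have hlim : Tendsto (fun ε : ℝ => (((1 - 4 * ε) * r : ℝ) : EReal)) (𝓝[>] 0)
        (𝓝 (r : EReal)) := by
      refine (continuous_coe_real_ereal.tendsto _).comp (Tendsto.mono_left ?_ nhdsWithin_le_nhds)
      have : Continuous fun ε : ℝ => (1 - 4 * ε) * r := by fun_prop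
      simpa using this.tendsto 0
    refine le_of_tendsto hlim ?_
    filter_upwards [Ioo_mem_nhdsGT (zero_lt_one (α := ℝ))] with ε hε
    exact key hε h0

end IidMixture

section Compactness

open scoped Matrix

theorem isCompact_convexHull_of_finiteDimensional {E : Type*} [AddCommGroup E] [Module ℝ E]
    [TopologicalSpace E] [IsTopologicalAddGroup E] [ContinuousSMul ℝ E] [FiniteDimensional ℝ E]
    {S : Set E} (hS : IsCompact S) : IsCompact (convexHull ℝ S) := by
  set D := Module.finrank ℝ E + 1
  have himg : convexHull ℝ S = (fun p : (Fin D → ℝ) × (Fin D → E) => ∑ i, p.1 i • p.2 i) ''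
      (stdSimplex ℝ (Fin D) ×ˢ Set.pi Set.univ fun _ => S) := by
    ext x
    constructor
    · intro hx
      obtain ⟨κ, _, z, w, hz, hai, hw, hw1, rfl⟩ := eq_pos_convex_span_of_mem_convexHull hx
      have hcard : Fintype.card κ ≤ Fintype.card (Fin D) := by
        rw [Fintype.card_fin]
        exact hai.card_le_finrank_succ.trans
          (Nat.succ_le_succ (Submodule.finrank_le _))
      obtain ⟨e⟩ := Function.Embedding.nonempty_of_card_le hcard
      obtain ⟨s0, hs0⟩ : S.Nonempty := convexHull_nonempty_iff.mp ⟨_, hx⟩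
      refine ⟨(Function.extend e w 0, Function.extend e z fun _ => s0), ⟨⟨fun j => ?_, ?_⟩, ?_⟩, ?_⟩
      · by_cases hj : ∃ i, e i = j
        · obtain ⟨i, rfl⟩ := hj
          simpa [e.injective.extend_apply] using (hw i).le
        · simp [Function.extend_apply' _ _ _ hj]
      · rw [← hw1]
        refine (Fintype.sum_of_injective e e.injective w _ (fun j hj => ?_) fun i => ?_).symm
        · exact Function.extend_apply' _ _ _ hj
        · exact (e.injective.extend_apply _ _ _).symm
      · intro j _
        by_cases hj : ∃ i, e i = j
        · obtain ⟨i, rfl⟩ := hj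
          simpa [e.injective.extend_apply] using hz ⟨i, rfl⟩
        · simpa [Function.extend_apply' _ _ _ hj] using hs0
      · refine (Fintype.sum_of_injective e e.injective _ _ (fun j hj => ?_) fun i => ?_).symm
        · have hj' : ¬ ∃ i, e i = j := hj
          simp [Function.extend_apply' _ _ _ hj']
        · simp [e.injective.extend_apply]
    · rintro ⟨⟨w, z⟩, ⟨⟨hw, hw1⟩, hz⟩, rfl⟩
      exact (convex_convexHull ℝ S).sum_mem (fun i _ => hw i) hw1
        fun i _ => subset_convexHull ℝ S (hz i trivial)
  rw [himg]
  refine ((isCompact_stdSimplex ℝ (Fin D)).prod (isCompact_univ_pi fun _ => hS)).image ?_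
  fun_prop

theorem isCompact_of_isClosed_of_isState {κ : Type*} [Fintype κ] [DecidableEq κ]
    {S : Set (Matrix κ κ ℂ)} (hS : ∀ ρ ∈ S, IsState ρ) (hc : IsClosed S) : IsCompact S := by
  have hK : IsCompact (Set.pi Set.univ fun _ : κ => Set.pi Set.univ fun _ : κ =>
      Metric.closedBall (0 : ℂ) 1) :=
    isCompact_univ_pi fun _ => isCompact_univ_pi fun _ => isCompact_closedBall _ _
  refine hK.of_isClosed_subset hc fun ρ hρ i _ j _ => ?_
  simpa using norm_entry_le_one (hS ρ hρ) i j

theorem continuous_tensorProdFam {ι : Type*} {n : ℕ} :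
    Continuous (tensorProdFam : (Fin n → MatC ι) → MatN ι n) := by
  refine continuous_matrix fun i j => ?_
  refine continuous_finsetProd _ fun k _ => ?_
  exact (continuous_apply k).matrix_elem (i k) (j k)

theorem isCompact_avSet {ι : Type*} {S : Set (MatC ι)} (hS : IsCompact S) (n : ℕ) :
    IsCompact (avSet S n) := by
  have : avSet S n = tensorProdFam '' (Set.pi Set.univ fun _ : Fin n => S) := by
    ext ρ
    constructor
    · rintro ⟨f, hf, rfl⟩
      exact ⟨f, fun p _ => hf p, rfl⟩
    · rintro ⟨f, hf, rfl⟩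
      exact ⟨f, fun p => hf p trivial, rfl⟩
  rw [this]
  exact (isCompact_univ_pi fun _ => hS).image continuous_tensorProdFam

/-- The interior point of a convex set of matrices used to absorb small perturbations: `τ` together
with a neighbourhood whose trace on the affine span stays in the set. -/
theorem exists_relative_interior {E : Type*} [NormedAddCommGroup E] [NormedSpace ℝ E]
    [FiniteDimensional ℝ E] {C : Set E} (hC : Convex ℝ C) (hne : C.Nonempty) :
    ∃ τ ∈ C, ∃ U : Set E, IsOpen U ∧ τ ∈ U ∧
      ∀ x ∈ C, ∀ y ∈ C, ∀ t : ℝ, τ + t • (x - y) ∈ U → τ + t • (x - y) ∈ C := by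
  obtain ⟨τ, hτ⟩ := hne.intrinsicInterior hC
  obtain ⟨y, hy, rfl⟩ := mem_intrinsicInterior.mp hτ
  obtain ⟨V, hVs, hVo, hyV⟩ := mem_interior.mp hy
  obtain ⟨U, hU, rfl⟩ := isOpen_induced_iff.mp hVo
  refine ⟨y, intrinsicInterior_subset hτ, U, hU, hyV, fun x hx z hz t h => ?_⟩
  have hmem : (y : E) + t • (x - z) ∈ affineSpan ℝ C := by
    have h1 : x - z ∈ (affineSpan ℝ C).direction := by
      rw [← vsub_eq_sub]
      exact AffineSubspace.vsub_mem_direction (subset_affineSpan ℝ C hx) (subset_affineSpan ℝ C hz)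
    have h2 := AffineSubspace.vadd_mem_of_mem_direction (Submodule.smul_mem _ t h1) y.2
    rwa [vadd_eq_add, add_comm] at h2
  exact hVs (a := ⟨_, hmem⟩) h

theorem exists_relative_interior_matrix {κ : Type*} [Fintype κ] {C : Set (Matrix κ κ ℂ)}
    (hC : Convex ℝ C) (hne : C.Nonempty) :
    ∃ τ ∈ C, ∃ U : Set (Matrix κ κ ℂ), IsOpen U ∧ τ ∈ U ∧
      ∀ x ∈ C, ∀ y ∈ C, ∀ t : ℝ, τ + t • (x - y) ∈ U → τ + t • (x - y) ∈ C :=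
  letI : NormedAddCommGroup (Matrix κ κ ℂ) := Matrix.normedAddCommGroup
  letI : NormedSpace ℝ (Matrix κ κ ℂ) := Matrix.normedSpace
  exists_relative_interior hC hne

end Compactness

section UniversalPrior

open scoped Matrix

theorem exists_finite_domination {κ : Type*} [Fintype κ] {C : Set (Matrix κ κ ℂ)}
    (hC : Convex ℝ C) (hK : IsCompact C) (hne : C.Nonempty) (hst : ∀ σ ∈ C, IsState σ)
    {s : ℕ → ↥C} (hs : DenseRange s) {δ : ℝ} (hδ : 0 < δ) (hδ1 : δ ≤ 1) :
    ∃ N : ℕ, ∀ σ ∈ C, ∃ i < N, ((s i : Matrix κ κ ℂ) - (1 - δ) • σ).PosSemidef := by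
  obtain ⟨τ, hτ, U, hU, hτU, hUC⟩ := exists_relative_interior_matrix hC hne
  set q : Matrix κ κ ℂ → Matrix κ κ ℂ := fun σ => (1 - δ) • σ + δ • τ with hq
  have hqC : ∀ σ ∈ C, q σ ∈ C := fun σ hσ =>
    hC hσ hτ (by linarith) hδ.le (by ring)
  have hqc : Continuous q := by fun_prop
  obtain ⟨t, ht⟩ := hK.elim_finite_subcover
    (fun i => (fun σ => τ + δ⁻¹ • ((s i : Matrix κ κ ℂ) - q σ)) ⁻¹' U)
    (fun i => hU.preimage (by fun_prop)) (fun σ hσ => by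
      have hV : IsOpen ((fun x : ↥C => τ + δ⁻¹ • ((x : Matrix κ κ ℂ) - q σ)) ⁻¹' U) :=
        hU.preimage (by fun_prop)
      obtain ⟨i, hi⟩ := hs.exists_mem_open hV ⟨⟨q σ, hqC σ hσ⟩, by simpa using hτU⟩
      exact Set.mem_iUnion.mpr ⟨i, hi⟩)
  refine ⟨t.sup id + 1, fun σ hσ => ?_⟩
  obtain ⟨i, hit, hi⟩ := Set.mem_iUnion₂.mp (ht hσ)
  refine ⟨i, Nat.lt_succ_of_le (Finset.le_sup (f := id) hit), ?_⟩
  have h1 := (hst _ (hUC _ (s i).2 _ (hqC σ hσ) δ⁻¹ hi)).1.smul hδ.le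
  convert h1 using 1
  rw [smul_add, smul_smul, mul_inv_cancel₀ hδ.ne', one_smul, hq]
  simp only []
  abel

theorem exists_absorbing {κ : Type*} [Fintype κ] {C : Set (Matrix κ κ ℂ)}
    (hC : Convex ℝ C) (hne : C.Nonempty) (hst : ∀ σ ∈ C, IsState σ) :
    ∃ τ ∈ C, ∀ σ ∈ C, ∃ t : ℝ, 0 < t ∧ (τ - t • σ).PosSemidef := by
  obtain ⟨τ, hτ, U, hU, hτU, hUC⟩ := exists_relative_interior_matrix hC hne
  refine ⟨τ, hτ, fun σ hσ => ?_⟩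
  have hc : Continuous fun u : ℝ => τ + u • (τ - σ) := by fun_prop
  have h1 : ∀ᶠ u : ℝ in 𝓝 0, τ + u • (τ - σ) ∈ U :=
    (hc.tendsto 0).eventually (hU.mem_nhds (by simpa using hτU))
  obtain ⟨u, hu, hu0⟩ := ((h1.filter_mono nhdsWithin_le_nhds).and
    (self_mem_nhdsWithin (s := Set.Ioi (0 : ℝ)))).exists
  have hu0 : 0 < u := hu0
  refine ⟨u / (1 + u), by positivity, ?_⟩
  have h2 := (hst _ (hUC _ hτ _ hσ u hu)).1.smul (a := (1 + u)⁻¹) (by positivity)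
  convert h2 using 1
  have h3 : (1 + u)⁻¹ * u = u / (1 + u) := by field_simp
  have h4 : (1 + u)⁻¹ + (1 + u)⁻¹ * u = 1 := by field_simp
  rw [smul_add, smul_smul, smul_sub, h3, ← add_sub_assoc, ← add_smul, ← h3, h4, one_smul]

open scoped MatrixOrder in
theorem mul_eq_zero_of_conj_eq_zero {κ : Type*} [Fintype κ] {A B : Matrix κ κ ℂ}
    (hA : A.PosSemidef) (h : Bᴴ * A * B = 0) : A * B = 0 := by
  obtain ⟨D, rfl⟩ := CStarAlgebra.nonneg_iff_eq_star_mul_self.mp hA.nonneg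
  rw [Matrix.star_eq_conjTranspose] at h ⊢
  have h1 : (D * B)ᴴ * (D * B) = 0 := by
    rw [← h, Matrix.conjTranspose_mul]; simp only [Matrix.mul_assoc]
  rw [Matrix.mul_assoc, Matrix.conjTranspose_mul_self_eq_zero.mp h1, Matrix.mul_zero]

/-- The support projection of a positive semidefinite matrix, with a spectral gap. -/
theorem exists_support_projection {κ : Type*} [Fintype κ] [DecidableEq κ] {τ : Matrix κ κ ℂ}
    (hτ : τ.PosSemidef) : ∃ Q : Matrix κ κ ℂ, Q.PosSemidef ∧ Q * τ = τ ∧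
      ∃ c : ℝ, 0 < c ∧ (τ - c • Q).PosSemidef := by
  set V := (hτ.1.eigenvectorUnitary : Matrix κ κ ℂ)
  set r := hτ.1.eigenvalues
  have hr : ∀ i, 0 ≤ r i := hτ.eigenvalues_nonneg
  obtain ⟨c, hc, hcr⟩ : ∃ c : ℝ, 0 < c ∧ ∀ i, r i ≠ 0 → c ≤ r i := by
    by_cases h : (Finset.univ.filter fun i => r i ≠ 0).Nonempty
    · refine ⟨(Finset.univ.filter fun i => r i ≠ 0).inf' h r, ?_, fun i hi => ?_⟩
      · rw [Finset.lt_inf'_iff]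
        intro i hi
        exact lt_of_le_of_ne (hr i) (Ne.symm (by simpa using hi))
      · exact Finset.inf'_le _ (by simpa using hi)
    · refine ⟨1, one_pos, fun i hi => absurd ⟨i, by simpa using hi⟩ h⟩
  have hpos : ∀ f : κ → ℝ, (∀ i, 0 ≤ f i) →
      (V * Matrix.diagonal (fun i => (f i : ℂ)) * Vᴴ).PosSemidef := fun f hf =>
    (Matrix.PosSemidef.diagonal fun i => by
      simpa using hf i : (Matrix.diagonal (fun i =>
        (f i : ℂ))).PosSemidef).mul_mul_conjTranspose_same V
  refine ⟨V * Matrix.diagonal (fun i => ((if r i = 0 then 0 else 1 : ℝ) : ℂ)) * Vᴴ,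
    hpos _ fun i => by split_ifs <;> norm_num, ?_, c, hc, ?_⟩
  · conv_lhs => rw [eigen_decomp hτ.1]
    conv_rhs => rw [eigen_decomp hτ.1]
    have h1 : V * Matrix.diagonal (fun i => ((if r i = 0 then 0 else 1 : ℝ) : ℂ)) * Vᴴ *
        (V * Matrix.diagonal (fun i => (r i : ℂ)) * Vᴴ) =
        V * (Matrix.diagonal (fun i => ((if r i = 0 then 0 else 1 : ℝ) : ℂ)) * (Vᴴ * V) *
          Matrix.diagonal (fun i => (r i : ℂ))) * Vᴴ := by
      simp only [Matrix.mul_assoc]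
    refine h1.trans ?_
    rw [(eigen_unitary hτ.1).1, Matrix.mul_one, Matrix.diagonal_mul_diagonal]
    congr 3
    funext i
    change ((if r i = 0 then 0 else 1 : ℝ) : ℂ) * (r i : ℂ) = (r i : ℂ)
    by_cases hi : r i = 0 <;> simp [hi]
  · have h2 := hpos (fun i => r i - c * (if r i = 0 then 0 else 1)) fun i => by
      split_ifs with h
      · simp [h]
      · linarith [hcr i h]
    convert h2 using 1
    conv_lhs => enter [1]; rw [eigen_decomp hτ.1]
    rw [← Matrix.smul_mul, ← Matrix.mul_smul, ← Matrix.sub_mul, ← Matrix.mul_sub]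
    congr 2
    ext i j
    by_cases hij : i = j
    · subst hij
      have hri : hτ.1.eigenvalues i = r i := rfl
      by_cases h : r i = 0 <;> simp [h, hri]
    · simp [hij]

theorem support_projection_mul {κ : Type*} [Fintype κ] [DecidableEq κ] {τ σ Q : Matrix κ κ ℂ}
    (hQ : Q.PosSemidef) (hQτ : Q * τ = τ) (hσ : σ.PosSemidef) {t : ℝ} (ht : 0 < t)
    (h : (τ - t • σ).PosSemidef) : Q * σ = σ := by
  set P := 1 - Q
  have hP : Pᴴ = P := by
    rw [Matrix.conjTranspose_sub, Matrix.conjTranspose_one, hQ.1.eq]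
  have h1 := h.conjTranspose_mul_mul_same P
  have h2 := (hσ.conjTranspose_mul_mul_same P)
  have h3 : P * τ = 0 := by rw [Matrix.sub_mul, hQτ, Matrix.one_mul, sub_self]
  have h4 : Pᴴ * (τ - t • σ) * P = -(t • (Pᴴ * σ * P)) := by
    rw [hP, Matrix.mul_sub P τ, h3, zero_sub, Matrix.mul_smul, Matrix.neg_mul, Matrix.smul_mul]
  rw [h4] at h1
  have h5 : (Pᴴ * σ * P) = 0 := by
    have h6 := h2.smul ht.le
    have h7 : (t • (Pᴴ * σ * P)).trace = 0 := by
      refine le_antisymm ?_ h6.trace_nonneg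
      have := h1.trace_nonneg
      rw [Matrix.trace_neg] at this
      exact neg_nonneg.mp this
    have h8 := h6.trace_eq_zero_iff.mp h7
    exact (smul_eq_zero.mp h8).resolve_left ht.ne'
  have h9 := mul_eq_zero_of_conj_eq_zero hσ h5
  have h10 := congrArg Matrix.conjTranspose h9
  rw [Matrix.conjTranspose_mul, hP, hσ.1.eq, Matrix.conjTranspose_zero, Matrix.sub_mul,
    Matrix.one_mul, sub_eq_zero] at h10
  exact h10.symm

instance matMeasurableSingletonClass (m n : Type*) [Countable m] [Countable n] :
    MeasurableSingletonClass (Matrix m n ℂ) :=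
  inferInstanceAs (MeasurableSingletonClass (m → n → ℂ))

instance matSecondCountable (m n : Type*) [Countable m] [Countable n] :
    SecondCountableTopology (Matrix m n ℂ) :=
  inferInstanceAs (SecondCountableTopology (m → n → ℂ))

theorem exists_measure_pos_singleton {α : Type*} [MeasurableSpace α] [MeasurableSingletonClass α]
    (s : ℕ → α) : ∃ μ : Measure α, IsProbabilityMeasure μ ∧ ∀ i, 0 < μ.real {s i} := by
  set p : unitInterval := ⟨1 / 2, by norm_num, by norm_num⟩
  set ν := ProbabilityTheory.geometricMeasure p
  have hs : Measurable s := measurable_from_nat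
  refine ⟨ν.map s, Measure.isProbabilityMeasure_map hs.aemeasurable, fun i => ?_⟩
  have := Measure.isProbabilityMeasure_map (μ := ν) hs.aemeasurable
  rw [map_measureReal_apply hs (measurableSet_singleton _)]
  refine lt_of_lt_of_le ?_ (measureReal_mono (s₁ := {i}) (by simp))
  refine ProbabilityTheory.geometricMeasure_real_singleton_pos ?_ ?_ i
  · intro h; have := congrArg Subtype.val h; norm_num [p] at this
  · intro h; have := congrArg Subtype.val h; norm_num [p] at this

theorem posSemidef_iidMix_sub {ι : Type*} [Fintype ι] [DecidableEq ι] {C : Set (MatC ι)}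
    (hC : ∀ σ ∈ C, IsState σ) (μ : Measure ↥C) [IsProbabilityMeasure μ] (n : ℕ) (σ : ↥C) :
    (iidMix μ n - μ.real {σ} • tensorPow (σ : MatC ι) n).PosSemidef := by
  have hσ := isState_tensorPow (hC _ σ.2) n
  refine posSemidef_of_re_trace_mul_nonneg
    ((isState_iidMix hC μ n).1.1.sub (hσ.1.smul measureReal_nonneg).1) fun E hE => ?_
  rw [Matrix.sub_mul, Matrix.trace_sub, Complex.sub_re, re_trace_iidMix_mul hC, Matrix.smul_mul,
    Matrix.trace_smul, Complex.real_smul, Complex.re_ofReal_mul, sub_nonneg]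
  have h1 := setIntegral_le_integral (s := {σ}) (integrable_trace_tensorPow hC μ n E).re
    (ae_of_all _ fun ω => re_trace_mul_nonneg (isState_tensorPow (hC _ ω.2) n).1 hE)
  rw [integral_singleton] at h1
  simpa using h1

theorem tensorPow_mul_iidMix {ι : Type*} [Fintype ι] [DecidableEq ι] {C : Set (MatC ι)}
    (hC : ∀ σ ∈ C, IsState σ) (μ : Measure ↥C) [IsProbabilityMeasure μ] (n : ℕ) {Q : MatC ι}
    (hQ : ∀ σ ∈ C, Q * σ = σ) : tensorPow Q n * iidMix μ n = iidMix μ n := by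
  ext i j
  rw [Matrix.mul_apply]
  change ∑ l, tensorPow Q n i l * ∫ σ : ↥C, tensorPow (σ : MatC ι) n l j ∂μ =
    ∫ σ : ↥C, tensorPow (σ : MatC ι) n i j ∂μ
  simp_rw [← integral_const_mul]
  rw [← integral_finsetSum _ fun l _ => (integrable_tensorPow hC μ n l j).const_mul _]
  refine integral_congr_ae (ae_of_all _ fun σ => ?_)
  have h : tensorPow Q n * tensorPow (σ : MatC ι) n = tensorPow (σ : MatC ι) n := by
    change tensorProdFam (fun _ => Q) * tensorProdFam (fun _ => (σ : MatC ι)) = _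
    rw [tensorProdFam_mul, hQ _ σ.2]; rfl
  exact congrFun (congrFun h i) j

theorem eigenvalue_lower_bound {κ : Type*} [Fintype κ] [DecidableEq κ] {A Q : Matrix κ κ ℂ}
    (hA : A.IsHermitian) (hQA : Q * A = A) {c : ℝ} (h : (A - c • Q).PosSemidef) (x : κ)
    (hx : hA.eigenvalues x ≠ 0) : c ≤ hA.eigenvalues x := by
  set V := (hA.eigenvectorUnitary : Matrix κ κ ℂ)
  set D := Matrix.diagonal (fun i => (hA.eigenvalues i : ℂ))
  have hVA : Vᴴ * A * V = D := by
    conv_lhs => rw [eigen_decomp hA]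
    rw [Matrix.mul_assoc, Matrix.mul_assoc, Matrix.mul_assoc, (eigen_unitary hA).1, Matrix.mul_one,
      ← Matrix.mul_assoc, (eigen_unitary hA).1, Matrix.one_mul]
  have h1 : Vᴴ * Q * V * D = D := by
    rw [← hVA]
    calc Vᴴ * Q * V * (Vᴴ * A * V) = Vᴴ * Q * (V * Vᴴ) * A * V := by
          simp only [Matrix.mul_assoc]
      _ = Vᴴ * A * V := by
          rw [(eigen_unitary hA).2, Matrix.mul_one, Matrix.mul_assoc Vᴴ, hQA]
  have hD : D x x = (hA.eigenvalues x : ℂ) := Matrix.diagonal_apply_eq _ _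
  have h2 := congrFun (congrFun h1 x) x
  rw [Matrix.mul_diagonal, hD] at h2
  have h3 : (Vᴴ * Q * V) x x = 1 :=
    mul_right_cancel₀ (Complex.ofReal_ne_zero.mpr hx) (h2.trans (one_mul _).symm)
  have h4 := (h.conjTranspose_mul_mul_same V).diag_nonneg (i := x)
  rw [Matrix.mul_sub, Matrix.sub_mul, hVA, Matrix.mul_smul, Matrix.smul_mul, Matrix.sub_apply,
    Matrix.smul_apply, h3, hD] at h4
  have h5 := (Complex.le_def.mp h4).1
  simpa using h5

end UniversalPrior

section TypeClasses

open scoped Nat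

theorem factorial_mul_pow_le (t k : ℕ) : t ! * t ^ k ≤ k ! * t ^ t := by
  rcases le_total t k with h | h
  · calc t ! * t ^ k = t ! * t ^ (k - t) * t ^ t := by
          rw [mul_assoc, ← pow_add, Nat.sub_add_cancel h]
      _ ≤ k ! * t ^ t := Nat.mul_le_mul_right _ (Nat.factorial_mul_pow_sub_le_factorial h)
  · have h1 := Nat.factorial_mul_descFactorial (Nat.sub_le t k)
    rw [Nat.sub_sub_self h] at h1
    calc t ! * t ^ k = k ! * t.descFactorial (t - k) * t ^ k := by rw [h1]
      _ ≤ k ! * t ^ (t - k) * t ^ k := by gcongr; exact Nat.descFactorial_le_pow _ _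
      _ = k ! * t ^ t := by rw [mul_assoc, ← pow_add, Nat.sub_add_cancel h]

/-- The type class of a distribution has polynomially large probability under it. -/
theorem typeClass_bound {n N : ℕ} (t : Fin N → ℕ) (ht : ∑ i, t i = n) :
    n ^ n * ∏ i, (t i)! ≤ (n + 1) ^ N * n ! * ∏ i, t i ^ t i := by
  have hcard : (Finset.univ.piAntidiag n : Finset (Fin N → ℕ)).card ≤ (n + 1) ^ N := by
    have : (Finset.univ.piAntidiag n : Finset (Fin N → ℕ)) ⊆
        Fintype.piFinset fun _ => Finset.range (n + 1) := by
      intro k hk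
      rw [Finset.mem_piAntidiag] at hk
      rw [Fintype.mem_piFinset]
      intro i
      have := Finset.single_le_sum (f := k) (fun _ _ => Nat.zero_le _) (Finset.mem_univ i)
      rw [Finset.mem_range]
      have h2 : ∑ x, k x = n := hk.1
      omega
    refine (Finset.card_le_card this).trans ?_
    simp
  have hterm : ∀ k ∈ (Finset.univ.piAntidiag n : Finset (Fin N → ℕ)),
      Nat.multinomial Finset.univ k * (∏ i, t i ^ k i) * ∏ i, (t i)! ≤ n ! * ∏ i, t i ^ t i := by
    intro k hk
    rw [Finset.mem_piAntidiag] at hk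
    have h1 := Nat.multinomial_spec Finset.univ k
    have h2 : Finset.univ.sum k = n := hk.1
    rw [h2] at h1
    rw [← h1]
    calc Nat.multinomial Finset.univ k * (∏ i, t i ^ k i) * ∏ i, (t i)!
        = Nat.multinomial Finset.univ k * ∏ i, ((t i)! * t i ^ k i) := by
          rw [Finset.prod_mul_distrib]; ring
      _ ≤ Nat.multinomial Finset.univ k * ∏ i, ((k i)! * t i ^ t i) := by
          exact Nat.mul_le_mul_left _ (Finset.prod_le_prod (fun _ _ => Nat.zero_le _)
            fun _ _ => factorial_mul_pow_le _ _)
      _ = _ := by rw [Finset.prod_mul_distrib]; ring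
  calc n ^ n * ∏ i, (t i)! = ∑ k ∈ (Finset.univ.piAntidiag n : Finset (Fin N → ℕ)),
        Nat.multinomial Finset.univ k * (∏ i, t i ^ k i) * ∏ i, (t i)! := by
        conv_lhs => enter [1, 1]; rw [← ht]
        rw [Finset.sum_pow_eq_sum_piAntidiag, Finset.sum_mul]
        simp only [Nat.cast_id]
    _ ≤ ∑ k ∈ (Finset.univ.piAntidiag n : Finset (Fin N → ℕ)), n ! * ∏ i, t i ^ t i :=
        Finset.sum_le_sum hterm
    _ ≤ _ := by
        rw [Finset.sum_const, smul_eq_mul, mul_assoc]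
        exact Nat.mul_le_mul_right _ hcard

theorem card_perm_comp_eq_le {n N : ℕ} (f f' : Fin n → Fin N) :
    (Finset.univ.filter fun π : Equiv.Perm (Fin n) => f ∘ π = f').card ≤
      ∏ i, (Finset.univ.filter fun p => f p = i).card ! := by
  have h0 := DomMulAct.stabilizer_card f
  simp only [Fintype.card_subtype] at h0
  rcases (Finset.univ.filter fun π : Equiv.Perm (Fin n) => f ∘ π = f').eq_empty_or_nonempty with
    h | ⟨π₀, hπ₀⟩
  · rw [h]; simp
  · rw [← h0]
    refine Finset.card_le_card_of_injOn (fun π => π * π₀⁻¹) (fun π hπ => ?_)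
      fun a _ b _ hab => mul_right_cancel hab
    have h1 : f ∘ π = f' := by simpa using hπ
    have h2 : f ∘ π₀ = f' := by simpa using hπ₀
    have h3 : f ∘ ⇑(π * π₀⁻¹) = f := by
      funext x
      have := congrFun (h1.trans h2.symm) (π₀⁻¹ x)
      simpa using this
    simpa using h3

/-- The average of a product over all permutations of its factors. -/
def symProd {κ : Type*} {n : ℕ} (g : Fin n → MatC κ) : MatN κ n :=
  ((n ! : ℝ)⁻¹) • ∑ π : Equiv.Perm (Fin n), tensorProdFam (g ∘ π)

theorem posSemidef_pow_sub_symProd_comp {κ : Type*} [Fintype κ] {n N : ℕ} (hn : 0 < n)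
    {s : Fin N → MatC κ} (hs : ∀ i, (s i).PosSemidef) (f : Fin n → Fin N) :
    (((n + 1 : ℝ) ^ N) •
        tensorPow (∑ i, ((Finset.univ.filter fun p => f p = i).card / n : ℝ) • s i) n
      - symProd (s ∘ f)).PosSemidef := by
  set t : Fin N → ℕ := fun i => (Finset.univ.filter fun p => f p = i).card with ht
  have hsum : ∑ i, t i = n := by
    have := Finset.card_eq_sum_card_fiberwise (f := f) (s := Finset.univ) (t := Finset.univ)
      (fun _ _ => Finset.mem_coe.mpr (Finset.mem_univ _))
    simpa [ht] using this.symm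
  have hn' : (0 : ℝ) < n := by exact_mod_cast hn
  have h1 : tensorPow (∑ i, (t i / n : ℝ) • s i) n =
      ∑ f' : Fin n → Fin N, (∏ p, (t (f' p) / n : ℝ)) • tensorProdFam (s ∘ f') := by
    change tensorProdFam (fun _ : Fin n => ∑ i, (t i / n : ℝ) • s i) = _
    rw [tensorProdFam_sum]
    refine Finset.sum_congr rfl fun f' _ => ?_
    ext i j
    simp [tensorProdFam, Finset.prod_mul_distrib]
  have h2 : symProd (s ∘ f) = ∑ f' : Fin n → Fin N,
      ((Finset.univ.filter fun π : Equiv.Perm (Fin n) => f ∘ π = f').card / (n ! : ℝ)) •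
        tensorProdFam (s ∘ f') := by
    rw [symProd, ← Finset.sum_fiberwise (s := Finset.univ)
      (g := fun π : Equiv.Perm (Fin n) => f ∘ π), Finset.smul_sum]
    refine Finset.sum_congr rfl fun f' _ => ?_
    rw [Finset.sum_congr rfl (g := fun _ => tensorProdFam (s ∘ f')) fun π hπ => by
      rw [Function.comp_assoc, (Finset.mem_filter.mp hπ).2], Finset.sum_const,
      ← Nat.cast_smul_eq_nsmul ℝ, smul_smul, div_eq_inv_mul]
  rw [h1, h2, Finset.smul_sum, ← Finset.sum_sub_distrib]
  refine Matrix.posSemidef_sum _ fun f' _ => ?_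
  rw [smul_smul, ← sub_smul]
  refine (posSemidef_tensorProdFam fun p => hs _).smul ?_
  rw [sub_nonneg]
  by_cases hne : (Finset.univ.filter fun π : Equiv.Perm (Fin n) => f ∘ π = f').Nonempty
  · obtain ⟨π, hπ⟩ := hne
    have hπ : f ∘ π = f' := by simpa using hπ
    have h3 : ∏ p, (t (f' p) / n : ℝ) = (∏ i, (t i : ℝ) ^ t i) / n ^ n := by
      rw [Finset.prod_div_distrib, Finset.prod_const, Finset.card_univ, Fintype.card_fin]
      congr 1
      have h4 : ∏ p, (t (f' p) : ℝ) = ∏ p, (t (f p) : ℝ) := by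
        rw [← hπ]
        exact Equiv.prod_comp π (fun p => (t (f p) : ℝ))
      rw [h4, ← Finset.prod_fiberwise (s := Finset.univ) (g := f)]
      refine Finset.prod_congr rfl fun i _ => ?_
      rw [Finset.prod_congr rfl (g := fun _ => (t i : ℝ)) fun p hp => by
        rw [(Finset.mem_filter.mp hp).2], Finset.prod_const]
    rw [h3]
    have h5 : ((Finset.univ.filter fun π : Equiv.Perm (Fin n) => f ∘ π = f').card : ℝ) ≤
        ∏ i, ((t i)! : ℝ) := by exact_mod_cast card_perm_comp_eq_le f f'
    have h6 : (n : ℝ) ^ n * ∏ i, ((t i)! : ℝ) ≤ (n + 1 : ℝ) ^ N * n ! * ∏ i, (t i : ℝ) ^ t i := by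
      exact_mod_cast typeClass_bound t hsum
    rw [← mul_div_assoc, div_le_div_iff₀ (by positivity) (by positivity)]
    calc _ ≤ (∏ i, ((t i)! : ℝ)) * n ^ n := by gcongr
      _ ≤ _ := by linarith
  · rw [Finset.not_nonempty_iff_eq_empty] at hne
    rw [hne, Finset.card_empty, Nat.cast_zero, zero_div]
    exact mul_nonneg (pow_nonneg (by linarith) _)
      (Finset.prod_nonneg fun _ _ => div_nonneg (Nat.cast_nonneg _) (Nat.cast_nonneg _))

/-- Symmetrised products of elements of `C` are dominated by the mixture `iidMix μ n`, up to a
subexponential factor, when `μ` charges a dense sequence. -/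
theorem exists_iidMix_sub_symProd {κ : Type*} [Fintype κ] [DecidableEq κ] {C : Set (MatC κ)}
    (hC : Convex ℝ C) (hK : IsCompact C) (hne : C.Nonempty) (hst : ∀ σ ∈ C, IsState σ)
    {s : ℕ → ↥C} (hs : DenseRange s) (μ : Measure ↥C) [IsProbabilityMeasure μ]
    (hμ : ∀ i, 0 < μ.real {s i}) {δ : ℝ} (hδ : 0 < δ) (hδ1 : δ < 1) :
    ∃ (N : ℕ) (K : ℝ), 0 < K ∧ ∀ n, 0 < n → ∀ g : Fin n → MatC κ, (∀ p, g p ∈ C) →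
      ((K * (n + 1 : ℝ) ^ N * ((1 - δ)⁻¹ ^ n * (1 - δ)⁻¹ ^ n)) • iidMix μ n -
        symProd g).PosSemidef := by
  obtain ⟨N, hN⟩ := exists_finite_domination hC hK hne hst hs hδ hδ1.le
  have hδ' : 0 < 1 - δ := by linarith
  obtain ⟨w, hw, hwle⟩ : ∃ w : ℝ, 0 < w ∧ ∀ i < N, w ≤ μ.real {s i} := by
    rcases (Finset.range N).eq_empty_or_nonempty with h | h
    · exact ⟨1, one_pos, fun i hi => absurd (Finset.mem_range.mpr hi) (by simp [h])⟩
    · refine ⟨(Finset.range N).inf' h fun i => μ.real {s i}, ?_, fun i hi =>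
        Finset.inf'_le _ (Finset.mem_range.mpr hi)⟩
      rw [Finset.lt_inf'_iff]
      exact fun i _ => hμ i
  refine ⟨N, w⁻¹, inv_pos.mpr hw, fun n hn g hg => ?_⟩
  choose i hi hi' using fun p => hN (g p) (hg p)
  set f : Fin n → Fin N := fun p => ⟨i p, hi p⟩
  set s' : Fin N → MatC κ := fun l => (s l : MatC κ)
  have hs' : ∀ l, s' l ∈ C := fun l => (s l).2
  set c := (1 - δ)⁻¹ with hc
  have hcpos : 0 < c := inv_pos.mpr hδ'
  have scale : ∀ σ τ : MatC κ, (τ - (1 - δ) • σ).PosSemidef → (c • τ - σ).PosSemidef := by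
    intro σ τ h
    have h1 := h.smul hcpos.le
    have heq : c • τ - σ = c • (τ - (1 - δ) • σ) := by
      rw [smul_sub, smul_smul, hc, inv_mul_cancel₀ hδ'.ne', one_smul]
    rw [heq]; exact h1
  have powsmul : ∀ {m : ℕ} (h : Fin m → MatC κ),
      tensorProdFam (fun p => c • h p) = c ^ m • tensorProdFam h := by
    intro m h
    ext i j
    simp [tensorProdFam, Finset.prod_mul_distrib]
  have h1 : ((c ^ n) • symProd (s' ∘ f) - symProd g).PosSemidef := by
    have h2 : ∀ π : Equiv.Perm (Fin n), ((c ^ n) • tensorProdFam ((s' ∘ f) ∘ π) -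
        tensorProdFam (g ∘ π)).PosSemidef := fun π => by
      rw [← powsmul]
      exact posSemidef_tensorProdFam_sub (fun p => (hst _ (hg _)).1)
        fun p => scale _ _ (hi' (π p))
    have heq : (c ^ n) • symProd (s' ∘ f) - symProd g = ((n ! : ℝ)⁻¹) •
        ∑ π : Equiv.Perm (Fin n), ((c ^ n) • tensorProdFam ((s' ∘ f) ∘ π) -
          tensorProdFam (g ∘ π)) := by
      rw [Finset.sum_sub_distrib, smul_sub, ← Finset.smul_sum, smul_comm, symProd, symProd]
    rw [heq]
    exact (Matrix.posSemidef_sum _ fun π _ => h2 π).smul (by positivity)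
  have h3 := posSemidef_pow_sub_symProd_comp hn (fun l => (hst _ (hs' l)).1) f
  set sb := ∑ l, ((Finset.univ.filter fun p => f p = l).card / n : ℝ) • s' l
  have hn' : (n : ℝ) ≠ 0 := by exact_mod_cast hn.ne'
  have hsb : sb ∈ C := by
    refine hC.sum_mem (fun l _ => by positivity) ?_ fun l _ => hs' l
    rw [← Finset.sum_div, div_eq_one_iff_eq hn', ← Nat.cast_sum]
    have := Finset.card_eq_sum_card_fiberwise (f := f) (s := Finset.univ) (t := Finset.univ)
      (fun _ _ => Finset.mem_coe.mpr (Finset.mem_univ _))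
    rw [← this]; simp
  obtain ⟨l, hl, hl'⟩ := hN sb hsb
  have h4 : ((c ^ n) • tensorPow (s l : MatC κ) n - tensorPow sb n).PosSemidef := by
    have : (c ^ n) • tensorPow (s l : MatC κ) n = tensorProdFam (fun _ => c • (s l : MatC κ)) :=
      (powsmul _).symm
    rw [this]
    exact posSemidef_tensorProdFam_sub (fun p => (hst _ hsb).1) fun p => scale _ _ hl'
  have h5 : (w⁻¹ • iidMix μ n - tensorPow (s l : MatC κ) n).PosSemidef := by
    have h6 := (posSemidef_iidMix_sub hst μ n (s l)).smul (inv_pos.mpr (hμ l)).le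
    have h7 := (isState_iidMix hst μ n).1.smul
      (sub_nonneg.mpr (inv_anti₀ hw (hwle l hl)))
    have heq : w⁻¹ • iidMix μ n - tensorPow (s l : MatC κ) n =
        (μ.real {s l})⁻¹ • (iidMix μ n - μ.real {s l} • tensorPow (s l : MatC κ) n) +
        (w⁻¹ - (μ.real {s l})⁻¹) • iidMix μ n := by
      rw [smul_sub, smul_smul, inv_mul_cancel₀ (hμ l).ne', one_smul, sub_smul]; abel
    rw [heq]; exact h6.add h7
  have heq : (w⁻¹ * (n + 1 : ℝ) ^ N * (c ^ n * c ^ n)) • iidMix μ n - symProd g =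
      ((n + 1 : ℝ) ^ N * (c ^ n * c ^ n)) • (w⁻¹ • iidMix μ n - tensorPow (s l : MatC κ) n) +
      ((n + 1 : ℝ) ^ N * c ^ n) • ((c ^ n) • tensorPow (s l : MatC κ) n - tensorPow sb n) +
      (c ^ n) • ((n + 1 : ℝ) ^ N • tensorPow sb n - symProd (s' ∘ f)) +
      ((c ^ n) • symProd (s' ∘ f) - symProd g) := by
    simp only [smul_sub, smul_smul]
    have e1 : w⁻¹ * (n + 1 : ℝ) ^ N * (c ^ n * c ^ n) =
      (n + 1 : ℝ) ^ N * (c ^ n * c ^ n) * w⁻¹ := by ring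
    have e2 : (n + 1 : ℝ) ^ N * c ^ n * c ^ n = (n + 1 : ℝ) ^ N * (c ^ n * c ^ n) := by ring
    have e3 : (n + 1 : ℝ) ^ N * c ^ n = c ^ n * (n + 1 : ℝ) ^ N := by ring
    rw [e2, e3, e1]
    abel
  rw [heq]
  exact (((h5.smul (by positivity)).add (h4.smul (by positivity))).add
    (h3.smul (by positivity))).add h1

end TypeClasses

section EntropyBounds

open scoped Matrix

/-- The nonzero eigenvalues of `iidMix μ n` decay at most exponentially. -/
theorem exists_eigenvalue_iidMix_ge {κ : Type*} [Fintype κ] [DecidableEq κ] {C : Set (MatC κ)}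
    (hC : Convex ℝ C) (hK : IsCompact C) (hne : C.Nonempty) (hst : ∀ σ ∈ C, IsState σ)
    {s : ℕ → ↥C} (hs : DenseRange s) (μ : Measure ↥C) [IsProbabilityMeasure μ]
    (hμ : ∀ i, 0 < μ.real {s i}) :
    ∃ a : ℕ, ∀ n (h : (iidMix μ n).IsHermitian) (x : Fin n → κ), h.eigenvalues x ≠ 0 →
      Real.exp (-((a * (n + 1) : ℕ) : ℝ)) ≤ h.eigenvalues x := by
  obtain ⟨τ, hτ, hτC⟩ := exists_absorbing hC hne hst
  obtain ⟨Q, hQ, hQτ, c, hc, hcQ⟩ := exists_support_projection (hst τ hτ).1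
  have hQσ : ∀ σ ∈ C, Q * σ = σ := fun σ hσ => by
    obtain ⟨t, ht, h⟩ := hτC σ hσ
    exact support_projection_mul hQ hQτ (hst σ hσ).1 ht h
  obtain ⟨N, hN⟩ := exists_finite_domination hC hK hne hst hs (δ := 1 / 2) (by norm_num)
    (by norm_num)
  obtain ⟨i, -, hi⟩ := hN τ hτ
  set w := μ.real {s i} with hw
  set b := c / 2 with hb
  have hb0 : 0 < b := by positivity
  have h1 : ((s i : MatC κ) - b • Q).PosSemidef := by
    have h2 := hcQ.smul (a := (1 / 2 : ℝ)) (by norm_num)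
    have heq : (s i : MatC κ) - b • Q = ((s i : MatC κ) - (1 - 1 / 2 : ℝ) • τ) +
        (1 / 2 : ℝ) • (τ - c • Q) := by
      rw [smul_sub, smul_smul, hb]
      have e1 : (1 - 1 / 2 : ℝ) = 1 / 2 := by norm_num
      have e2 : (1 / 2 : ℝ) * c = c / 2 := by ring
      rw [e1, e2]; abel
    rw [heq]; exact hi.add h2
  obtain ⟨a, ha⟩ := exists_nat_ge (|Real.log w| + |Real.log b|)
  refine ⟨a, fun n h x hx => ?_⟩
  have h3 : (tensorPow (s i : MatC κ) n - b ^ n • tensorPow Q n).PosSemidef := by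
    have : b ^ n • tensorPow Q n = tensorProdFam (fun _ : Fin n => b • Q) := by
      ext i j
      simp [tensorProdFam, tensorPow, Finset.prod_mul_distrib]
    rw [this]
    exact posSemidef_tensorProdFam_sub (fun _ => hQ.smul hb0.le) fun _ => h1
  have h4 : (iidMix μ n - (w * b ^ n) • tensorPow Q n).PosSemidef := by
    have h5 := (posSemidef_iidMix_sub hst μ n (s i)).add (h3.smul (hμ i).le)
    have heq : iidMix μ n - (w * b ^ n) • tensorPow Q n =
        iidMix μ n - μ.real {s i} • tensorPow (s i : MatC κ) n +
          μ.real {s i} • (tensorPow (s i : MatC κ) n - b ^ n • tensorPow Q n) := by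
      rw [smul_sub, smul_smul, ← hw]; abel
    rw [heq]; exact h5
  refine le_trans ?_ (eigenvalue_lower_bound h (tensorPow_mul_iidMix hst μ n hQσ) h4 x hx)
  have hw0 : 0 < w := hμ i
  rw [← Real.exp_log (mul_pos hw0 (pow_pos hb0 n)), Real.exp_le_exp,
    Real.log_mul hw0.ne' (pow_pos hb0 n).ne', Real.log_pow]
  push_cast
  have e1 := neg_abs_le (Real.log w)
  have e2 := neg_abs_le (Real.log b)
  have e3 : (n : ℝ) * -|Real.log b| ≤ n * Real.log b := by gcongr
  have e4 : (|Real.log w| + |Real.log b|) * (n + 1) ≤ a * (n + 1 : ℝ) := by gcongr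
  have e5 : 0 ≤ |Real.log w| * n := by positivity
  have e6 := abs_nonneg (Real.log b)
  linarith

theorem sum_mul_log_le_of_diagonal {κ Z : Type*} [Fintype κ] [DecidableEq κ] [Fintype Z]
    {t : κ → ℝ} (ht : ∀ i, 0 ≤ t i) (hsum : ∑ i, t i = 1) {M : Z → Matrix κ κ ℂ}
    (hM : ∀ z, (M z).PosSemidef) (hM1 : ∑ z, M z = 1) {P : Matrix κ κ ℂ} {r : Z → ℝ}
    (hr : ∀ z, 0 < r z) (hP : ∀ z, P * M z = r z • M z) {v : ℝ} (hv : 0 < v)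
    (hle : (v • P - Matrix.diagonal fun i => (t i : ℂ)).PosSemidef) :
    ∑ i, t i * Real.log (t i) ≤
      Real.log v + ∑ i, t i * ∑ z, (M z i i).re * Real.log (r z) := by
  set G := ∑ z, (r z)⁻¹ • M z with hG
  have hGp : G.PosSemidef := Matrix.posSemidef_sum _ fun z _ =>
    (hM z).smul (inv_pos.mpr (hr z)).le
  have hPG : P * G = 1 := by
    rw [hG, Finset.mul_sum, ← hM1]
    refine Finset.sum_congr rfl fun z _ => ?_
    rw [Matrix.mul_smul, hP, smul_smul, inv_mul_cancel₀ (hr z).ne', one_smul]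
  have hGP : G * P = 1 := mul_eq_one_comm.mp hPG
  have hGre : ∀ i, (G i i).re = ∑ z, (r z)⁻¹ * (M z i i).re := fun i => by
    rw [hG, Matrix.sum_apply, Complex.re_sum]
    exact Finset.sum_congr rfl fun z _ => by
      rw [Matrix.smul_apply, Complex.real_smul, Complex.re_ofReal_mul]
  have hp : ∀ z i, 0 ≤ (M z i i).re := fun z i =>
    (Complex.le_def.mp ((hM z).diag_nonneg (i := i))).1
  have hp1 : ∀ i, ∑ z, (M z i i).re = 1 := fun i => by
    rw [← Complex.re_sum, ← Matrix.sum_apply, hM1, Matrix.one_apply_eq, Complex.one_re]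
  have key : ∀ i, t i * (G i i).re ≤ v := fun i => by
    have h1 := hle.conjTranspose_mul_mul_same G
    have h2 : Gᴴ * (v • P - Matrix.diagonal fun i => (t i : ℂ)) * G =
        v • G - Gᴴ * (Matrix.diagonal fun i => (t i : ℂ)) * G := by
      rw [Matrix.mul_sub, Matrix.sub_mul, Matrix.mul_smul, Matrix.smul_mul, hGp.1.eq, hGP,
        Matrix.one_mul]
    have h3 : (Gᴴ * (Matrix.diagonal fun i => (t i : ℂ)) * G) i i =
        ((∑ k, t k * Complex.normSq (G k i) : ℝ) : ℂ) := by
      rw [Matrix.mul_apply]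
      push_cast
      refine Finset.sum_congr rfl fun k _ => ?_
      rw [Matrix.mul_diagonal, Matrix.conjTranspose_apply, Complex.normSq_eq_conj_mul_self,
        Complex.star_def]
      ring
    have h4 := (Complex.le_def.mp (h1.diag_nonneg (i := i))).1
    rw [h2, Matrix.sub_apply, h3, Matrix.smul_apply, Complex.sub_re, Complex.ofReal_re,
      Complex.real_smul, Complex.re_ofReal_mul, Complex.zero_re] at h4
    have h5 : t i * (G i i).re ^ 2 ≤ ∑ k, t k * Complex.normSq (G k i) := by
      refine le_trans ?_ (Finset.single_le_sum (f := fun k => t k * Complex.normSq (G k i))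
        (fun k _ => mul_nonneg (ht k) (Complex.normSq_nonneg _)) (Finset.mem_univ i))
      refine mul_le_mul_of_nonneg_left ?_ (ht i)
      rw [Complex.normSq_apply, sq]
      nlinarith [mul_self_nonneg (G i i).im]
    have h6 : 0 ≤ (G i i).re := (Complex.le_def.mp (hGp.diag_nonneg (i := i))).1
    rcases h6.eq_or_lt with h | h
    · rw [← h, mul_zero]; exact hv.le
    · refine le_of_mul_le_mul_right ?_ h
      nlinarith
  have hlog : ∀ i, 0 < t i →
      Real.log (t i) - Real.log v ≤ ∑ z, (M z i i).re * Real.log (r z) := fun i hi => by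
    have h1 : ∀ z, Real.log (t i) - Real.log v - Real.log (r z) ≤ t i / v * (r z)⁻¹ - 1 :=
      fun z => by
        have h2 : 0 < t i / v * (r z)⁻¹ := by have := hr z; positivity
        have h3 := Real.log_le_sub_one_of_pos h2
        rwa [Real.log_mul (by positivity) (inv_pos.mpr (hr z)).ne', Real.log_inv,
          Real.log_div hi.ne' hv.ne', ← sub_eq_add_neg] at h3
    have h4 : ∑ z, (M z i i).re * (Real.log (t i) - Real.log v - Real.log (r z)) ≤
        ∑ z, (M z i i).re * (t i / v * (r z)⁻¹ - 1) :=
      Finset.sum_le_sum fun z _ => mul_le_mul_of_nonneg_left (h1 z) (hp z i)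
    have h5 : ∑ z, (M z i i).re * (t i / v * (r z)⁻¹ - 1) = t i * (G i i).re / v - 1 := by
      simp only [mul_sub, mul_one, Finset.sum_sub_distrib, hp1, hGre]
      rw [mul_div_right_comm, Finset.mul_sum]
      congr 1
      exact Finset.sum_congr rfl fun z _ => by ring
    have h6 : ∑ z, (M z i i).re * (Real.log (t i) - Real.log v - Real.log (r z)) =
        Real.log (t i) - Real.log v - ∑ z, (M z i i).re * Real.log (r z) := by
      simp only [mul_sub, Finset.sum_sub_distrib, ← Finset.sum_mul, hp1, one_mul]
    have h7 : t i * (G i i).re / v ≤ 1 := (div_le_one hv).mpr (key i)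
    linarith
  have h8 : ∀ i, t i * Real.log (t i) ≤
      t i * Real.log v + t i * ∑ z, (M z i i).re * Real.log (r z) := fun i => by
    rcases (ht i).eq_or_lt with h | h
    · simp [← h]
    · have := mul_le_mul_of_nonneg_left (hlog i h) h.le
      linarith
  refine (Finset.sum_le_sum fun i _ => h8 i).trans_eq ?_
  rw [Finset.sum_add_distrib, ← Finset.sum_mul, hsum, one_mul]

/-- The negative entropy of a state is controlled by that of a dominating operator `P`. -/
theorem sum_eigenvalues_mul_log_le {κ Z : Type*} [Fintype κ] [DecidableEq κ] [Fintype Z]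
    {ρ : Matrix κ κ ℂ} (hρ : IsState ρ) {M : Z → Matrix κ κ ℂ}
    (hM : ∀ z, (M z).PosSemidef) (hM1 : ∑ z, M z = 1) {P : Matrix κ κ ℂ} {r : Z → ℝ}
    (hr : ∀ z, 0 < r z) (hP : ∀ z, P * M z = r z • M z) {v : ℝ} (hv : 0 < v)
    (hle : (v • P - ρ).PosSemidef) :
    ∑ i, hρ.1.1.eigenvalues i * Real.log (hρ.1.1.eigenvalues i) ≤
      Real.log v + ∑ z, (ρ * M z).trace.re * Real.log (r z) := by
  set U := (hρ.1.1.eigenvectorUnitary : Matrix κ κ ℂ) with hU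
  have hU1 : Uᴴ * U = 1 := (eigen_unitary hρ.1.1).1
  have hU2 : U * Uᴴ = 1 := (eigen_unitary hρ.1.1).2
  have hdec := eigen_decomp hρ.1.1
  have hconj : Uᴴ * ρ * U = Matrix.diagonal fun i => (hρ.1.1.eigenvalues i : ℂ) := by
    conv_lhs => rw [hdec]
    rw [Matrix.mul_assoc, Matrix.mul_assoc, Matrix.mul_assoc, hU1, Matrix.mul_one,
      ← Matrix.mul_assoc, hU1, Matrix.one_mul]
  have h1 := sum_mul_log_le_of_diagonal (t := hρ.1.1.eigenvalues) (M := fun z => Uᴴ * M z * U)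
    (P := Uᴴ * P * U) (r := r) (v := v) hρ.1.eigenvalues_nonneg (sum_eigenvalues_of_isState hρ)
    (fun z => (hM z).conjTranspose_mul_mul_same U)
    (by rw [← Finset.sum_mul, ← Finset.mul_sum, hM1, Matrix.mul_one, hU1]) hr
    (fun z => by
      calc Uᴴ * P * U * (Uᴴ * M z * U) = Uᴴ * P * (U * Uᴴ) * M z * U := by
            simp only [Matrix.mul_assoc]
        _ = Uᴴ * (P * M z) * U := by rw [hU2, Matrix.mul_one, Matrix.mul_assoc Uᴴ P]
        _ = _ := by rw [hP, Matrix.mul_smul, Matrix.smul_mul]) hv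
    (by
      have h2 := hle.conjTranspose_mul_mul_same U
      rw [Matrix.mul_sub, Matrix.sub_mul, hconj, Matrix.mul_smul, Matrix.smul_mul] at h2
      exact h2)
  refine h1.trans_eq ?_
  congr 1
  simp only [Finset.mul_sum]
  rw [Finset.sum_comm]
  refine Finset.sum_congr rfl fun z _ => ?_
  have h3 : (ρ * M z).trace = ∑ i, (hρ.1.1.eigenvalues i : ℂ) * (Uᴴ * M z * U) i i := by
    rw [Matrix.trace_mul_comm]
    conv_lhs => enter [1, 2]; rw [hdec]
    exact trace_mul_conj_diagonal _ _ _
  rw [h3, Complex.re_sum, Finset.sum_mul]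
  exact Finset.sum_congr rfl fun i _ => by rw [Complex.re_ofReal_mul]; ring

end EntropyBounds

section Measurement

open scoped Matrix

theorem suppLE_of_eigen_zero {κ : Type*} [Fintype κ] [DecidableEq κ] {ρ σ : Matrix κ κ ℂ}
    (hρ : ρ.PosSemidef) (hσ : σ.IsHermitian)
    (h : ∀ x, hσ.eigenvalues x = 0 →
      ((hσ.eigenvectorUnitary : Matrix κ κ ℂ)ᴴ * ρ * hσ.eigenvectorUnitary) x x = 0) :
    suppLE ρ σ := by
  set V := (hσ.eigenvectorUnitary : Matrix κ κ ℂ) with hV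
  set s := hσ.eigenvalues with hs
  have hV1 : Vᴴ * V = 1 := (eigen_unitary hσ).1
  have hV2 : V * Vᴴ = 1 := (eigen_unitary hσ).2
  obtain ⟨A, hA⟩ : ∃ A, A = Vᴴ * ρ * V := ⟨_, rfl⟩
  have hAp : A.PosSemidef := hA ▸ hρ.conjTranspose_mul_mul_same V
  rw [← hA] at h
  obtain ⟨K, hK⟩ : ∃ K : Matrix κ κ ℂ, K = Matrix.diagonal fun x => if s x = 0 then 1 else 0 :=
    ⟨_, rfl⟩
  have hKH : Kᴴ = K := by
    rw [hK, Matrix.diagonal_conjTranspose]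
    congr 1; funext x
    by_cases hx : s x = 0 <;> simp [hx]
  have h1 : Kᴴ * A * K = 0 := by
    refine (hAp.conjTranspose_mul_mul_same K).trace_eq_zero_iff.mp ?_
    rw [hKH, hK, Matrix.trace]
    refine Finset.sum_eq_zero fun x _ => ?_
    rw [Matrix.diag_apply, Matrix.mul_diagonal, Matrix.diagonal_mul]
    by_cases hx : s x = 0 <;> simp [hx, h]
  have h2 : K * A = 0 := by
    have h3 := congrArg Matrix.conjTranspose (mul_eq_zero_of_conj_eq_zero hAp h1)
    rwa [Matrix.conjTranspose_mul, hKH, hAp.1.eq, Matrix.conjTranspose_zero] at h3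
  obtain ⟨D, hD⟩ : ∃ D : Matrix κ κ ℂ, D = Matrix.diagonal fun x => (s x : ℂ) := ⟨_, rfl⟩
  obtain ⟨D', hD'⟩ : ∃ D' : Matrix κ κ ℂ, D' = Matrix.diagonal fun x => (s x : ℂ)⁻¹ := ⟨_, rfl⟩
  have h4 : D * D' = 1 - K := by
    rw [hD, hD', hK, Matrix.diagonal_mul_diagonal, ← Matrix.diagonal_one, Matrix.diagonal_sub]
    congr 1; funext x
    by_cases hx : s x = 0 <;> simp [hx]
  have h5 : D * (D' * A) = A := by
    rw [← Matrix.mul_assoc, h4, Matrix.sub_mul, h2, Matrix.one_mul, sub_zero]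
  have h6 : ρ = σ * (V * (D' * A) * Vᴴ) := by
    have h7 : σ = V * D * Vᴴ := by rw [hD]; exact eigen_decomp hσ
    calc ρ = (V * Vᴴ) * ρ * (V * Vᴴ) := by rw [hV2, Matrix.one_mul, Matrix.mul_one]
      _ = V * A * Vᴴ := by rw [hA]; simp only [Matrix.mul_assoc]
      _ = V * (D * (D' * A)) * Vᴴ := by rw [h5]
      _ = V * D * (Vᴴ * V) * (D' * A) * Vᴴ := by
          rw [hV1, Matrix.mul_one]; simp only [Matrix.mul_assoc]
      _ = σ * (V * (D' * A) * Vᴴ) := by rw [h7]; simp only [Matrix.mul_assoc]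
  unfold suppLE
  conv_lhs => rw [h6]
  rw [Matrix.toLin'_mul]
  exact LinearMap.range_comp_le_range _ _

/-- The pinching inequality. -/
theorem posSemidef_pinching_sub {κ J : Type*} [Fintype κ] [DecidableEq κ] [Fintype J]
    {ρ : Matrix κ κ ℂ} (hρ : ρ.PosSemidef) {Q : J → Matrix κ κ ℂ} (hQ : ∀ j, (Q j).IsHermitian)
    (hQ1 : ∑ j, Q j = 1) :
    ((Fintype.card J : ℝ) • ∑ j, Q j * ρ * Q j - ρ).PosSemidef := by
  have h1 : (∑ j, ∑ k, (Q j - Q k) * ρ * (Q j - Q k)).PosSemidef :=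
    Matrix.posSemidef_sum _ fun j _ => Matrix.posSemidef_sum _ fun k _ => by
      have := hρ.mul_mul_conjTranspose_same (Q j - Q k)
      rwa [((hQ j).sub (hQ k)).eq] at this
  have h2 : ∑ j, ∑ k, (Q j - Q k) * ρ * (Q j - Q k) =
      (2 : ℝ) • ((Fintype.card J : ℝ) • ∑ j, Q j * ρ * Q j - ρ) := by
    have e1 : ∀ j k, (Q j - Q k) * ρ * (Q j - Q k) =
        Q j * ρ * Q j - Q j * ρ * Q k - Q k * ρ * Q j + Q k * ρ * Q k := fun j k => by
      noncomm_ring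
    have e2 : ∑ j, ∑ k, Q j * ρ * Q k = ρ := by
      simp only [← Finset.mul_sum, ← Finset.sum_mul, hQ1, Matrix.mul_one, Matrix.one_mul]
    have e3 : ∑ j, ∑ k, Q k * ρ * Q j = ρ := by rw [Finset.sum_comm]; exact e2
    simp only [e1, Finset.sum_add_distrib, Finset.sum_sub_distrib, e2, e3, Finset.sum_const,
      Finset.card_univ]
    rw [← Finset.smul_sum, ← Nat.cast_smul_eq_nsmul ℝ, two_smul]
    abel
  rw [h2] at h1
  have h3 := h1.smul (a := (2⁻¹ : ℝ)) (by norm_num)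
  rwa [smul_smul, inv_mul_cancel₀ (by norm_num), one_smul] at h3

/-- The eigenvalue cells of `σ`: `none` collects the kernel, and `some j` the eigenvalues
in `[e^{-j-1}, e^{-j}]`. -/
theorem exists_cells {κ : Type*} {s : κ → ℝ} {a : ℕ} (hs1 : ∀ x, s x ≤ 1)
    (hs : ∀ x, s x ≠ 0 → Real.exp (-(a : ℝ)) ≤ s x) :
    ∃ l : κ → Option (Fin (a + 1)), ∀ x, (l x = none → s x = 0) ∧ ∀ j, l x = some j →
      0 < s x ∧ s x ≤ Real.exp (-(j : ℝ)) ∧ -Real.log (s x) - 1 ≤ j := by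
  refine ⟨fun x => if s x = 0 then none else some (Fin.ofNat (a + 1) ⌊-Real.log (s x)⌋₊),
    fun x => ?_⟩
  by_cases hx : s x = 0
  · simp [hx]
  · have hpos : 0 < s x := (Real.exp_pos _).trans_le (hs x hx)
    have h0 : 0 ≤ -Real.log (s x) := by
      have := Real.log_nonpos hpos.le (hs1 x); linarith
    have h1 : -Real.log (s x) ≤ a := by
      have := Real.log_le_log (Real.exp_pos _) (hs x hx)
      rw [Real.log_exp] at this; linarith
    have h2 : ⌊-Real.log (s x)⌋₊ < a + 1 := by
      refine Nat.lt_succ_of_le ?_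
      exact_mod_cast (Nat.floor_le h0).trans h1
    have h3 := Nat.floor_le h0
    have h4 := Nat.lt_floor_add_one (-Real.log (s x))
    refine ⟨fun h => by simp [hx] at h, fun j hj => ?_⟩
    have hj : j = Fin.ofNat (a + 1) ⌊-Real.log (s x)⌋₊ := by simpa [hx] using hj.symm
    have hj' : ((j : ℕ) : ℝ) = (⌊-Real.log (s x)⌋₊ : ℝ) := by
      rw [hj]; simp [Nat.mod_eq_of_lt h2]
    rw [hj']
    refine ⟨hpos, ?_, by linarith⟩
    rw [← Real.log_le_iff_le_exp hpos]; linarith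

end Measurement

section ScoredPOVM

open scoped Matrix

theorem exists_scored_povm_of_blocks {κ : Type} [Fintype κ] [DecidableEq κ] {J : Type} [Fintype J]
    {ρ σ : Matrix κ κ ℂ} (hρ : IsState ρ) {Q : J → Matrix κ κ ℂ}
    (hQp : ∀ j, (Q j).PosSemidef) (hQ1 : ∑ j, Q j = 1) (hQQ : ∀ j, Q j * Q j = Q j)
    (hQ0 : ∀ j k, j ≠ k → Q j * Q k = 0) {ω g : J → ℝ}
    (hσ : ∀ j, (ω j • Q j - Q j * σ * Q j).PosSemidef)
    (hg : ∀ j, ω j * Real.exp (g j) ≤ 1) :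
    ∃ (X : Type) (_ : Fintype X) (M : X → Matrix κ κ ℂ) (h : X → ℝ),
      (∀ x, (M x).PosSemidef) ∧ ∑ x, M x = 1 ∧
      ∑ i, hρ.1.1.eigenvalues i * Real.log (hρ.1.1.eigenvalues i) - Real.log (Fintype.card J) +
        ∑ j, g j * (ρ * Q j).trace.re ≤ ∑ x, (ρ * M x).trace.re * h x ∧
      ∑ x, (σ * M x).trace.re * Real.exp (h x) ≤ 2 := by
  have hκ : Nonempty κ := by
    by_contra h
    rw [not_nonempty_iff] at h
    have := hρ.2
    rw [Matrix.trace_eq_zero_of_isEmpty] at this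
    exact zero_ne_one this
  have hJ : Nonempty J := by
    by_contra h
    rw [not_nonempty_iff] at h
    rw [Finset.univ_eq_empty, Finset.sum_empty] at hQ1
    exact zero_ne_one hQ1
  have hQH : ∀ j, (Q j)ᴴ = Q j := fun j => (hQp j).1.eq
  obtain ⟨P, hP⟩ : ∃ P, P = ∑ j, Q j * ρ * Q j := ⟨_, rfl⟩
  have hPp : P.PosSemidef := by
    rw [hP]
    refine Matrix.posSemidef_sum _ fun j _ => ?_
    have := hρ.1.mul_mul_conjTranspose_same (Q j)
    rwa [hQH] at this
  set W := (hPp.1.eigenvectorUnitary : Matrix κ κ ℂ)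
  set r := hPp.1.eigenvalues
  have hW1 : Wᴴ * W = 1 := (eigen_unitary hPp.1).1
  have hW2 : W * Wᴴ = 1 := (eigen_unitary hPp.1).2
  have hdec : P = W * Matrix.diagonal (fun i => (r i : ℂ)) * Wᴴ := eigen_decomp hPp.1
  have hr : ∀ y, 0 ≤ r y := hPp.eigenvalues_nonneg
  obtain ⟨F, hF⟩ : ∃ F : κ → Matrix κ κ ℂ,
      ∀ y, F y = W * Matrix.diagonal (Pi.single y 1) * Wᴴ := ⟨_, fun _ => rfl⟩
  have hFp : ∀ y, (F y).PosSemidef := fun y => by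
    rw [hF]
    refine Matrix.PosSemidef.mul_mul_conjTranspose_same ?_ W
    refine Matrix.PosSemidef.diagonal fun i => ?_
    by_cases h : i = y
    · subst h; simp
    · simp [h]
  have hF1 : ∑ y, F y = 1 := by
    simp only [hF]
    rw [← Finset.sum_mul, ← Finset.mul_sum]
    have : ∑ y, Matrix.diagonal (Pi.single y (1 : ℂ)) = (1 : Matrix κ κ ℂ) := by
      ext i j
      rw [Matrix.sum_apply]
      by_cases h : i = j
      · subst h; simp [Pi.single_apply]
      · simp [h]
    rw [this, Matrix.mul_one, hW2]
  have hPF : ∀ y, P * F y = r y • F y := fun y => by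
    have h1 : Matrix.diagonal (fun i => (r i : ℂ)) * Matrix.diagonal (Pi.single y (1 : ℂ)) =
        r y • Matrix.diagonal (Pi.single y (1 : ℂ)) := by
      rw [Matrix.diagonal_mul_diagonal]
      ext i j
      by_cases h : i = j
      · subst h
        by_cases hy : i = y
        · subst hy; simp
        · simp [hy]
      · simp [h]
    calc P * F y = W * Matrix.diagonal (fun i => (r i : ℂ)) * (Wᴴ * W) *
          Matrix.diagonal (Pi.single y (1 : ℂ)) * Wᴴ := by
          rw [hF, hdec]; simp only [Matrix.mul_assoc]
      _ = W * (Matrix.diagonal (fun i => (r i : ℂ)) * Matrix.diagonal (Pi.single y (1 : ℂ))) *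
          Wᴴ := by rw [hW1, Matrix.mul_one]; simp only [Matrix.mul_assoc]
      _ = r y • F y := by rw [h1, hF, Matrix.mul_smul, Matrix.smul_mul]
  have hFt : ∀ y, (F y).trace = 1 := fun y => by
    rw [hF, Matrix.trace_mul_comm, ← Matrix.mul_assoc, hW1, Matrix.one_mul, Matrix.trace_diagonal]
    simp
  have hPQ : ∀ j, P * Q j = Q j * P := fun j => by
    rw [hP, Finset.sum_mul, Finset.mul_sum]
    refine Finset.sum_congr rfl fun k _ => ?_
    by_cases h : k = j
    · subst h
      rw [Matrix.mul_assoc, hQQ, ← Matrix.mul_assoc, ← Matrix.mul_assoc, hQQ]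
    · rw [Matrix.mul_assoc, hQ0 k j h, Matrix.mul_zero, ← Matrix.mul_assoc, ← Matrix.mul_assoc,
        hQ0 j k (Ne.symm h), Matrix.zero_mul, Matrix.zero_mul]
  have htrP : P.trace = 1 := by
    rw [hP, Matrix.trace_sum, ← hρ.2]
    have : ∀ j, (Q j * ρ * Q j).trace = (ρ * Q j).trace := fun j => by
      rw [Matrix.mul_assoc, Matrix.trace_mul_comm, Matrix.mul_assoc, hQQ]
    simp only [this]
    rw [← Matrix.trace_sum, ← Finset.mul_sum, hQ1, Matrix.mul_one]
  have hrsum : ∑ y, r y = 1 := sum_eigenvalues_of_isState ⟨hPp, htrP⟩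
  obtain ⟨D, hD⟩ : ∃ D : ℝ, D = Fintype.card κ := ⟨_, rfl⟩
  have hD0 : 0 < D := by rw [hD]; exact_mod_cast Fintype.card_pos
  have hr' : ∀ y, 0 < r y + D⁻¹ := fun y => add_pos_of_nonneg_of_pos (hr y) (inv_pos.mpr hD0)
  set M : J × κ → Matrix κ κ ℂ := fun z => Q z.1 * F z.2 * Q z.1 with hM
  have hMp : ∀ z, (M z).PosSemidef := fun z => by
    have := (hFp z.2).mul_mul_conjTranspose_same (Q z.1)
    rwa [hQH] at this
  have hMj : ∀ j, ∑ y, M (j, y) = Q j := fun j => by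
    simp only [hM]
    rw [← Finset.sum_mul, ← Finset.mul_sum, hF1, Matrix.mul_one, hQQ]
  have hM1 : ∑ z, M z = 1 := by
    rw [Fintype.sum_prod_type]
    simp only [hMj, hQ1]
  have hent := sum_eigenvalues_mul_log_le hρ hMp hM1 (P := P + D⁻¹ • 1)
    (r := fun z => r z.2 + D⁻¹) (fun z => hr' z.2) (fun z => by
      rw [Matrix.add_mul, Matrix.smul_mul, Matrix.one_mul, add_smul]
      congr 1
      simp only [hM]
      rw [← Matrix.mul_assoc, ← Matrix.mul_assoc, hPQ, Matrix.mul_assoc (Q z.1), hPF,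
        Matrix.mul_smul, Matrix.smul_mul]) (v := Fintype.card J)
    (by exact_mod_cast Fintype.card_pos) (by
      have h1 := posSemidef_pinching_sub hρ.1 (fun j => (hQp j).1) hQ1
      rw [← hP] at h1
      have h2 : (((Fintype.card J : ℝ) * D⁻¹) • (1 : Matrix κ κ ℂ)).PosSemidef :=
        Matrix.PosSemidef.one.smul (by positivity)
      have heq : (Fintype.card J : ℝ) • (P + D⁻¹ • 1) - ρ =
          ((Fintype.card J : ℝ) • P - ρ) + ((Fintype.card J : ℝ) * D⁻¹) • (1 : Matrix κ κ ℂ) := by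
        rw [smul_add, smul_smul]; abel
      rw [heq]; exact h1.add h2)
  refine ⟨J × κ, inferInstance, M, fun z => Real.log (r z.2 + D⁻¹) + g z.1, hMp, hM1, ?_, ?_⟩
  · have h1 : ∑ z : J × κ, (ρ * M z).trace.re * g z.1 = ∑ j, g j * (ρ * Q j).trace.re := by
      rw [Fintype.sum_prod_type]
      refine Finset.sum_congr rfl fun j _ => ?_
      change ∑ y, (ρ * M (j, y)).trace.re * g j = _
      rw [← Finset.sum_mul, ← Complex.re_sum, ← Matrix.trace_sum, ← Finset.mul_sum, hMj, mul_comm]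
    simp only [mul_add, Finset.sum_add_distrib, h1]
    linarith
  · have h1 : ∀ z : J × κ, (σ * M z).trace.re * Real.exp (Real.log (r z.2 + D⁻¹) + g z.1) ≤
        (r z.2 + D⁻¹) * (Q z.1 * F z.2).trace.re := fun z => by
      have h2 : (σ * M z).trace.re ≤ ω z.1 * (Q z.1 * F z.2).trace.re := by
        have h3 := re_trace_mul_mono (hσ z.1) (hFp z.2)
        rw [Matrix.smul_mul, Matrix.trace_smul, Complex.real_smul, Complex.re_ofReal_mul] at h3
        have h4 : (σ * M z).trace = (Q z.1 * σ * Q z.1 * F z.2).trace := by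
          calc (σ * M z).trace = ((σ * Q z.1 * F z.2) * Q z.1).trace := by
                simp only [hM, Matrix.mul_assoc]
            _ = _ := by rw [Matrix.trace_mul_comm]; simp only [Matrix.mul_assoc]
        rw [h4]; exact h3
      have h5 : 0 ≤ (Q z.1 * F z.2).trace.re := re_trace_mul_nonneg (hQp _) (hFp _)
      rw [Real.exp_add, Real.exp_log (hr' z.2)]
      calc _ ≤ ω z.1 * (Q z.1 * F z.2).trace.re * ((r z.2 + D⁻¹) * Real.exp (g z.1)) :=
            mul_le_mul_of_nonneg_right h2 (mul_nonneg (hr' _).le (Real.exp_pos _).le)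
        _ = (ω z.1 * Real.exp (g z.1)) * ((r z.2 + D⁻¹) * (Q z.1 * F z.2).trace.re) := by ring
        _ ≤ 1 * ((r z.2 + D⁻¹) * (Q z.1 * F z.2).trace.re) :=
            mul_le_mul_of_nonneg_right (hg _) (mul_nonneg (hr' _).le h5)
        _ = _ := one_mul _
    refine (Finset.sum_le_sum fun z _ => h1 z).trans_eq ?_
    rw [Fintype.sum_prod_type_right]
    have h6 : ∀ y, ∑ j, (r y + D⁻¹) * (Q j * F y).trace.re = r y + D⁻¹ := fun y => by
      rw [← Finset.mul_sum, ← Complex.re_sum, ← Matrix.trace_sum, ← Finset.sum_mul, hQ1,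
        Matrix.one_mul, hFt, Complex.one_re, mul_one]
    simp only [h6, Finset.sum_add_distrib, hrsum, Finset.sum_const, Finset.card_univ, nsmul_eq_mul]
    rw [← hD, mul_inv_cancel₀ hD0.ne']
    norm_num

/-- A measurement nearly achieving the relative entropy, up to the logarithm of the number
of eigenvalue scales of `σ`. -/
theorem exists_scored_povm {κ : Type} [Fintype κ] [DecidableEq κ] {ρ σ : Matrix κ κ ℂ}
    (hρ : IsState ρ) (hσ : IsState σ) {a : ℕ}
    (ha : ∀ x, hσ.1.1.eigenvalues x ≠ 0 → Real.exp (-(a : ℝ)) ≤ hσ.1.1.eigenvalues x)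
    {R : ℝ} (hR : (R : EReal) ≤ relEnt ρ σ) :
    ∃ (X : Type) (_ : Fintype X) (M : X → Matrix κ κ ℂ) (h : X → ℝ),
      (∀ x, (M x).PosSemidef) ∧ ∑ x, M x = 1 ∧
      R - Real.log (a + 2) - 1 ≤ ∑ x, (ρ * M x).trace.re * h x ∧
      ∑ x, (σ * M x).trace.re * Real.exp (h x) ≤ 2 := by
  set V := (hσ.1.1.eigenvectorUnitary : Matrix κ κ ℂ) with hV
  set s := hσ.1.1.eigenvalues with hs
  have hV1 : Vᴴ * V = 1 := (eigen_unitary hσ.1.1).1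
  have hV2 : V * Vᴴ = 1 := (eigen_unitary hσ.1.1).2
  have hdec : σ = V * Matrix.diagonal (fun i => (s i : ℂ)) * Vᴴ := eigen_decomp hσ.1.1
  have hs0 : ∀ x, 0 ≤ s x := hσ.1.eigenvalues_nonneg
  have hs1 : ∀ x, s x ≤ 1 := fun x => by
    rw [← sum_eigenvalues_of_isState hσ]
    exact Finset.single_le_sum (fun y _ => hs0 y) (Finset.mem_univ x)
  obtain ⟨l, hl⟩ := exists_cells hs1 ha
  have hmul : ∀ f f' : κ → ℂ, V * Matrix.diagonal f * Vᴴ * (V * Matrix.diagonal f' * Vᴴ) =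
      V * Matrix.diagonal (fun x => f x * f' x) * Vᴴ := fun f f' => by
    calc _ = V * (Matrix.diagonal f * (Vᴴ * V) * Matrix.diagonal f') * Vᴴ := by
          simp only [Matrix.mul_assoc]
      _ = _ := by rw [hV1, Matrix.mul_one, Matrix.diagonal_mul_diagonal]
  obtain ⟨Q, hQ⟩ : ∃ Q : Option (Fin (a + 1)) → Matrix κ κ ℂ,
      ∀ j, Q j = V * Matrix.diagonal (fun x => if l x = j then (1 : ℂ) else 0) * Vᴴ :=
    ⟨_, fun _ => rfl⟩
  have hdiag : ∀ f : κ → ℝ, (∀ x, 0 ≤ f x) →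
      (V * Matrix.diagonal (fun x => (f x : ℂ)) * Vᴴ).PosSemidef := fun f hf =>
    (Matrix.PosSemidef.diagonal fun x => by
      simpa using hf x :
        (Matrix.diagonal fun x => (f x : ℂ)).PosSemidef).mul_mul_conjTranspose_same V
  have hQp : ∀ j, (Q j).PosSemidef := fun j => by
    have := hdiag (fun x => if l x = j then 1 else 0) fun x => by split_ifs <;> norm_num
    have heq : (fun x => if l x = j then (1 : ℂ) else 0) =
        fun x => ((if l x = j then 1 else 0 : ℝ) : ℂ) := by
      funext x; split_ifs <;> simp
    rw [hQ, heq]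
    exact this
  have hQ1 : ∑ j, Q j = 1 := by
    simp only [hQ]
    rw [← Finset.sum_mul, ← Finset.mul_sum]
    have : ∑ j, Matrix.diagonal (fun x => if l x = j then (1 : ℂ) else 0) = 1 := by
      ext i k
      rw [Matrix.sum_apply]
      by_cases h : i = k
      · subst h; simp
      · simp [h]
    rw [this, Matrix.mul_one, hV2]
  have hQmul : ∀ j k, Q j * Q k = if j = k then Q j else 0 := fun j k => by
    rw [hQ, hQ, hmul]
    split_ifs with h
    · subst h; congr 3; funext x; split_ifs <;> simp
    · have : (fun x => (if l x = j then (1 : ℂ) else 0) * if l x = k then 1 else 0) = 0 := by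
        funext x
        by_cases hx : l x = j
        · simp [hx, h]
        · simp [hx]
      rw [this]; simp
  set A := Vᴴ * ρ * V with hA
  have hA0 : ∀ x, 0 ≤ (A x x).re := fun x =>
    (Complex.le_def.mp ((hρ.1.conjTranspose_mul_mul_same V).diag_nonneg (i := x))).1
  have htrQ : ∀ g : Option (Fin (a + 1)) → ℝ,
      ∑ j, g j * (ρ * Q j).trace.re = ∑ x, (A x x).re * g (l x) := fun g => by
    have h1 : ∀ j, (ρ * Q j).trace.re = ∑ x, if l x = j then (A x x).re else 0 := fun j => by
      rw [hQ, trace_mul_conj_diagonal, Complex.re_sum]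
      refine Finset.sum_congr rfl fun x _ => ?_
      split_ifs <;> simp [hA]
    simp only [h1, Finset.mul_sum]
    rw [Finset.sum_comm]
    refine Finset.sum_congr rfl fun x _ => ?_
    simp [mul_comm]
  obtain ⟨H, hH⟩ : ∃ H : ℝ,
    H = ∑ i, hρ.1.1.eigenvalues i * Real.log (hρ.1.1.eigenvalues i) := ⟨_, rfl⟩
  obtain ⟨T, hT0, hT⟩ : ∃ T : ℝ, 0 ≤ T ∧
      R - 1 ≤ H + ∑ x, (A x x).re * (l x).elim T (fun j => (j : ℝ)) := by
    by_cases hsup : suppLE ρ σ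
    · refine ⟨0, le_rfl, ?_⟩
      rw [relEnt, if_pos hsup, EReal.coe_le_coe_iff, relEnt_trace_formula hρ.1.1 hσ.1.1,
        ← hH] at hR
      have h2 : ∑ x, (A x x).re = 1 := by
        have : A.trace = 1 := by
          rw [hA, Matrix.trace_mul_comm, ← Matrix.mul_assoc, hV2, Matrix.one_mul, hρ.2]
        rw [← Complex.re_sum]
        exact congrArg Complex.re this
      have h3 : ∑ x, (A x x).re * (-Real.log (s x) - 1) ≤
          ∑ x, (A x x).re * (l x).elim 0 (fun j => (j : ℝ)) := by
        refine Finset.sum_le_sum fun x _ => mul_le_mul_of_nonneg_left ?_ (hA0 x)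
        rcases hx : l x with _ | j
        · simp [(hl x).1 hx]
        · exact ((hl x).2 j hx).2.2
      have h4 : ∑ x, (A x x).re * (-Real.log (s x) - 1) =
          -(∑ x, Real.log (s x) * (A x x).re) - 1 := by
        simp only [mul_sub, mul_one, Finset.sum_sub_distrib, h2, mul_neg, Finset.sum_neg_distrib]
        simp only [mul_comm]
      linarith
    · obtain ⟨x, hx, hAx⟩ : ∃ x, s x = 0 ∧ A x x ≠ 0 := by
        by_contra hcon
        push Not at hcon
        exact hsup (suppLE_of_eigen_zero hρ.1 hσ.1.1 hcon)
      have hApos : 0 < (A x x).re := by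
        refine lt_of_le_of_ne (hA0 x) fun h => hAx ?_
        refine Complex.ext h.symm ?_
        exact ((Complex.le_def.mp
          ((hρ.1.conjTranspose_mul_mul_same V).diag_nonneg (i := x))).2).symm
      have hlx : l x = none := by
        rcases h : l x with _ | j
        · rfl
        · exact absurd hx ((hl x).2 j h).1.ne'
      refine ⟨max 0 ((R - H) / (A x x).re), le_max_left _ _, ?_⟩
      have h1 : (A x x).re * max 0 ((R - H) / (A x x).re) ≤ ∑ x', (A x' x').re *
          (l x').elim (max 0 ((R - H) / (A x x).re)) (fun j => (j : ℝ)) := by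
        refine le_trans (le_of_eq ?_) (Finset.single_le_sum (f := fun x' => (A x' x').re *
          (l x').elim (max 0 ((R - H) / (A x x).re)) (fun j => (j : ℝ)))
          (fun x' _ => mul_nonneg (hA0 x') ?_) (Finset.mem_univ x))
        · simp [hlx]
        · rcases l x' with _ | j
          · exact le_max_left _ _
          · exact Nat.cast_nonneg _
      have h2 : R - H ≤ (A x x).re * max 0 ((R - H) / (A x x).re) := by
        rw [← div_le_iff₀' hApos]; exact le_max_right _ _
      linarith
  obtain ⟨X, hX, M, h, hMp, hM1, hMρ, hMσ⟩ := exists_scored_povm_of_blocks hρ (σ := σ)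
    (Q := Q) hQp hQ1
    (fun j => by rw [hQmul, if_pos rfl]) (fun j k hjk => by rw [hQmul, if_neg hjk])
    (ω := fun j => j.elim 0 fun j => Real.exp (-(j : ℝ)))
    (g := fun j => j.elim T fun j => (j : ℝ))
    (fun j => by
      have heq : (j.elim 0 fun j => Real.exp (-(j : ℝ)) : ℝ) • Q j - Q j * σ * Q j =
          V * Matrix.diagonal (fun x => ((if l x = j then
            (j.elim 0 fun j => Real.exp (-(j : ℝ)) : ℝ) - s x else 0 : ℝ) : ℂ)) * Vᴴ := by
        rw [hQ]
        conv_lhs => enter [2, 1, 2]; rw [hdec]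
        rw [hmul, hmul, ← Matrix.smul_mul, ← Matrix.mul_smul, ← Matrix.sub_mul, ← Matrix.mul_sub]
        congr 2
        ext x y
        by_cases hxy : x = y
        · subst hxy
          by_cases hx : l x = j
          · simp [hx]
          · simp [hx]
        · simp [hxy]
      rw [heq]
      refine hdiag _ fun x => ?_
      split_ifs with hx
      · rcases j with _ | j
        · simp [(hl x).1 hx]
        · exact sub_nonneg.mpr ((hl x).2 j hx).2.1
      · exact le_rfl)
    (fun j => by
      rcases j with _ | j
      · simp
      · simp [← Real.exp_add])
  refine ⟨X, hX, M, h, hMp, hM1, le_trans ?_ hMρ, hMσ⟩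
  rw [htrQ, ← hH]
  have hcard : (Fintype.card (Option (Fin (a + 1))) : ℝ) = a + 2 := by
    simp; ring
  rw [hcard]
  linarith

end ScoredPOVM

section Minimax

open scoped Matrix

/-- The score operators `∑ h x • M x` of measurements satisfying the moment constraint
`∑ Tr[σ M x] exp (h x) ≤ c`. -/
def scoreOps {κ : Type} [Fintype κ] [DecidableEq κ] (σ : Matrix κ κ ℂ) (c : ℝ) :
    Set (Matrix κ κ ℂ) :=
  {Z | ∃ (X : Type) (_ : Fintype X) (M : X → Matrix κ κ ℂ) (h : X → ℝ),
    (∀ x, (M x).PosSemidef) ∧ ∑ x, M x = 1 ∧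
    ∑ x, (σ * M x).trace.re * Real.exp (h x) ≤ c ∧ Z = ∑ x, h x • M x}

theorem convex_scoreOps {κ : Type} [Fintype κ] [DecidableEq κ] (σ : Matrix κ κ ℂ) (c : ℝ) :
    Convex ℝ (scoreOps σ c) := by
  rintro _ ⟨X, _, M, h, hM, hM1, hMs, rfl⟩ _ ⟨Y, _, N, g, hN, hN1, hNs, rfl⟩ a b ha hb hab
  refine ⟨X ⊕ Y, inferInstance, Sum.elim (fun x => a • M x) (fun y => b • N y), Sum.elim h g,
    ?_, ?_, ?_, ?_⟩
  · rintro (x | y)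
    · exact (hM x).smul ha
    · exact (hN y).smul hb
  · simp only [Fintype.sum_sum_type, Sum.elim_inl, Sum.elim_inr, ← Finset.smul_sum, hM1, hN1,
      ← add_smul, hab, one_smul]
  · simp only [Fintype.sum_sum_type, Sum.elim_inl, Sum.elim_inr, Matrix.mul_smul,
      Matrix.trace_smul, Complex.real_smul, Complex.re_ofReal_mul, mul_assoc, ← Finset.mul_sum]
    calc _ ≤ a * c + b * c := by gcongr
      _ = c := by rw [← add_mul, hab, one_mul]
  · simp only [Fintype.sum_sum_type, Sum.elim_inl, Sum.elim_inr, Finset.smul_sum]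
    congr 1 <;> exact Finset.sum_congr rfl fun _ _ => smul_comm _ _ _

theorem re_trace_mul_sum_smul {κ X : Type} [Fintype κ] [Fintype X] (ρ : Matrix κ κ ℂ)
    (M : X → Matrix κ κ ℂ) (h : X → ℝ) :
    (ρ * ∑ x, h x • M x).trace.re = ∑ x, (ρ * M x).trace.re * h x := by
  simp only [Finset.mul_sum, Matrix.trace_sum, Complex.re_sum, Matrix.mul_smul,
    Matrix.trace_smul, Complex.real_smul, Complex.re_ofReal_mul]
  exact Finset.sum_congr rfl fun _ _ => mul_comm _ _

/-- Von Neumann minimax for a compact convex set of matrices against a convex set of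
observables. -/
theorem exists_uniform_observable {κ : Type} [Fintype κ] {C Y : Set (Matrix κ κ ℂ)}
    (hC : Convex ℝ C) (hK : IsCompact C) (hne : C.Nonempty) (hY : Convex ℝ Y) {t : ℝ}
    (h : ∀ ρ ∈ C, ∃ Z ∈ Y, t < (ρ * Z).trace.re) :
    ∃ Z ∈ Y, ∀ ρ ∈ C, t < (ρ * Z).trace.re := by
  have hcont : ∀ Z : Matrix κ κ ℂ, Continuous fun ρ : Matrix κ κ ℂ => (ρ * Z).trace.re := fun Z =>
    Complex.continuous_re.comp (continuous_id.matrix_mul continuous_const).matrix_trace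
  have hcont' : ∀ ρ : Matrix κ κ ℂ, Continuous fun Z : Matrix κ κ ℂ => (ρ * Z).trace.re := fun ρ =>
    Complex.continuous_re.comp (continuous_const.matrix_mul continuous_id).matrix_trace
  choose! Z hZY hZ using h
  obtain ⟨s, hs, hcov⟩ := hK.elim_nhds_subcover (fun ρ => {ρ' | t < (ρ' * Z ρ).trace.re})
    fun ρ hρ => (isOpen_lt continuous_const (hcont (Z ρ))).mem_nhds (hZ ρ hρ)
  refine Sion.exists_lt_iInf_of_lt_iInf_of_finite (f := fun ρ Z : Matrix κ κ ℂ => (ρ * Z).trace.re)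
    hne hK (fun Z _ => (hcont Z).continuousOn.lowerSemicontinuousOn) (fun Z _ => ?_) hY
    (fun ρ _ => (hcont' ρ).continuousOn.upperSemicontinuousOn) (fun ρ _ => ?_) hC
    (s := Z '' s) (s.finite_toSet.image Z) (by rintro _ ⟨ρ, hρ, rfl⟩; exact hZY ρ (hs ρ hρ)) ?_
  · refine ConvexOn.quasiconvexOn ⟨hC, fun ρ _ ρ' _ a b _ _ _ => le_of_eq ?_⟩
    simp [Matrix.add_mul]
  · refine ConcaveOn.quasiconcaveOn ⟨hY, fun ρ _ ρ' _ a b _ _ _ => le_of_eq ?_⟩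
    simp [Matrix.mul_add]
  · intro ρ hρ
    obtain ⟨ρ', h1, h2⟩ := Set.mem_iUnion₂.mp (hcov hρ)
    exact ⟨Z ρ', ⟨ρ', h1, rfl⟩, h2⟩

end Minimax

section Symmetrise

open scoped Matrix Nat

theorem trace_tensorProdFam_mul_permCopies {κ : Type*} [Fintype κ] {n : ℕ} (g : Fin n → MatC κ)
    (π : Equiv.Perm (Fin n)) (M : MatN κ n) :
    (tensorProdFam g * permCopies π M).trace = (tensorProdFam (g ∘ π) * M).trace := by
  simp only [Matrix.trace, Matrix.diag, Matrix.mul_apply]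
  have key : ∀ i j : Fin n → κ, tensorProdFam g i j * permCopies π M j i =
      tensorProdFam (g ∘ π) (i ∘ π) (j ∘ π) * M (j ∘ π) (i ∘ π) := fun i j => by
    congr 1
    exact (Equiv.prod_comp π fun k => g k (i k) (j k)).symm
  simp only [key]
  have hsum : ∀ F : (Fin n → κ) → ℂ, ∑ i : Fin n → κ, F (i ∘ π) = ∑ i, F i := fun F =>
    Equiv.sum_comp (Equiv.arrowCongr π.symm (Equiv.refl κ)) F
  exact (Finset.sum_congr rfl fun i _ =>
    hsum fun j => tensorProdFam (g ∘ π) (i ∘ π) j * M j (i ∘ π)).trans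
      (hsum fun i => ∑ j, tensorProdFam (g ∘ π) i j * M j i)

/-- Average of `M` over all permutations of the tensor factors. -/
def symOp {κ : Type*} {n : ℕ} (M : MatN κ n) : MatN κ n :=
  ((n ! : ℝ)⁻¹) • ∑ π : Equiv.Perm (Fin n), permCopies π M

theorem posSemidef_symOp {κ : Type*} [Fintype κ] {n : ℕ} {M : MatN κ n} (h : M.PosSemidef) :
    (symOp M).PosSemidef := by
  have h1 : ∀ π : Equiv.Perm (Fin n), (permCopies π M).PosSemidef := fun π =>
    h.submatrix fun i => i ∘ π
  have h2 : (∑ π : Equiv.Perm (Fin n), permCopies π M).PosSemidef :=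
    Matrix.posSemidef_sum _ fun π _ => h1 π
  exact h2.smul (inv_nonneg.mpr (Nat.cast_nonneg _))

theorem sum_symOp {κ X : Type*} [Fintype κ] [DecidableEq κ] [Fintype X] {n : ℕ} {M : X → MatN κ n}
    (h : ∑ x, M x = 1) : ∑ x, symOp (M x) = 1 := by
  have h1 : ∀ π : Equiv.Perm (Fin n), ∑ x, permCopies π (M x) = 1 := fun π => by
    have h2 : ∑ x, permCopies π (M x) = permCopies π (∑ x, M x) := by
      ext i j; simp [permCopies, Matrix.sum_apply]
    rw [h2, h]
    ext i j
    simp only [permCopies, Matrix.one_apply]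
    exact if_congr (π.surjective.injective_comp_right.eq_iff) rfl rfl
  simp only [symOp]
  rw [← Finset.smul_sum, Finset.sum_comm]
  simp only [h1, Finset.sum_const, Finset.card_univ, Fintype.card_perm, Fintype.card_fin]
  rw [← Nat.cast_smul_eq_nsmul ℝ, smul_smul, inv_mul_cancel₀ (by positivity), one_smul]

theorem trace_tensorProdFam_mul_symOp {κ : Type*} [Fintype κ] {n : ℕ} (g : Fin n → MatC κ)
    (M : MatN κ n) :
    (tensorProdFam g * symOp M).trace = (symProd g * M).trace := by
  simp only [symOp, symProd, Matrix.mul_smul, Matrix.smul_mul, Matrix.trace_smul, Finset.mul_sum,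
    Finset.sum_mul, Matrix.trace_sum, trace_tensorProdFam_mul_permCopies]

theorem symProd_mem_convexHull {κ : Type*} {n : ℕ} {A : Set (MatC κ)} {g : Fin n → MatC κ}
    (hg : ∀ p, g p ∈ A) : symProd g ∈ convexHull ℝ (avSet A n) := by
  rw [symProd, Finset.smul_sum]
  refine (convex_convexHull ℝ _).sum_mem (fun _ _ => by positivity) ?_ fun π _ =>
    subset_convexHull ℝ _ ⟨g ∘ π, fun p => hg _, rfl⟩
  simp only [Finset.sum_const, Finset.card_univ, Fintype.card_perm, Fintype.card_fin]
  rw [nsmul_eq_mul, mul_inv_cancel₀ (by positivity)]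

end Symmetrise

section Exponents

open scoped Matrix

theorem typeII_nonneg {κ : Type*} [Fintype κ] [DecidableEq κ] {A B : Set (Matrix κ κ ℂ)} {ε : ℝ}
    (hB : ∀ σ ∈ B, IsState σ) : 0 ≤ typeII A B ε := by
  refine Real.sInf_nonneg ?_
  rintro _ ⟨E, hE, -, -, rfl⟩
  refine Real.sSup_nonneg ?_
  rintro _ ⟨σ, hσ, rfl⟩
  exact re_trace_mul_nonneg (hB σ hσ).1 hE

theorem steinExponent_le_of_subset_convexHull {ι : Type*} [Fintype ι] [DecidableEq ι]
    {A B B' : ∀ n : ℕ, Set (MatN ι n)} (hB : ∀ n, ∀ σ ∈ B n, IsState σ)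
    (h : ∀ n, B' n ⊆ convexHull ℝ (B n)) : steinExponent A B ≤ steinExponent A B' := by
  refine iInf₂_mono fun ε hε => liminf_le_liminf (Eventually.of_forall fun n => ?_)
  refine cFrac_mul_mono n (negLog_antitone ?_)
  refine le_of_forall_gt_imp_ge_of_dense fun b hb => ?_
  obtain ⟨E, h1, h2, h3, h4⟩ := hasTest_of_typeII_lt (hB n) hε.1.le hb
  exact typeII_le_of_hasTest (fun σ hσ => isState_of_mem_convexHull (hB n) σ (h n hσ))
    ((typeII_nonneg (hB n)).trans hb.le)
    ⟨E, h1, h2, h3, fun σ hσ => re_trace_mul_le_of_mem_convexHull h4 σ (h n hσ)⟩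

theorem iidSet_subset_avSet {ι : Type*} (C : Set (MatC ι)) (n : ℕ) : iidSet C n ⊆ avSet C n := by
  rintro _ ⟨σ, hσ, rfl⟩
  exact ⟨fun _ => σ, fun _ => hσ, rfl⟩

theorem avSet_mono {ι : Type*} {C C' : Set (MatC ι)} (h : C ⊆ C') (n : ℕ) :
    avSet C n ⊆ avSet C' n := by
  rintro _ ⟨f, hf, rfl⟩
  exact ⟨f, fun p => h (hf p), rfl⟩

theorem avSet_convexHull_subset {ι : Type*} (B : Set (MatC ι)) (n : ℕ) :
    avSet (convexHull ℝ B) n ⊆ convexHull ℝ (avSet B n) := by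
  have hlin : ∀ (f : Fin n → MatC ι) (p : Fin n), IsLinearMap ℝ fun x : MatC ι =>
      tensorProdFam (Function.update f p x) := fun f p => by
    have hsplit : ∀ (x : MatC ι) (i j : Fin n → ι), tensorProdFam (Function.update f p x) i j =
        x (i p) (j p) * ∏ q ∈ Finset.univ.erase p, f q (i q) (j q) := fun x i j => by
      rw [tensorProdFam, ← Finset.mul_prod_erase _ _ (Finset.mem_univ p), Function.update_self]
      congr 1
      refine Finset.prod_congr rfl fun q hq => ?_
      rw [Function.update_of_ne (Finset.ne_of_mem_erase hq)]
    constructor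
    · intro x y
      ext i j
      simp only [hsplit, Matrix.add_apply, add_mul]
    · intro c x
      ext i j
      simp only [hsplit, Matrix.smul_apply, Complex.real_smul, mul_assoc]
  have key : ∀ (s : Finset (Fin n)) (f : Fin n → MatC ι), (∀ p ∈ s, f p ∈ convexHull ℝ B) →
      (∀ p ∉ s, f p ∈ B) → tensorProdFam f ∈ convexHull ℝ (avSet B n) := by
    intro s
    induction s using Finset.induction_on with
    | empty =>
      intro f _ hf
      exact subset_convexHull ℝ _ ⟨f, fun p => hf p (Finset.notMem_empty p), rfl⟩
    | insert p s hp ih =>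
      intro f hs hf
      have h1 : B ⊆ (fun x => tensorProdFam (Function.update f p x)) ⁻¹'
          convexHull ℝ (avSet B n) := fun x hx => by
        refine ih _ (fun q hq => ?_) fun q hq => ?_
        · rw [Function.update_of_ne (by rintro rfl; exact hp hq)]
          exact hs q (Finset.mem_insert_of_mem hq)
        · by_cases hqp : q = p
          · subst hqp; simpa using hx
          · rw [Function.update_of_ne hqp]
            exact hf q (by simp [hqp, hq])
      have h2 := convexHull_min h1 ((convex_convexHull ℝ _).is_linear_preimage (hlin f p))
        (hs p (Finset.mem_insert_self p s))
      simpa using h2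
  rintro _ ⟨f, hf, rfl⟩
  exact key Finset.univ f (fun p _ => hf p) fun p hp => absurd (Finset.mem_univ p) hp

end Exponents

section Achievability

open scoped Matrix

/-- One-shot achievability: a lower bound on the relative entropies to the universal mixture
gives, up to subexponential corrections, an achievable Stein exponent. -/
theorem exists_le_steinExponent_of_le_relEnt {κ : Type} [Fintype κ] [DecidableEq κ]
    {A C : Set (MatC κ)} (hA : ∀ ρ ∈ A, IsState ρ) (hAK : IsCompact A) (hAne : A.Nonempty)
    (hC : Convex ℝ C) (hK : IsCompact C) (hne : C.Nonempty) (hst : ∀ σ ∈ C, IsState σ)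
    {s : ℕ → ↥C} (hs : DenseRange s) (μ : Measure ↥C) [IsProbabilityMeasure μ]
    (hμ : ∀ i, 0 < μ.real {s i}) {ε : ℝ} (hε : 0 < ε) :
    ∃ (N : ℕ) (c : ℝ), ∀ k : ℕ, 0 < k → ∀ R : ℝ,
      (∀ ρ ∈ convexHull ℝ (avSet A k), (R : EReal) ≤ relEnt ρ (iidMix μ k)) →
      (((R - ε * k - N * Real.log (k + 1) - c) / k : ℝ) : EReal) ≤
        steinExponent (avSet A) (avSet C) := by
  have hδ : Real.exp (-(ε / 2)) < 1 := Real.exp_zero ▸ Real.exp_lt_exp.mpr (by linarith)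
  obtain ⟨N, K, hK0, hdom⟩ := exists_iidMix_sub_symProd hC hK hne hst hs μ hμ
    (δ := 1 - Real.exp (-(ε / 2))) (by linarith) (by linarith [Real.exp_pos (-(ε / 2))])
  obtain ⟨a, ha⟩ := exists_eigenvalue_iidMix_ge hC hK hne hst hs μ hμ
  refine ⟨N + 1, Real.log (a + 2) + 3 + Real.log K + Real.log 2, fun k hk R hR => ?_⟩
  have hσ := isState_iidMix hst μ k
  have hstA := isState_of_mem_convexHull (isState_of_mem_avSet hA (n := k))
  set t : ℝ := R - Real.log ((a * (k + 1) : ℕ) + 2) - 2 with ht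
  obtain ⟨Z, ⟨X, _, M, h, hM, hM1, hMσ, rfl⟩, hZ⟩ := exists_uniform_observable (t := t)
    (convex_convexHull ℝ (avSet A k))
    (isCompact_convexHull_of_finiteDimensional (isCompact_avSet hAK k))
    (by
      obtain ⟨ρ, hρ⟩ := hAne
      exact ⟨_, subset_convexHull ℝ _ ⟨fun _ => ρ, fun _ => hρ, rfl⟩⟩)
    (convex_scoreOps (iidMix μ k) 2) (fun ρ hρ => by
      obtain ⟨X, _, M, h, hM, hM1, hMρ, hMσ⟩ := exists_scored_povm (hstA ρ hρ) hσ
        (ha k hσ.1.1) (hR ρ hρ)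
      refine ⟨_, ⟨X, inferInstance, M, h, hM, hM1, hMσ, rfl⟩, ?_⟩
      rw [re_trace_mul_sum_smul]
      linarith)
  have hfac : ((1 - (1 - Real.exp (-(ε / 2))))⁻¹ ^ k * (1 - (1 - Real.exp (-(ε / 2))))⁻¹ ^ k) =
      Real.exp (ε * k) := by
    rw [sub_sub_cancel, ← Real.exp_neg, ← Real.exp_nat_mul, ← Real.exp_add]
    congr 1; ring
  have hk1 : (0 : ℝ) < k + 1 := by positivity
  have hmain := le_steinExponent_of_scored_povm hk hA hst (M := fun x => symOp (M x))
    (fun x => posSemidef_symOp (hM x)) (sum_symOp hM1) h (R := t)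
    (s := ε * k + N * Real.log (k + 1) + Real.log K + Real.log 2) (by
      rintro _ ⟨g, hg, rfl⟩
      simp only [trace_tensorProdFam_mul_symOp]
      rw [← re_trace_mul_sum_smul]
      exact (hZ _ (symProd_mem_convexHull hg)).le) (by
      rintro _ ⟨g, hg, rfl⟩
      simp only [trace_tensorProdFam_mul_symOp]
      have h1 : ∀ x, (symProd g * M x).trace.re ≤
          K * (k + 1 : ℝ) ^ N * Real.exp (ε * k) * (iidMix μ k * M x).trace.re := fun x => by
        have := re_trace_mul_mono (hdom k hk g hg) (hM x)
        rwa [hfac, Matrix.smul_mul, Matrix.trace_smul, Complex.real_smul,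
          Complex.re_ofReal_mul] at this
      calc ∑ x, (symProd g * M x).trace.re * Real.exp (h x)
          ≤ ∑ x, K * (k + 1 : ℝ) ^ N * Real.exp (ε * k) * (iidMix μ k * M x).trace.re *
            Real.exp (h x) := Finset.sum_le_sum fun x _ =>
              mul_le_mul_of_nonneg_right (h1 x) (Real.exp_pos _).le
        _ = K * (k + 1 : ℝ) ^ N * Real.exp (ε * k) *
            ∑ x, (iidMix μ k * M x).trace.re * Real.exp (h x) := by
          rw [Finset.mul_sum]; exact Finset.sum_congr rfl fun _ _ => mul_assoc _ _ _
        _ ≤ K * (k + 1 : ℝ) ^ N * Real.exp (ε * k) * 2 := by gcongr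
        _ = _ := by
          rw [Real.exp_add, Real.exp_add, Real.exp_add, Real.exp_log hK0, Real.exp_log two_pos,
            Real.exp_nat_mul, Real.exp_log hk1]
          ring) one_pos
  refine le_trans ?_ hmain
  have hlog : Real.log ((a * (k + 1) : ℕ) + 2) ≤ Real.log (a + 2) + Real.log (k + 1) := by
    rw [← Real.log_mul (by positivity) hk1.ne']
    refine Real.log_le_log (by positivity) ?_
    push_cast
    nlinarith [(Nat.cast_nonneg k : (0 : ℝ) ≤ k)]
  rw [EReal.coe_le_coe_iff]
  refine div_le_div_of_nonneg_right ?_ (Nat.cast_nonneg k)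
  rw [ht]
  push_cast at hlog ⊢
  linarith

theorem limsup_relEnt_le_steinExponent {κ : Type} [Fintype κ] [DecidableEq κ]
    {A C : Set (MatC κ)} (hA : ∀ ρ ∈ A, IsState ρ) (hAK : IsCompact A) (hAne : A.Nonempty)
    (hC : Convex ℝ C) (hK : IsCompact C) (hne : C.Nonempty) (hst : ∀ σ ∈ C, IsState σ)
    {s : ℕ → ↥C} (hs : DenseRange s) (μ : Measure ↥C) [IsProbabilityMeasure μ]
    (hμ : ∀ i, 0 < μ.real {s i}) :
    limsup (fun n : ℕ => cFrac n * ⨅ ρn ∈ convexHull ℝ (avSet A n), relEnt ρn (iidMix μ n)) atTop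
      ≤ steinExponent (avSet A) (avSet C) := by
  refine EReal.ge_of_forall_gt_iff_ge.mp fun r hr => ?_
  obtain ⟨r', hr', hr'L⟩ := EReal.lt_iff_exists_real_btwn.mp hr
  have hrr : r < r' := EReal.coe_lt_coe_iff.mp hr'
  obtain ⟨N, c, hNc⟩ := exists_le_steinExponent_of_le_relEnt hA hAK hAne hC hK hne hst hs μ hμ
    (sub_pos.mpr hrr)
  have hlog : Tendsto (fun k : ℕ => Real.log (k + 1) / k) atTop (𝓝 0) := by
    have h1 := (Real.tendsto_pow_log_div_mul_add_atTop 1 (-1) 1 one_ne_zero).comp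
      (tendsto_atTop_add_const_right atTop (1 : ℝ) tendsto_natCast_atTop_atTop)
    refine h1.congr fun k => ?_
    simp
  have hlim : Tendsto (fun k : ℕ => ((r - N * (Real.log (k + 1) / k) - c * (k : ℝ)⁻¹ : ℝ) : EReal))
      atTop (𝓝 (r : EReal)) := by
    refine (continuous_coe_real_ereal.tendsto _).comp ?_
    simpa using (tendsto_const_nhds.sub (hlog.const_mul (N : ℝ))).sub
      ((tendsto_inv_atTop_nhds_zero_nat (𝕜 := ℝ)).const_mul c)
  refine le_of_tendsto_of_frequently hlim ?_
  refine ((frequently_lt_of_lt_limsup (by isBoundedDefault) hr'L).and_eventually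
    (eventually_gt_atTop 0)).mono fun k hk => ?_
  obtain ⟨hk, hk0⟩ := hk
  have hk0' : (0 : ℝ) < k := by exact_mod_cast hk0
  refine le_trans (le_of_eq ?_) (hNc k hk0 (r' * k) fun ρ hρ => ?_)
  · rw [EReal.coe_eq_coe_iff]
    field_simp
    ring
  · refine le_trans ?_ (iInf₂_le (f := fun ρ _ => relEnt ρ (iidMix μ k)) ρ hρ)
    by_contra hlt
    push Not at hlt
    refine absurd hk (not_lt.mpr ((cFrac_mul_mono k hlt.le).trans (le_of_eq ?_)))
    rw [cFrac, ← EReal.coe_mul, EReal.coe_eq_coe_iff]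
    field_simp

end Achievability

/-- **Arbitrarily varying null versus arbitrarily varying alternative.**
`Stein(𝒜₁^{av}‖ℬ₁^{av}) = Stein(𝒜₁^{av}‖co(ℬ₁)^{av}) = Stein(𝒜₁^{av}‖co(ℬ₁)^{iid})
  = min*_{μ∈𝒫(co(ℬ₁))} lim_n (1/n) inf_{ρ_n∈co(𝒜₁^{⊗n,av})} D(ρ_n‖∫dμ(σ) σ^{⊗n})`. -/
theorem composite_av_vs_av (d : ℕ)
    (A1 B1 : Set (MatC (Fin d)))
    (hA_states : ∀ ρ ∈ A1, IsState ρ) (hA_ne : A1.Nonempty) (hA_closed : IsClosed A1)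
    (hB_states : ∀ σ ∈ B1, IsState σ) (hB_ne : B1.Nonempty) (hB_closed : IsClosed B1) :
    ∃ S : EReal,
      steinExponent (avSet A1) (avSet B1) = S ∧
      steinExponent (avSet A1) (avSet (convexHull ℝ B1)) = S ∧
      steinExponent (avSet A1) (iidSet (convexHull ℝ B1)) = S ∧
      (∃ μ : Measure ↥(convexHull ℝ B1), IsProbabilityMeasure μ ∧
        Filter.Tendsto
          (fun n : ℕ => cFrac n * ⨅ ρn ∈ convexHull ℝ (avSet A1 n), relEnt ρn (iidMix μ n))
          Filter.atTop (nhds S)) ∧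
      (∀ μ : Measure ↥(convexHull ℝ B1), IsProbabilityMeasure μ → ∀ L : EReal,
        Filter.Tendsto
          (fun n : ℕ => cFrac n * ⨅ ρn ∈ convexHull ℝ (avSet A1 n), relEnt ρn (iidMix μ n))
          Filter.atTop (nhds L) → S ≤ L) := by
  have hAK := isCompact_of_isClosed_of_isState hA_states hA_closed
  have hC : Convex ℝ (convexHull ℝ B1) := convex_convexHull ℝ B1
  have hK : IsCompact (convexHull ℝ B1) := isCompact_convexHull_of_finiteDimensional
    (isCompact_of_isClosed_of_isState hB_states hB_closed)
  have hne : (convexHull ℝ B1).Nonempty := hB_ne.convexHull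
  have hst := isState_of_mem_convexHull hB_states
  have : Nonempty ↥(convexHull ℝ B1) := hne.to_subtype
  set S := steinExponent (avSet A1) (avSet (convexHull ℝ B1)) with hS
  have hle : S ≤ steinExponent (avSet A1) (iidSet (convexHull ℝ B1)) :=
    steinExponent_le_of_subset_convexHull (fun n => isState_of_mem_avSet hst)
      fun n => (iidSet_subset_avSet _ n).trans (subset_convexHull ℝ _)
  obtain ⟨s, hs⟩ := TopologicalSpace.exists_dense_seq ↥(convexHull ℝ B1)
  obtain ⟨μ, hμp, hμ⟩ := exists_measure_pos_singleton s
  have hlimsup := limsup_relEnt_le_steinExponent hA_states hAK hA_ne hC hK hne hst hs μ hμ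
  have hlim : Tendsto
      (fun n : ℕ => cFrac n * ⨅ ρn ∈ convexHull ℝ (avSet A1 n), relEnt ρn (iidMix μ n))
      atTop (nhds S) :=
    tendsto_of_le_liminf_of_limsup_le
      (hle.trans (steinExponent_iid_le_liminf hA_states hst μ)) hlimsup
  have hiid : steinExponent (avSet A1) (iidSet (convexHull ℝ B1)) = S :=
    le_antisymm ((steinExponent_iid_le_liminf hA_states hst μ).trans_eq hlim.liminf_eq) hle
  refine ⟨S, le_antisymm ?_ ?_, rfl, hiid, ⟨μ, hμp, hlim⟩, fun ν _ L hL => ?_⟩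
  · exact steinExponent_le_of_subset_convexHull (fun n => isState_of_mem_avSet hB_states)
      (avSet_convexHull_subset B1)
  · exact steinExponent_le_of_subset_convexHull (fun n => isState_of_mem_avSet hst)
      fun n => (avSet_mono (subset_convexHull ℝ B1) n).trans (subset_convexHull ℝ _)
  · rw [← hiid, ← hL.liminf_eq]
    exact steinExponent_iid_le_liminf hA_states hst ν

end QSanov
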